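/- Fix real numbers α, β₁, β₂ ≥ 1 with (α, β₁) ≠ (1,1), and set C(α,β₁,β₂) = (1/π²)·log( ((αβ₂+1)/(αβ₂)) · (αβ₁/(αβ₁−1)) ). Then for every ε > 0 there is a constant K = K(α,β₁,β₂,ε) > 0 such that for all R > 0, the number r_E(α,β₁,β₂;R) of E-reduced quadratic irrationals ω with ϱ_E(ω) ≤ R, ω ≥ α, and −1/β₂ ≤ ω* ≤ 1/β₁ satisfies |r_E(α,β₁,β₂;R) − C(α,β₁,β₂)·e^R| ≤ K·e^{(3/4+ε)R}. -/

import Mathlib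

noncomputable section

/-- `ω'` is the conjugate of the quadratic irrational `ω`: both are roots of the
minimal integer polynomial `A X^2 + B X + C` of `ω` (with `A > 0`, `gcd(A,B,C) = 1`),
and `ω' ≠ ω`. -/
def IsConjPair (ω ω' : ℝ) : Prop :=
  Irrational ω ∧ ∃ A B C : ℤ, 0 < A ∧ Int.gcd (Int.gcd A B : ℤ) C = 1 ∧
    (A : ℝ) * ω ^ 2 + B * ω + C = 0 ∧ (A : ℝ) * ω' ^ 2 + B * ω' + C = 0 ∧ ω' ≠ ω

/-- The quadratic irrational `ω` has discriminant `Δ = B^2 - 4AC`, where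
`A X^2 + B X + C` is its minimal integer polynomial (`A > 0`, `gcd(A,B,C) = 1`). -/
def HasDisc (ω : ℝ) (Δ : ℤ) : Prop :=
  Irrational ω ∧ ∃ A B C : ℤ, 0 < A ∧ Int.gcd (Int.gcd A B : ℤ) C = 1 ∧
    (A : ℝ) * ω ^ 2 + B * ω + C = 0 ∧ Δ = B ^ 2 - 4 * A * C

/-- The matrix `M(a,e) = (a, e; 1, 0)`. -/
def Mmat (a e : ℤ) : Matrix (Fin 2) (Fin 2) ℤ := !![a, e; 1, 0]

/-- The spectral radius of a 2x2 integer matrix with trace `t`, namely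
`(t + sqrt (t^2 - 4)) / 2`. -/
def specRad (σ : Matrix (Fin 2) (Fin 2) ℤ) : ℝ :=
  ((σ.trace : ℝ) + Real.sqrt ((σ.trace : ℝ) ^ 2 - 4)) / 2

/-- First ECF digit: `a₁(u) = 2⎣(u+1)/2⎦`. -/
def aE (u : ℝ) : ℤ := 2 * ⌊(u + 1) / 2⌋

/-- Sign digit: `e₁(u) = sgn (u - a₁(u)) ∈ {±1}`. -/
def eE (u : ℝ) : ℤ := if (aE u : ℝ) < u then 1 else -1

/-- The ECF Gauss shift `T_E(u) = e₁(u) / (u - a₁(u))`. -/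
def TE (u : ℝ) : ℝ := (eE u : ℝ) / (u - aE u)

/-- The least period of `ω` under `T_E` (junk value `0` if `ω` is not periodic). -/
def perE (ω : ℝ) : ℕ := sInf {n : ℕ | 0 < n ∧ TE^[n] ω = ω}

/-- `Ω_E(ω) = M(a₁,e₁) ⋯ M(aₙ,eₙ)`, where `n = per(ω)` and `(aᵢ, eᵢ)` are the
ECF digits of `ω`. -/
def OmegaE (ω : ℝ) : Matrix (Fin 2) (Fin 2) ℤ :=
  ((List.range (perE ω)).map (fun i => Mmat (aE (TE^[i] ω)) (eE (TE^[i] ω)))).prod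

/-- `Ω̃_E(ω)`: equal to `Ω_E(ω)` if `det Ω_E(ω) = 1`, and to `Ω_E(ω)²` otherwise. -/
def OmegaTildeE (ω : ℝ) : Matrix (Fin 2) (Fin 2) ℤ :=
  if (OmegaE ω).det = 1 then OmegaE ω else OmegaE ω ^ 2

/-- The length `ϱ_E(ω) = 2 log 𝔯(Ω̃_E(ω))`. -/
def rhoE (ω : ℝ) : ℝ := 2 * Real.log (specRad (OmegaTildeE ω))

section
open Polynomial Finset

section Stepanov

/-- degree in the inner variable bounded -/
def degU {F : Type*} [Field F] (Q : F[X][X]) (B : ℕ) : Prop := ∀ l, (Q.coeff l).natDegree ≤ B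

lemma degU_mono {F : Type*} [Field F] {Q : F[X][X]} {B B' : ℕ} (h : degU Q B) (hb : B ≤ B') :
    degU Q B' := fun l => (h l).trans hb

lemma degU_add {F : Type*} [Field F] {P Q : F[X][X]} {B : ℕ} (hP : degU P B) (hQ : degU Q B) :
    degU (P + Q) B := by
  intro l
  rw [coeff_add]
  exact (natDegree_add_le _ _).trans (max_le (hP l) (hQ l))

lemma degU_sub {F : Type*} [Field F] {P Q : F[X][X]} {B : ℕ} (hP : degU P B) (hQ : degU Q B) :
    degU (P - Q) B := by
  intro l
  rw [coeff_sub]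
  exact (natDegree_sub_le _ _).trans (max_le (hP l) (hQ l))

lemma degU_sum {F : Type*} [Field F] {ι : Type*} (s : Finset ι) {f : ι → F[X][X]} {B : ℕ}
    (h : ∀ i ∈ s, degU (f i) B) : degU (∑ i ∈ s, f i) B := by
  intro l
  rw [finsetSum_coeff]
  exact natDegree_sum_le_of_forall_le _ _ (fun i hi => h i hi l)

lemma degU_mul {F : Type*} [Field F] {P Q : F[X][X]} {B B' : ℕ} (hP : degU P B) (hQ : degU Q B') :
    degU (P * Q) (B + B') := by
  intro l
  rw [coeff_mul]
  refine natDegree_sum_le_of_forall_le _ _ (fun i _ => ?_)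
  exact natDegree_mul_le.trans (add_le_add (hP _) (hQ _))

lemma degU_C {F : Type*} [Field F] {f : F[X]} {B : ℕ} (h : f.natDegree ≤ B) : degU (C f) B := by
  intro l
  rw [coeff_C]
  split_ifs
  · exact h
  · simp

lemma degU_pow {F : Type*} [Field F] {P : F[X][X]} {B : ℕ} (hP : degU P B) (k : ℕ) :
    degU (P ^ k) (k * B) := by
  induction k with
  | zero => simpa using degU_C (F := F) (f := 1) (B := 0) (by simp)
  | succ k ih =>
    rw [pow_succ, Nat.succ_mul]
    exact degU_mul ih hP

lemma degU_lin {F : Type*} [Field F] : degU ((X : F[X][X]) + C X) 1 := by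
  apply degU_add
  · intro l
    rw [coeff_X]
    split_ifs <;> simp
  · exact degU_C (by simp)

lemma degU_lin_pow {F : Type*} [Field F] (k : ℕ) : degU (((X : F[X][X]) + C X) ^ k) k := by
  simpa using degU_pow (degU_lin (F := F)) k

lemma sum_ne_zero_of_degrees {F : Type*} [Field F] (P : ℕ → F[X]) (e : ℕ)
    (hP : ∀ n, (P n).natDegree = n + e) (hP0 : ∀ n, P n ≠ 0) (L : ℕ) (r : Fin L → F)
    (hr : r ≠ 0) : ∑ n, C (r n) * P n ≠ 0 := by
  classical
  obtain ⟨n1, hn1⟩ := Function.ne_iff.mp hr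
  set S : Finset (Fin L) := univ.filter (fun n => r n ≠ 0)
  have hS : S.Nonempty := ⟨n1, by simpa [S] using hn1⟩
  set n0 := S.max' hS
  have hn0 : r n0 ≠ 0 := by
    have := S.max'_mem hS
    simpa [S] using this
  intro h0
  have h1 : (∑ n, C (r n) * P n).coeff (n0 + e) = r n0 * (P n0).coeff (n0 + e) := by
    rw [finsetSum_coeff]
    rw [Finset.sum_eq_single n0]
    · simp
    · intro n _ hn
      rw [coeff_C_mul]
      by_cases hr0 : r n = 0
      · simp [hr0]
      · have hle : n ≤ n0 := S.le_max' n (by simpa [S] using hr0)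
        have hlt : n < n0 := lt_of_le_of_ne hle hn
        rw [coeff_eq_zero_of_natDegree_lt, mul_zero]
        rw [hP]
        have : (n : ℕ) < n0 := hlt
        omega
    · simp
  rw [h0, coeff_zero] at h1
  have h2 : (P n0).coeff (n0 + e) ≠ 0 := by
    rw [← hP n0]
    simpa using hP0 n0
  exact mul_ne_zero hn0 h2 h1.symm

/-- the polynomial `X^D * trace` -/
noncomputable def stG {F : Type*} [Field F] (p m D : ℕ) (a b : F) : F[X] :=
  ∑ t ∈ range (2 * m), (C a * X ^ (D + p ^ t) + C b * X ^ (D - p ^ t))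

lemma stG_natDegree {F : Type*} [Field F] (p m : ℕ) (hp : 2 ≤ p) (hm : 1 ≤ m) (a b : F)
    (ha : a ≠ 0) : (stG p m (p ^ (2 * m - 1)) a b).natDegree = 2 * p ^ (2 * m - 1) := by
  set D := p ^ (2 * m - 1) with hD
  have hDpos : 0 < D := by positivity
  have h2m : 2 * m = (2 * m - 1) + 1 := by omega
  unfold stG
  rw [h2m, sum_range_succ, ← hD]
  have hlt : (∑ t ∈ range (2 * m - 1), (C a * X ^ (D + p ^ t) + C b * X ^ (D - p ^ t))
      + C b * X ^ (D - D)).natDegree < 2 * D := by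
    refine lt_of_le_of_lt (b := 2 * D - 1) ?_ (by omega)
    refine (natDegree_add_le _ _).trans (max_le ?_ ?_)
    · refine natDegree_sum_le_of_forall_le _ _ (fun t ht => ?_)
      have : p ^ t < D := Nat.pow_lt_pow_right (by omega) (by simpa using ht)
      refine (natDegree_add_le _ _).trans (max_le ?_ ?_)
      · exact (natDegree_C_mul_X_pow_le _ _).trans (by omega)
      · exact (natDegree_C_mul_X_pow_le _ _).trans (by omega)
    · exact (natDegree_C_mul_X_pow_le _ _).trans (by omega)
  have hre : ∑ t ∈ range (2 * m - 1), (C a * X ^ (D + p ^ t) + C b * X ^ (D - p ^ t))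
      + (C a * X ^ (D + D) + C b * X ^ (D - D)) =
      (∑ t ∈ range (2 * m - 1), (C a * X ^ (D + p ^ t) + C b * X ^ (D - p ^ t))
      + C b * X ^ (D - D)) + C a * X ^ (D + D) := by ring
  rw [hre, natDegree_add_eq_right_of_natDegree_lt]
  · rw [natDegree_C_mul_X_pow _ _ ha]; ring
  · rw [natDegree_C_mul_X_pow _ _ ha]; omega

noncomputable def stP {F : Type*} [Field F] (p m D : ℕ) (a b : F) (n : ℕ) : F[X] :=
  X ^ (n % D + p * D * (n / D / p)) * stG p m D a b ^ (n / D % p) * X ^ (D * (p - 1 - n / D % p))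

lemma stP_ne_zero {F : Type*} [Field F] (p m : ℕ) (hp : 2 ≤ p) (hm : 1 ≤ m) (a b : F)
    (ha : a ≠ 0) (n : ℕ) : stP p m (p ^ (2 * m - 1)) a b n ≠ 0 := by
  have hG : stG p m (p ^ (2 * m - 1)) a b ≠ 0 := by
    intro h
    have := stG_natDegree p m hp hm a b ha
    rw [h] at this
    have hDpos : 0 < p ^ (2 * m - 1) := by positivity
    simp at this
    omega
  unfold stP
  exact mul_ne_zero (mul_ne_zero (pow_ne_zero _ X_ne_zero) (pow_ne_zero _ hG))
    (pow_ne_zero _ X_ne_zero)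

lemma stP_natDegree {F : Type*} [Field F] (p m : ℕ) (hp : 2 ≤ p) (hm : 1 ≤ m) (a b : F)
    (ha : a ≠ 0) (n : ℕ) : (stP p m (p ^ (2 * m - 1)) a b n).natDegree =
      n + p ^ (2 * m - 1) * (p - 1) := by
  have hne := stP_ne_zero p m hp hm a b ha n
  unfold stP at hne ⊢
  rw [natDegree_mul (left_ne_zero_of_mul hne) (right_ne_zero_of_mul hne),
    natDegree_mul (left_ne_zero_of_mul (left_ne_zero_of_mul hne))
      (right_ne_zero_of_mul (left_ne_zero_of_mul hne)), natDegree_pow, natDegree_pow,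
      natDegree_pow, natDegree_X, stG_natDegree p m hp hm a b ha]
  set D := p ^ (2 * m - 1) with hD
  have h1 : n = n % D + D * (n / D) := (Nat.mod_add_div n D).symm
  have h2 : n / D = (n / D) % p + p * (n / D / p) := (Nat.mod_add_div _ p).symm
  have h3 : n / D % p < p := Nat.mod_lt _ (by omega)
  set j := n / D % p
  set i := n / D / p
  set k := n % D
  obtain ⟨l, hl⟩ : ∃ l, p - 1 = j + l := ⟨p - 1 - j, by omega⟩
  have hl2 : p - 1 - j = l := by omega
  rw [h1, h2, hl2, hl]
  ring

/-- bivariate version of `G` -/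
noncomputable def stH {F : Type*} [Field F] (p m : ℕ) (a b c : F) : F[X][X] :=
  C (C c * X ^ (p ^ m)) + ∑ t ∈ range m,
    (C (C a * X ^ (p ^ m)) * ((X + C X) ^ (p ^ t) - C (X ^ (p ^ t))) +
      C (C b) * ((X + C X) ^ (p ^ m - p ^ t) - C (X ^ (p ^ m - p ^ t))))

lemma stH_degU {F : Type*} [Field F] (p m : ℕ) (hp : 2 ≤ p) (a b c : F) :
    degU (stH p m a b c) (2 * p ^ m) := by
  unfold stH
  apply degU_add
  · exact degU_C ((natDegree_C_mul_X_pow_le _ _).trans (by omega))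
  · refine degU_sum _ (fun t ht => ?_)
    have ht' : p ^ t ≤ p ^ m := Nat.pow_le_pow_right (by omega) (by simp at ht; omega)
    apply degU_add
    · rw [two_mul]
      apply degU_mul
      · exact degU_C ((natDegree_C_mul_X_pow_le _ _))
      · apply degU_sub
        · exact degU_mono (degU_lin_pow _) ht'
        · exact degU_C (by simpa using ht')
    · refine degU_mono (B := 0 + p ^ m) ?_ (by omega)
      apply degU_mul
      · exact degU_C (by simp)
      · apply degU_sub
        · exact degU_mono (degU_lin_pow _) (by omega)
        · exact degU_C (by simp)

noncomputable def stQ {F : Type*} [Field F] (p m D : ℕ) (a b c : F) (n : ℕ) : F[X][X] :=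
  C (X ^ (n / D / p + p ^ m * (p - 1 - n / D % p))) * (X + C X) ^ (n % D)
    * stH p m a b c ^ (n / D % p)

lemma stQ_degU {F : Type*} [Field F] (p m D I : ℕ) (hp : 2 ≤ p) (hD : 0 < D) (a b c : F) (n : ℕ)
    (hn : n < p * I * D) : degU (stQ p m D a b c n) (D + I + 2 * p ^ m * p - 1) := by
  unfold stQ
  have h3 : n / D % p < p := Nat.mod_lt _ (by omega)
  have hi : n / D / p < I := by
    rw [Nat.div_div_eq_div_mul, Nat.div_lt_iff_lt_mul (by positivity)]
    calc n < p * I * D := hn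
      _ = I * (D * p) := by ring
  have hk : n % D < D := Nat.mod_lt _ hD
  refine degU_mono (degU_mul (degU_mul (degU_C (f := X ^ _) (natDegree_X_pow_le _))
    (degU_lin_pow _)) (degU_pow (stH_degU p m hp a b c) _)) ?_
  set j := n / D % p
  have h4 : p ^ m * (p - 1 - j) + j * (2 * p ^ m) ≤ 2 * p ^ m * p := by
    obtain ⟨l, hl⟩ : ∃ l, p = j + l + 1 := ⟨p - 1 - j, by omega⟩
    have hl2 : p - 1 - j = l := by omega
    rw [hl2]
    generalize p ^ m = M
    rw [hl]
    nlinarith [Nat.zero_le (M * l), Nat.zero_le M]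
  omega

end Stepanov

end

section
open Polynomial Finset

section Stepanov2

/-- the key congruence in a ring where `ξ^M = y^M`. -/
lemma st_key {F B : Type*} [Field F] [CommRing B] [Algebra F B] (p m : ℕ) (hp : p.Prime)
    (hm : 1 ≤ m) (a b c x : F) (hx : x ≠ 0) (hxq : x ^ (p ^ (2 * m)) = x)
    (hT : ∑ t ∈ range (2 * m), (a * x ^ (p ^ t) + b * (x⁻¹) ^ (p ^ t)) = c)
    (ξ : B) (hξ : ξ ^ (p ^ m) = (algebraMap F B x) ^ (p ^ m)) (n : ℕ) :
    aeval ξ (stP p m (p ^ (2 * m - 1)) a b n) =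
      algebraMap F B (x ^ (p ^ (2 * m - 1) * (p - 1)) * x⁻¹ ^ (p ^ m * (p - 1))) *
      eval₂ (aeval (algebraMap F B x) : F[X] →ₐ[F] B).toRingHom (ξ - algebraMap F B x)
        (stQ p m (p ^ (2 * m - 1)) a b c n) := by
  set D := p ^ (2 * m - 1) with hD
  set M := p ^ m with hM
  set y := algebraMap F B x with hy
  set z := algebraMap F B x⁻¹ with hz
  have hyz : y * z = 1 := by rw [hy, hz, ← map_mul, mul_inv_cancel₀ hx, map_one]
  have hp1 : 1 ≤ p := hp.one_lt.le
  have hpow : ∀ t, m ≤ t → ξ ^ (p ^ t) = y ^ (p ^ t) := by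
    intro t ht
    obtain ⟨s, rfl⟩ := Nat.exists_eq_add_of_le ht
    rw [pow_add, pow_mul, pow_mul, ← hM, hξ]
  have hDM : D = M * p ^ (m - 1) := by
    rw [hD, hM, ← pow_add]; congr 1; omega
  have hξD : ξ ^ D = y ^ D := hpow _ (by omega)
  have hpD : p * D = p ^ (2 * m) := by
    rw [hD, ← pow_succ']; congr 1; omega
  have hξq : ξ ^ (p * D) = y := by
    rw [hpD, hpow _ (by omega), hy, ← map_pow, hxq]
  have hMD : M ≤ D := by rw [hDM]; exact Nat.le_mul_of_pos_right _ (by positivity)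
  -- powers with exponent D - p^t
  have hlow : ∀ t, t < m → ξ ^ (D - p ^ t) = y ^ (D - M) * ξ ^ (M - p ^ t) := by
    intro t ht
    have h1 : p ^ t ≤ M := Nat.pow_le_pow_right hp1 ht.le
    have h2 : D - p ^ t = (D - M) + (M - p ^ t) := by omega
    rw [h2, pow_add]
    congr 1
    have h3 : D - M = M * (p ^ (m - 1) - 1) := by rw [hDM, Nat.mul_sub, mul_one]
    rw [h3, pow_mul, hξ, ← pow_mul]
  have hhigh : ∀ t, m ≤ t → t < 2 * m → ξ ^ (D - p ^ t) = y ^ (D - p ^ t) := by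
    intro t ht ht2
    have h3 : D - p ^ t = p ^ t * (p ^ (2 * m - 1 - t) - 1) := by
      rw [Nat.mul_sub, mul_one, ← pow_add, hD]; congr 2; omega
    rw [h3, pow_mul, hpow t ht, ← pow_mul]
  have hsub : ∀ A e : ℕ, e ≤ A → y ^ (A - e) = y ^ A * z ^ e := by
    intro A e he
    have : y ^ A = y ^ (A - e) * y ^ e := by rw [← pow_add]; congr 1; omega
    rw [this, mul_assoc, ← mul_pow, hyz, one_pow, mul_one]
  -- value of H
  set ev := eval₂RingHom (aeval y : F[X] →ₐ[F] B).toRingHom (ξ - y) with hev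
  have evX : ev (X + C X) = ξ := by simp [hev]
  have evC : ∀ f : F[X], ev (C f) = aeval y f := by intro f; simp [hev]
  have hH : ev (stH p m a b c) = algebraMap F B c * y ^ M + ∑ t ∈ range m,
      (algebraMap F B a * y ^ M * (ξ ^ (p ^ t) - y ^ (p ^ t)) +
      algebraMap F B b * (ξ ^ (M - p ^ t) - y ^ (M - p ^ t))) := by
    unfold stH
    rw [map_add, evC, map_sum]
    congr 1
    · simp [hM]
    · refine sum_congr rfl fun t _ => ?_
      rw [map_add, map_mul ev, map_mul ev, map_sub, map_sub, map_pow ev, map_pow ev, evX, evC, evC, evC,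
        evC]
      simp [hM]
  have hc : algebraMap F B c = ∑ t ∈ range (2 * m),
      (algebraMap F B a * y ^ (p ^ t) + algebraMap F B b * z ^ (p ^ t)) := by
    rw [← hT, map_sum]
    refine sum_congr rfl fun t _ => ?_
    rw [map_add, map_mul, map_mul, map_pow, map_pow]
  have hG : aeval ξ (stG p m D a b) = y ^ D * (z ^ M * ev (stH p m a b c)) := by
    rw [hH, hc]
    have hzM : z ^ M * y ^ M = 1 := by rw [← mul_pow, mul_comm, hyz, one_pow]
    have hsplit : ∀ f : ℕ → B, ∑ t ∈ range (2 * m), f t =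
        ∑ t ∈ range m, f t + ∑ t ∈ Ico m (2 * m), f t := by
      intro f
      rw [range_eq_Ico, range_eq_Ico, sum_Ico_consecutive _ (by omega) (by omega)]
    unfold stG
    rw [map_sum, hsplit, hsplit]
    have e1 : ∑ t ∈ Ico m (2 * m), aeval ξ (C a * X ^ (D + p ^ t) + C b * X ^ (D - p ^ t)) =
        y ^ D * ∑ t ∈ Ico m (2 * m), (algebraMap F B a * y ^ (p ^ t) +
          algebraMap F B b * z ^ (p ^ t)) := by
      rw [mul_sum]
      refine sum_congr rfl fun t ht => ?_
      rw [mem_Ico] at ht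
      have hle : p ^ t ≤ D := Nat.pow_le_pow_right hp1 (by omega)
      simp only [map_add, map_mul, aeval_C, map_pow, aeval_X]
      rw [hhigh t ht.1 ht.2, hsub _ _ hle, pow_add, hξD, hpow t ht.1]
      ring
    have e2 : ∑ t ∈ range m, aeval ξ (C a * X ^ (D + p ^ t) + C b * X ^ (D - p ^ t)) =
        y ^ D * (∑ t ∈ range m, (algebraMap F B a * y ^ (p ^ t) +
          algebraMap F B b * z ^ (p ^ t))) + y ^ D * (z ^ M * ∑ t ∈ range m,
      (algebraMap F B a * y ^ M * (ξ ^ (p ^ t) - y ^ (p ^ t)) +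
      algebraMap F B b * (ξ ^ (M - p ^ t) - y ^ (M - p ^ t)))) := by
      rw [mul_sum, mul_sum, mul_sum, ← sum_add_distrib]
      refine sum_congr rfl fun t ht => ?_
      rw [mem_range] at ht
      have hle : p ^ t ≤ M := Nat.pow_le_pow_right hp1 ht.le
      simp only [map_add, map_mul, aeval_C, map_pow, aeval_X]
      rw [hlow t ht, hsub M _ hle, hsub D M hMD, pow_add, hξD]
      linear_combination (-algebraMap F B a * y ^ D * (ξ ^ p ^ t - y ^ p ^ t) +
        algebraMap F B b * y ^ D * z ^ p ^ t) * hzM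
    rw [e1, e2]
    linear_combination (-(y ^ D * (∑ t ∈ range m, (algebraMap F B a * y ^ p ^ t +
      algebraMap F B b * z ^ p ^ t) + ∑ t ∈ Ico m (2 * m), (algebraMap F B a * y ^ p ^ t +
      algebraMap F B b * z ^ p ^ t)))) * hzM
  have hR : eval₂ (aeval y : F[X] →ₐ[F] B).toRingHom (ξ - y) (stQ p m D a b c n) =
      ev (stQ p m D a b c n) := rfl
  rw [hR]
  unfold stP stQ
  set j := n / D % p
  set i := n / D / p
  set k := n % D
  have h3 : j < p := Nat.mod_lt _ (by omega)
  obtain ⟨l, hl⟩ : ∃ l, p - 1 = j + l := ⟨p - 1 - j, by omega⟩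
  have hl2 : p - 1 - j = l := by omega
  rw [map_mul, map_mul, map_pow, map_pow, map_pow, hG, map_mul ev, map_mul ev, map_pow ev, map_pow ev,
    evX, evC, aeval_X, map_pow, aeval_X, map_mul, map_pow, map_pow, ← hy, ← hz, ← hM, hl2, hl]
  have e1 : ξ ^ (k + p * D * i) = ξ ^ k * y ^ i := by rw [pow_add, pow_mul, hξq]
  have e2 : ξ ^ (D * l) = y ^ (D * l) := by rw [pow_mul, hξD, ← pow_mul]
  rw [e1, e2]
  have e3 : z ^ (M * l) * y ^ (M * l) = 1 := by rw [← mul_pow, mul_comm, hyz, one_pow]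
  generalize ev (stH p m a b c) = h
  have e4 : z ^ (M * (j + l)) * y ^ (i + M * l) = z ^ (M * j) * y ^ i := by
    rw [mul_add, pow_add, pow_add]
    linear_combination (z ^ (M * j) * y ^ i) * e3
  calc _ = (z ^ (M * j) * y ^ i) * (y ^ (D * (j + l)) * ξ ^ k * h ^ j) := by
        rw [mul_pow, mul_pow, mul_add, pow_add, pow_mul z, pow_mul y D j]; ring
    _ = _ := by rw [← e4]; ring

theorem stepanov {F : Type*} [Field F] [Fintype F] [DecidableEq F] (p m : ℕ) [hpf : Fact p.Prime]
    [CharP F p] (hm : 1 ≤ m) (hF : Fintype.card F = p ^ (2 * m)) (a b c : F) (ha : a ≠ 0) :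
    ((univ : Finset F).filter (fun x => x ≠ 0 ∧
      ∑ t ∈ range (2 * m), (a * x ^ (p ^ t) + b * (x⁻¹) ^ (p ^ t)) = c)).card * p ^ m ≤
      p ^ (2 * m) * (p ^ (m - 1) + 4 * p + 5) := by
  classical
  have hp := hpf.out
  have hp2 : 2 ≤ p := hp.two_le
  set D := p ^ (2 * m - 1) with hD
  set M := p ^ m with hM
  set I := p ^ (m - 1) + 4 * p + 4 with hI
  set B := D + I + 2 * M * p with hB
  have hDpos : 0 < D := by positivity
  have hpD : p * D = p ^ (2 * m) := by
    rw [hD, ← pow_succ']; congr 1; omega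
  have hMM : p * D = M * M := by rw [hpD, hM, ← pow_add]; congr 1; omega
  have hM1 : M = p * p ^ (m - 1) := by rw [hM, ← pow_succ']; congr 1; omega
  have hMpos : 2 ≤ M := by
    rw [hM1]; exact hp2.trans (Nat.le_mul_of_pos_right _ (by positivity))
  have hcount : M * B < p * I * D := by
    have h1 : p * I * D = I * (M * M) := by rw [← hMM]; ring
    have h2 : p ^ (m - 1) * 2 ≤ M := by rw [hM1]; nlinarith [Nat.zero_le (p ^ (m-1))]
    rw [h1, hB, hI]
    have h3 : M * D = p ^ (m - 1) * (M * M) := by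
      have : M * D = p ^ (m - 1) * (p * D) := by rw [hM1]; ring
      rw [this, hMM]
    generalize p ^ (m - 1) = w at *
    have h4 : M * (D + (w + 4 * p + 4) + 2 * M * p) = w * (M * M) + M * w + 4 * (p * M) + 4 * M
      + 2 * (M * M * p) := by rw [← h3]; ring
    rw [h4]
    nlinarith [Nat.mul_le_mul_left M h2, Nat.mul_le_mul_left (p * M) hMpos,
      Nat.mul_le_mul_left M hMpos]
  -- linear algebra
  let Φ : (Fin (p * I * D) → F) →ₗ[F] (Fin M × Fin B → F) :=
    { toFun := fun r lb => ∑ n, r n * ((stQ p m D a b c n).coeff lb.1).coeff lb.2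
      map_add' := by
        intro r s; ext lb; simp [add_mul, sum_add_distrib]
      map_smul' := by
        intro r s; ext lb; simp [mul_sum, mul_assoc] }
  have hker : LinearMap.ker Φ ≠ ⊥ := by
    apply LinearMap.ker_ne_bot_of_finrank_lt
    simpa using hcount
  obtain ⟨r, hrk, hr0⟩ := (Submodule.ne_bot_iff _).mp hker
  have hrΦ : ∀ (l : Fin M) (u : Fin B),
      ∑ n, r n * ((stQ p m D a b c n).coeff l).coeff u = 0 := by
    intro l u
    have := congrFun (LinearMap.mem_ker.mp hrk) (l, u)
    simpa [Φ] using this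
  set R : F[X] := ∑ n, C (r n) * stP p m D a b n with hR
  have hRne : R ≠ 0 := sum_ne_zero_of_degrees _ _ (stP_natDegree p m hp2 hm a b ha)
    (stP_ne_zero p m hp2 hm a b ha) _ r hr0
  have hRdeg : R.natDegree ≤ p * I * D + D * (p - 1) := by
    rw [hR]
    refine natDegree_sum_le_of_forall_le _ _ (fun n _ => ?_)
    refine (natDegree_C_mul_le _ _).trans ?_
    rw [stP_natDegree p m hp2 hm a b ha, ← hD]
    have := n.2
    omega
  set Q : F[X][X] := ∑ n, C (C (r n)) * stQ p m D a b c n with hQ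
  have hQ0 : ∀ l < M, Q.coeff l = 0 := by
    intro l hl
    ext u
    rw [hQ, finsetSum_coeff, finsetSum_coeff]
    simp only [coeff_C_mul, coeff_zero]
    by_cases hu : u < B
    · exact hrΦ ⟨l, hl⟩ ⟨u, hu⟩
    · refine sum_eq_zero fun n _ => ?_
      rw [coeff_eq_zero_of_natDegree_lt, mul_zero]
      have := stQ_degU p m D I hp2 hDpos a b c n n.2 l
      have h5 : 0 < D + I + 2 * p ^ m * p := by omega
      rw [← hM] at this h5
      omega
  set S := (univ : Finset F).filter (fun x => x ≠ 0 ∧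
      ∑ t ∈ range (2 * m), (a * x ^ (p ^ t) + b * (x⁻¹) ^ (p ^ t)) = c) with hS
  have hdvd : ∀ x ∈ S, (X - C x) ^ M ∣ R := by
    intro x hxS
    rw [hS, mem_filter] at hxS
    obtain ⟨-, hx0, hT⟩ := hxS
    set J : Ideal F[X] := Ideal.span {(X - C x) ^ M} with hJ
    rw [← Ideal.mem_span_singleton, ← hJ, ← Ideal.Quotient.eq_zero_iff_mem]
    have hxq : x ^ (p ^ (2 * m)) = x := by rw [← hF]; exact FiniteField.pow_card x
    set ξ : F[X] ⧸ J := Ideal.Quotient.mk J X with hξd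
    have hal : ∀ f : F, Ideal.Quotient.mk J (C f) = algebraMap F (F[X] ⧸ J) f := fun f => rfl
    have hnil : (ξ - algebraMap F (F[X] ⧸ J) x) ^ M = 0 := by
      rw [hξd, ← hal, ← map_sub, ← map_pow, Ideal.Quotient.eq_zero_iff_mem, hJ]
      exact Ideal.mem_span_singleton_self _
    have hξM : ξ ^ (p ^ m) = (algebraMap F (F[X] ⧸ J) x) ^ (p ^ m) := by
      have h1 : (X - C x) ^ (p ^ m) = (X : F[X]) ^ (p ^ m) - C x ^ (p ^ m) :=
        sub_pow_char_pow _ _ _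
      have h2 := congrArg (Ideal.Quotient.mk J) h1
      rw [map_pow, map_sub, map_sub, map_pow, map_pow, hal, ← hξd, ← hM, hnil] at h2
      exact (sub_eq_zero.mp h2.symm)
    have haev : ∀ f : F[X], Ideal.Quotient.mk J f = aeval ξ f := by
      intro f
      have : (Ideal.Quotient.mkₐ F J) f = aeval (Ideal.Quotient.mkₐ F J X) f := by
        rw [aeval_algHom_apply, aeval_X_left, AlgHom.id_apply]
      simpa using this
    rw [haev, hR, map_sum]
    have hterm : ∀ n : Fin (p * I * D), aeval ξ (C (r n) * stP p m D a b n) =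
        algebraMap F (F[X] ⧸ J) (x ^ (D * (p - 1)) * x⁻¹ ^ (M * (p - 1))) *
        eval₂ (aeval (algebraMap F (F[X] ⧸ J) x) : F[X] →ₐ[F] (F[X] ⧸ J)).toRingHom
          (ξ - algebraMap F (F[X] ⧸ J) x) (C (C (r n)) * stQ p m D a b c n) := by
      intro n
      rw [map_mul, st_key p m hp hm a b c x hx0 hxq hT ξ hξM n, eval₂_mul, eval₂_C]
      have : (aeval (algebraMap F (F[X] ⧸ J) x) : F[X] →ₐ[F] (F[X] ⧸ J)).toRingHom (C (r n)) =
        aeval ξ (C (r n)) := by simp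
      rw [this]
      ring
    rw [sum_congr rfl (fun n _ => hterm n), ← mul_sum, ← eval₂_finsetSum, ← hQ, eval₂_eq_sum,
      Polynomial.sum]
    rw [sum_eq_zero, mul_zero]
    intro l _
    by_cases hl : l < M
    · rw [hQ0 l hl, map_zero, zero_mul]
    · rw [← Nat.sub_add_cancel (not_lt.mp hl), pow_add, hnil, mul_zero, mul_zero]
  have hprod : ∏ x ∈ S, (X - C x) ^ M ∣ R := by
    refine Finset.prod_dvd_of_coprime ?_ hdvd
    intro x _ x' _ hxx'
    exact (pairwise_coprime_X_sub_C Function.injective_id hxx').pow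
  have hle := natDegree_le_of_dvd hprod hRne
  have hdegp : (∏ x ∈ S, (X - C x) ^ M).natDegree = S.card * M := by
    rw [natDegree_prod _ _ (fun x _ => pow_ne_zero _ (X_sub_C_ne_zero x))]
    simp
  rw [hdegp] at hle
  refine (hle.trans hRdeg).trans ?_
  rw [← hpD]
  have h6 : D * (p - 1) ≤ p * D := by rw [mul_comm]; exact Nat.mul_le_mul_right _ (by omega)
  calc p * I * D + D * (p - 1) ≤ p * I * D + p * D := by omega
    _ = p * D * (p ^ (m - 1) + 4 * p + 5) := by rw [hI]; ring

end Stepanov2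

end

section
open Polynomial Finset
open scoped Classical

/-- monic polynomials of degree d -/
def monics (p d : ℕ) [Fact p.Prime] : Finset (ZMod p)[X] :=
  (univ : Finset (Fin d → ZMod p)).image (fun c => X ^ d + ∑ i : Fin d, C (c i) * X ^ (i : ℕ))

lemma degree_fin_sum_lt {p d : ℕ} [Fact p.Prime] (c : Fin d → ZMod p) :
    (∑ i, C (c i) * X ^ (i : ℕ) : (ZMod p)[X]).degree < d := by
  refine lt_of_le_of_lt (degree_sum_le _ _) ?_
  rw [Finset.sup_lt_iff (by exact WithBot.bot_lt_coe d)]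
  intro i _
  exact lt_of_le_of_lt (degree_C_mul_X_pow_le _ _) (by exact_mod_cast i.2)

lemma mem_monics {p d : ℕ} [Fact p.Prime] (h : (ZMod p)[X]) :
    h ∈ monics p d ↔ h.Monic ∧ h.natDegree = d := by
  unfold monics
  simp only [mem_image, mem_univ, true_and]
  constructor
  · rintro ⟨c, rfl⟩
    have h1 := degree_fin_sum_lt c
    have hm := monic_X_pow_add h1
    refine ⟨hm, ?_⟩
    rw [natDegree_eq_of_degree_eq (degree_add_eq_left_of_degree_lt (by simpa using h1))]
    simp
  · rintro ⟨hm, hd⟩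
    refine ⟨fun i => h.coeff i, ?_⟩
    conv_rhs => rw [hm.as_sum, hd]
    rw [Finset.sum_range]

lemma monics_inj {p d : ℕ} [Fact p.Prime] : Function.Injective
    (fun c : Fin d → ZMod p => (X ^ d + ∑ i, C (c i) * X ^ (i : ℕ) : (ZMod p)[X])) := by
  intro c c' h
  ext j
  have hcoef := congrArg (fun f => f.coeff (j : ℕ)) h
  simp only [coeff_add, finsetSum_coeff, coeff_C_mul, coeff_X_pow, mul_ite, mul_one, mul_zero] at hcoef
  have : ∀ c : Fin d → ZMod p, ∑ i : Fin d, (if (j : ℕ) = (i : ℕ) then c i else 0) = c j := by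
    intro c
    rw [Finset.sum_eq_single j]
    · simp
    · intro b _ hb; rw [if_neg]; intro e; exact hb (Fin.ext e.symm)
    · simp
  rw [this, this] at hcoef
  exact add_left_cancel hcoef

/-- monic irreducibles of degree at most d -/
def irreds (p d : ℕ) [Fact p.Prime] : Finset (ZMod p)[X] := by

  exact ((Finset.range (d+1)).biUnion (fun e => monics p e)).filter Irreducible

lemma mem_irreds {p d : ℕ} [Fact p.Prime] (h : (ZMod p)[X]) :
    h ∈ irreds p d ↔ h.Monic ∧ h.natDegree ≤ d ∧ Irreducible h := by
  unfold irreds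
  simp only [mem_filter, mem_biUnion, mem_range, mem_monics]
  constructor
  · rintro ⟨⟨e, he, hm, hd⟩, hi⟩; exact ⟨hm, by omega, hi⟩
  · rintro ⟨hm, hd, hi⟩; exact ⟨⟨_, by omega, hm, rfl⟩, hi⟩

open UniqueFactorizationMonoid in
lemma degree_identity {p d : ℕ} [Fact p.Prime] (h : (ZMod p)[X]) (hh : h ∈ monics p d) :
    ∑ P ∈ irreds p d, ∑ k ∈ Icc 1 d, (if P ^ k ∣ h then P.natDegree else 0) = d := by

  rw [mem_monics] at hh
  obtain ⟨hm, hd⟩ := hh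
  have h0 : h ≠ 0 := hm.ne_zero
  set s := normalizedFactors h with hs
  have hsirr : ∀ P ∈ s, Irreducible P := fun P hP => irreducible_of_normalized_factor P hP
  have hprod : Associated s.prod h := prod_normalizedFactors h0
  have hs0 : (0 : (ZMod p)[X]) ∉ s := fun h => (hsirr 0 h).ne_zero rfl
  have hdeg : (s.map natDegree).sum = d := by
    rw [← natDegree_multiset_prod _ hs0, ← hd]
    exact natDegree_eq_of_degree_eq (degree_eq_degree_of_associated hprod)
  have hkey : ∀ P : (ZMod p)[X], Irreducible P → P.Monic → ∀ k, P ^ k ∣ h ↔ k ≤ s.count P := by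
    intro P hP hPm k
    rw [pow_dvd_iff_le_emultiplicity, emultiplicity_eq_count_normalizedFactors hP h0,
      hPm.normalize_eq_self]
    simp [hs]
  have hsmem : ∀ P ∈ s, P ∈ irreds p d := by
    intro P hP
    rw [mem_irreds]
    have h1 := normalize_normalized_factor P hP
    refine ⟨?_, ?_, hsirr P hP⟩
    · rw [← h1]; exact monic_normalize (hsirr P hP).ne_zero
    · rw [← hd]; exact natDegree_le_of_dvd (dvd_of_mem_normalizedFactors hP) h0
  refine Eq.trans ?_ hdeg
  rw [Finset.sum_multiset_map_count]
  symm
  rw [Finset.sum_subset (s₂ := irreds p d) (fun P hP => hsmem P (Multiset.mem_toFinset.1 hP))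
    (fun P _ hP => by
      rw [Multiset.mem_toFinset] at hP; rw [Multiset.count_eq_zero_of_notMem hP, zero_smul])]
  refine Finset.sum_congr rfl fun P hP => ?_
  rw [mem_irreds] at hP
  obtain ⟨hPm, hPd, hPi⟩ := hP
  rw [← Finset.sum_filter, Finset.sum_const, smul_eq_mul, smul_eq_mul]
  congr 1
  have hle : s.count P ≤ d := by
    have h1 : P ^ (s.count P) ∣ h := (hkey P hPi hPm _).2 le_rfl
    have h2 := natDegree_le_of_dvd h1 h0
    rw [natDegree_pow, hd] at h2
    have h3 : 1 ≤ P.natDegree := hPi.natDegree_pos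
    nlinarith
  have : (Icc 1 (d)).filter (fun k => P ^ k ∣ h) = Icc 1 (s.count P) := by
    ext k
    simp only [mem_filter, mem_Icc, hkey P hPi hPm]
    omega
  rw [this]; simp

/-- the multiplicative weight -/
def lam (p : ℕ) [Fact p.Prime] (ψ : AddChar (ZMod p) ℂ) (a b : ZMod p) (h : (ZMod p)[X]) : ℂ :=
  if h.coeff 0 = 0 then 0 else ψ (-(a * h.nextCoeff) - b * (h.coeff 1 / h.coeff 0))

section
variable {p : ℕ} [Fact p.Prime] (ψ : AddChar (ZMod p) ℂ) (a b : ZMod p)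

lemma lam_mul {f g : (ZMod p)[X]} (hf : f.Monic) (hg : g.Monic) :
    lam p ψ a b (f * g) = lam p ψ a b f * lam p ψ a b g := by
  unfold lam
  rw [mul_coeff_zero]
  by_cases h1 : f.coeff 0 = 0
  · simp [h1]
  by_cases h2 : g.coeff 0 = 0
  · simp [h2]
  rw [if_neg (mul_ne_zero h1 h2), if_neg h1, if_neg h2, ← AddChar.map_add_eq_mul,
    Monic.nextCoeff_mul hf hg, mul_coeff_one]
  congr 1
  field_simp
  ring

lemma lam_one : lam p ψ a b 1 = 1 := by
  unfold lam
  have : (1 : (ZMod p)[X]).nextCoeff = 0 := by rw [← map_one (f := C), nextCoeff_C_eq_zero]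
  simp [coeff_one, this]

lemma lam_pow {f : (ZMod p)[X]} (hf : f.Monic) (k : ℕ) :
    lam p ψ a b (f ^ k) = lam p ψ a b f ^ k := by
  induction k with
  | zero => simp [lam_one]
  | succ k ih => rw [pow_succ, lam_mul ψ a b (hf.pow k) hf, ih, pow_succ]

/-- coefficient sums of the L-function -/
def Ssum (d : ℕ) : ℂ := ∑ h ∈ monics p d, lam p ψ a b h

lemma Ssum_dvd (d k : ℕ) {P : (ZMod p)[X]} (hP : P.Monic) :
    (∑ h ∈ monics p d, if P ^ k ∣ h then lam p ψ a b h else 0) =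
      if k * P.natDegree ≤ d then lam p ψ a b P ^ k * Ssum ψ a b (d - k * P.natDegree) else 0 := by

  rw [← Finset.sum_filter]
  split_ifs with hk
  · unfold Ssum
    rw [Finset.mul_sum]
    symm
    refine Finset.sum_bij (fun g _ => P ^ k * g) ?_ ?_ ?_ ?_
    · intro g hg
      rw [mem_monics] at hg
      rw [mem_filter, mem_monics]
      refine ⟨⟨(hP.pow k).mul hg.1, ?_⟩, dvd_mul_right _ _⟩
      rw [(hP.pow k).natDegree_mul hg.1, hP.natDegree_pow, hg.2]; omega
    · intro g _ g' _ h
      exact mul_left_cancel₀ (hP.pow k).ne_zero h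
    · intro h hh
      rw [mem_filter, mem_monics] at hh
      obtain ⟨⟨hm, hd⟩, g, rfl⟩ := hh
      have hg : g.Monic := (hP.pow k).of_mul_monic_left hm
      refine ⟨g, ?_, rfl⟩
      rw [mem_monics]
      refine ⟨hg, ?_⟩
      rw [(hP.pow k).natDegree_mul hg, hP.natDegree_pow] at hd
      omega
    · intro g hg
      rw [mem_monics] at hg
      rw [lam_mul ψ a b (hP.pow k) hg.1, lam_pow ψ a b hP]
  · refine Finset.sum_eq_zero fun h hh => ?_
    rw [mem_filter, mem_monics] at hh
    exfalso
    apply hk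
    have := natDegree_le_of_dvd hh.2 hh.1.1.ne_zero
    rwa [hP.natDegree_pow, hh.1.2] at this

/-- the von Mangoldt sums -/
def Ksum (d j : ℕ) : ℂ := ∑ P ∈ irreds p d,
  if P.natDegree ∣ j then (P.natDegree : ℂ) * lam p ψ a b P ^ (j / P.natDegree) else 0

lemma newton (d : ℕ) : (d : ℂ) * Ssum ψ a b d =
    ∑ j ∈ Icc 1 d, Ksum ψ a b d j * Ssum ψ a b (d - j) := by

  have h1 : (d : ℂ) * Ssum ψ a b d = ∑ P ∈ irreds p d, ∑ k ∈ Icc 1 d, (P.natDegree : ℂ) *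
      (∑ h ∈ monics p d, if P ^ k ∣ h then lam p ψ a b h else 0) := by
    unfold Ssum
    rw [Finset.mul_sum]
    have : ∀ h ∈ monics p d, (d : ℂ) * lam p ψ a b h = ∑ P ∈ irreds p d, ∑ k ∈ Icc 1 d,
        (P.natDegree : ℂ) * (if P ^ k ∣ h then lam p ψ a b h else 0) := by
      intro h hh
      have h2 := congrArg (fun n : ℕ => (n : ℂ)) (degree_identity h hh)
      simp only [Nat.cast_sum] at h2
      rw [← h2, Finset.sum_mul]
      refine Finset.sum_congr rfl fun P _ => ?_
      rw [Finset.sum_mul]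
      refine Finset.sum_congr rfl fun k _ => ?_
      split_ifs <;> simp
    rw [Finset.sum_congr rfl this, Finset.sum_comm]
    refine Finset.sum_congr rfl fun P _ => ?_
    rw [Finset.sum_comm]
    refine Finset.sum_congr rfl fun k _ => ?_
    rw [Finset.mul_sum]
  rw [h1]
  unfold Ksum
  simp_rw [Finset.sum_mul]
  rw [Finset.sum_comm (s := Icc 1 d)]
  refine Finset.sum_congr rfl fun P hP => ?_
  rw [mem_irreds] at hP
  obtain ⟨hPm, hPd, hPi⟩ := hP
  have hpos := hPi.natDegree_pos
  simp_rw [Ssum_dvd ψ a b d _ hPm]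
  simp only [mul_ite, mul_zero, ite_mul, zero_mul]
  rw [← Finset.sum_filter, ← Finset.sum_filter]
  refine Finset.sum_bij (fun k _ => k * P.natDegree) ?_ ?_ ?_ ?_
  · intro k hk
    simp only [mem_filter, mem_Icc] at hk ⊢
    refine ⟨⟨?_, hk.2⟩, dvd_mul_left _ _⟩
    nlinarith
  · intro k _ k' _ h
    exact Nat.eq_of_mul_eq_mul_right hpos h
  · intro j hj
    simp only [mem_filter, mem_Icc] at hj
    obtain ⟨⟨hj1, hj2⟩, k, rfl⟩ := hj
    refine ⟨k, ?_, by ring⟩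
    simp only [mem_filter, mem_Icc]
    refine ⟨⟨?_, ?_⟩, by linarith [mul_comm k P.natDegree]⟩
    · rcases Nat.eq_zero_or_pos k with rfl | h
      · simp at hj1
      · exact h
    · nlinarith
  · intro k _
    rw [Nat.mul_div_cancel _ hpos]; ring

lemma Ssum_zero : Ssum ψ a b 0 = 1 := by
  unfold Ssum
  have : monics p 0 = {1} := by
    ext h
    rw [mem_monics, mem_singleton]
    constructor
    · rintro ⟨hm, hd⟩; exact (Polynomial.Monic.natDegree_eq_zero hm).1 hd
    · rintro rfl; exact ⟨monic_one, natDegree_one⟩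
  rw [this]; simp [lam_one]

lemma Ssum_ge_three (hψ : ψ ≠ 1) (ha : a ≠ 0) (d : ℕ) (hd : 3 ≤ d) : Ssum ψ a b d = 0 := by
  obtain ⟨t, ht⟩ := (AddChar.ne_one_iff).1 hψ
  set s : ZMod p := -(t / a)
  have hs : ψ (-(a * s)) ≠ 1 := by
    have : -(a * s) = t := by simp only [s]; field_simp
    rwa [this]
  have key : Ssum ψ a b d = ψ (-(a * s)) * Ssum ψ a b d := by
    conv_lhs => unfold Ssum
    unfold Ssum
    rw [Finset.mul_sum]
    symm
    have hdeg : ∀ (h : (ZMod p)[X]) (s : ZMod p), h ∈ monics p d →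
        h + C s * X ^ (d - 1) ∈ monics p d := by
      intro h s hh
      rw [mem_monics] at hh ⊢
      have h1 : (C s * X ^ (d-1) : (ZMod p)[X]).degree < h.degree := by
        rw [degree_eq_natDegree hh.1.ne_zero, hh.2]
        exact lt_of_le_of_lt (degree_C_mul_X_pow_le _ _) (by norm_cast; omega)
      refine ⟨hh.1.add_of_left h1, ?_⟩
      rw [natDegree_eq_of_degree_eq (degree_add_eq_left_of_degree_lt h1), hh.2]
    refine Finset.sum_bij (fun h _ => h + C s * X ^ (d-1)) (fun h hh => hdeg h s hh) ?_ ?_ ?_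
    · intro g _ g' _ h
      exact add_right_cancel h
    · intro h hh
      refine ⟨h + C (-s) * X ^ (d-1), hdeg h _ hh, ?_⟩
      simp
    · intro h hh
      have h2 := hdeg h s hh
      rw [mem_monics] at hh h2
      unfold lam
      have c0 : (h + C s * X ^ (d-1)).coeff 0 = h.coeff 0 := by
        rw [coeff_add, coeff_C_mul, coeff_X_pow, if_neg (by omega)]; simp
      have c1 : (h + C s * X ^ (d-1)).coeff 1 = h.coeff 1 := by
        rw [coeff_add, coeff_C_mul, coeff_X_pow, if_neg (by omega)]; simp
      have c2 : (h + C s * X ^ (d-1)).nextCoeff = h.nextCoeff + s := by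
        rw [nextCoeff_of_natDegree_pos (by omega), nextCoeff_of_natDegree_pos (by omega), h2.2, hh.2,
          coeff_add, coeff_C_mul, coeff_X_pow, if_pos rfl, mul_one]
      rw [c0, c1, c2]
      split_ifs with h0
      · simp
      · rw [← AddChar.map_add_eq_mul]; congr 1; ring
  have : (1 - ψ (-(a * s))) * Ssum ψ a b d = 0 := by linear_combination key
  rcases mul_eq_zero.1 this with h | h
  · exact absurd (sub_eq_zero.1 h).symm hs
  · exact h

lemma Ssum_one : Ssum ψ a b 1 = ∑ x : ZMod p, if x = 0 then 0 else ψ (a * x + b * x⁻¹) := by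
  unfold Ssum monics
  rw [Finset.sum_image (fun _ _ _ _ h => monics_inj h)]
  rw [← Equiv.sum_comp (Equiv.neg (ZMod p)) (fun x : ZMod p => if x = 0 then 0 else ψ (a * x + b * x⁻¹))]
  refine Fintype.sum_equiv (Equiv.funUnique (Fin 1) (ZMod p)) _ _ ?_
  intro c
  have e : (X ^ 1 + ∑ i : Fin 1, C (c i) * X ^ (i : ℕ) : (ZMod p)[X]) = X + C (c 0) := by simp
  rw [e]
  unfold lam
  rw [nextCoeff_X_add_C]
  simp [coeff_X, coeff_C, sub_eq_add_neg, inv_neg]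

lemma Ssum_two (hψ : ψ ≠ 1) (ha : a ≠ 0) (hb : b ≠ 0) : Ssum ψ a b 2 = p := by
  unfold Ssum monics
  rw [Finset.sum_image (fun _ _ _ _ h => monics_inj h)]
  have e : ∀ c : Fin 2 → ZMod p,
      lam p ψ a b (X ^ 2 + ∑ i : Fin 2, C (c i) * X ^ (i : ℕ) : (ZMod p)[X]) =
       if c 0 = 0 then 0 else ψ (c 1 * (-(a + b / c 0))) := by
    intro c
    have hmem : (X ^ 2 + ∑ i : Fin 2, C (c i) * X ^ (i : ℕ) : (ZMod p)[X]) ∈ monics p 2 := by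
      unfold monics; exact mem_image_of_mem _ (mem_univ _)
    rw [mem_monics] at hmem
    unfold lam
    rw [nextCoeff_of_natDegree_pos (by omega), hmem.2]
    simp [coeff_X, coeff_C, coeff_X_pow, coeff_one]
    split_ifs
    · rfl
    · congr 1; field_simp; ring
  rw [Finset.sum_congr rfl (fun c _ => e c)]
  have e2 := Fintype.sum_equiv (finTwoArrowEquiv (ZMod p))
    (fun c => if c 0 = 0 then 0 else ψ (c 1 * (-(a + b / c 0))))
    (fun x : ZMod p × ZMod p => if x.1 = 0 then 0 else ψ (x.2 * (-(a + b / x.1)))) (fun c => rfl)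
  rw [e2]
  rw [Fintype.sum_prod_type]
  have h3 : ∀ v : ZMod p, (∑ u : ZMod p, if v = 0 then 0 else ψ (u * (-(a + b / v)))) =
      if v = -b / a then (p : ℂ) else 0 := by
    intro v
    by_cases hv : v = 0
    · subst hv
      rw [if_neg]
      · simp
      · intro h
        have := h.symm
        rw [div_eq_zero_iff] at this
        rcases this with h | h
        · exact hb (neg_eq_zero.1 h)
        · exact ha h
    · simp only [hv, if_false]
      rw [AddChar.sum_mulShift _ (AddChar.IsPrimitive.of_ne_one hψ)]
      have : -(a + b / v) = 0 ↔ v = -b / a := by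
        rw [neg_eq_zero]
        constructor
        · intro h; field_simp at h ⊢; linear_combination h
        · rintro rfl; field_simp; ring
      simp only [this, ZMod.card]; split_ifs <;> simp
  simp_rw [h3]
  simp

end

end

section
open Polynomial Finset
open scoped Classical

lemma minpoly_fiber_card {p : ℕ} [Fact p.Prime] {L : Type*} [Field L] [Fintype L]
    [Algebra (ZMod p) L] (j : ℕ) (hj : Module.finrank (ZMod p) L = j) (P : (ZMod p)[X])
    (hP : P.Monic) (hi : Irreducible P) :
    ((univ : Finset L).filter (fun x => minpoly (ZMod p) x = P)).card =
      if P.natDegree ∣ j then P.natDegree else 0 := by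
  have hcard : Fintype.card L = p ^ j := by
    rw [Module.card_eq_pow_finrank (K := ZMod p) (V := L), ZMod.card, hj]
  have hiff : ∀ x : L, minpoly (ZMod p) x = P ↔ aeval x P = 0 := by
    intro x
    constructor
    · rintro rfl; exact minpoly.aeval _ _
    · intro h; exact (minpoly.eq_of_irreducible_of_monic hi h hP).symm
  split_ifs with hd
  · have h1 : P ∣ X ^ (Nat.card (ZMod p)) ^ j - X :=
      (hi.natDegree_dvd_iff_dvd_X_pow_card_pow_sub_X).1 hd
    have hsep : P.Separable := PerfectField.separable_of_irreducible hi
    have hspl : (P.map (algebraMap (ZMod p) L)).Splits := by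
      have h2 : (X ^ (Fintype.card L) - X : L[X]).Splits := by
        simpa using FiniteField.splits_X_pow_card_sub_X p (K := L)
      have hne : (X ^ (Fintype.card L) - X : L[X]) ≠ 0 :=
        FiniteField.X_pow_card_sub_X_ne_zero L Fintype.one_lt_card
      refine h2.of_dvd hne ?_
      have h3 := Polynomial.map_dvd (algebraMap (ZMod p) L) h1
      simpa [hcard, Nat.card_eq_fintype_card, ZMod.card] using h3
    have h4 := card_rootSet_eq_natDegree hsep hspl
    rw [← h4, Fintype.card_of_subtype]
    intro x
    rw [mem_filter, hiff, mem_rootSet]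
    simp [hP.ne_zero]
  · rw [Finset.card_eq_zero, Finset.filter_eq_empty_iff]
    intro x _ h
    apply hd
    rw [← h, ← hj]
    exact minpoly.degree_dvd (IsIntegral.of_finite _ _)

lemma minpoly_inv_aux0 {p : ℕ} [Fact p.Prime] {L : Type*} [Field L] [Fintype L]
    [Algebra (ZMod p) L] (x : L) (hx : x ≠ 0) :
    (minpoly (ZMod p) x).coeff 0 ≠ 0 ∧ ∃ Q : (ZMod p)[X], Q.Monic ∧
    Q.natDegree = (minpoly (ZMod p) x).natDegree ∧ minpoly (ZMod p) x⁻¹ ∣ Q ∧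
    Q.nextCoeff = (minpoly (ZMod p) x).coeff 1 / (minpoly (ZMod p) x).coeff 0 := by
  set P := minpoly (ZMod p) x with hP
  have hIntg : IsIntegral (ZMod p) x := IsIntegral.of_finite _ _
  have hPi : Irreducible P := minpoly.irreducible hIntg
  have hPm : P.Monic := minpoly.monic hIntg
  have hc0 : P.coeff 0 ≠ 0 := minpoly.coeff_zero_ne_zero hIntg hx
  have hnt : P.natTrailingDegree = 0 := by
    rw [natTrailingDegree_eq_zero]; right; exact hc0
  set Q : (ZMod p)[X] := C (P.coeff 0)⁻¹ * P.reverse with hQ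
  have hrd : P.reverse.natDegree = P.natDegree := by rw [reverse_natDegree, hnt]; simp
  have hrl : P.reverse.leadingCoeff = P.coeff 0 := by
    rw [reverse_leadingCoeff, trailingCoeff, hnt]
  have hQd : Q.natDegree = P.natDegree := by
    rw [hQ, natDegree_C_mul (inv_ne_zero hc0), hrd]
  have hQm : Q.Monic := by
    rw [Monic, hQ, leadingCoeff_mul, leadingCoeff_C, hrl]; field_simp
  have hQx : aeval x⁻¹ Q = 0 := by
    rw [hQ, map_mul]
    have : aeval x⁻¹ P.reverse = 0 := by
      rw [aeval_def]
      letI : Invertible x := invertibleOfNonzero hx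
      have := (eval₂_reverse_eq_zero_iff (algebraMap (ZMod p) L) x P).2 (by
        rw [← aeval_def]; exact minpoly.aeval _ _)
      simpa using this
    rw [this, mul_zero]
  refine ⟨hc0, Q, hQm, hQd, minpoly.dvd _ _ hQx, ?_⟩
  have hpos := hPi.natDegree_pos
  rw [nextCoeff_of_natDegree_pos (by omega), hQd, hQ, coeff_C_mul, coeff_reverse,
    revAt_le (by omega)]
  rw [show P.natDegree - (P.natDegree - 1) = 1 by omega]
  field_simp

lemma minpoly_inv_aux {p : ℕ} [Fact p.Prime] {L : Type*} [Field L] [Fintype L]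
    [Algebra (ZMod p) L] (x : L) (hx : x ≠ 0) :
    (minpoly (ZMod p) x⁻¹).nextCoeff = (minpoly (ZMod p) x).coeff 1 / (minpoly (ZMod p) x).coeff 0
    ∧ (minpoly (ZMod p) x).coeff 0 ≠ 0 ∧
    (minpoly (ZMod p) x⁻¹).natDegree = (minpoly (ZMod p) x).natDegree := by
  obtain ⟨h0, Q, hQm, hQd, hdvd, hQn⟩ := minpoly_inv_aux0 (p := p) x hx
  obtain ⟨_, Q', hQm', hQd', hdvd', _⟩ := minpoly_inv_aux0 (p := p) x⁻¹ (inv_ne_zero hx)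
  rw [inv_inv] at hdvd'
  have hle := natDegree_le_of_dvd hdvd' hQm'.ne_zero
  have hIntg : IsIntegral (ZMod p) x⁻¹ := IsIntegral.of_finite _ _
  have he : Q = minpoly (ZMod p) x⁻¹ :=
    eq_of_monic_of_dvd_of_natDegree_le (minpoly.monic hIntg) hQm hdvd (by omega)
  rw [← he]
  exact ⟨hQn, h0, hQd⟩

lemma lam_minpoly {p : ℕ} [Fact p.Prime] (ψ : AddChar (ZMod p) ℂ) (a b : ZMod p)
    {L : Type*} [Field L] [Fintype L]
    [Algebra (ZMod p) L] (j : ℕ) (hj : Module.finrank (ZMod p) L = j) (x : L) :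
    lam p ψ a b (minpoly (ZMod p) x) ^ (j / (minpoly (ZMod p) x).natDegree) =
     if x = 0 then 0 else ψ (Algebra.trace (ZMod p) L (a • x + b • x⁻¹)) := by
  have hIntg : ∀ x : L, IsIntegral (ZMod p) x := fun x => IsIntegral.of_finite _ _
  have hdvd : (minpoly (ZMod p) x).natDegree ∣ j := hj ▸ minpoly.degree_dvd (hIntg x)
  have hjpos : 0 < j := hj ▸ Module.finrank_pos
  have hpos := minpoly.natDegree_pos (hIntg x)
  split_ifs with hx
  · subst hx
    unfold lam
    rw [if_pos (by simp), zero_pow]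
    exact (Nat.div_pos (Nat.le_of_dvd hjpos hdvd) hpos).ne'
  · obtain ⟨h1, h2, h3⟩ := minpoly_inv_aux (p := p) x hx
    have hfr : ∀ y : L, Module.finrank (IntermediateField.adjoin (ZMod p) {y}) L =
        j / (minpoly (ZMod p) y).natDegree := by
      intro y
      have h := Module.finrank_mul_finrank (ZMod p) (IntermediateField.adjoin (ZMod p) {y}) L
      rw [IntermediateField.adjoin.finrank (hIntg y), hj] at h
      rw [← h, Nat.mul_div_cancel_left _ (minpoly.natDegree_pos (hIntg y))]
    unfold lam
    rw [if_neg h2, map_add, map_smul, map_smul, trace_eq_finrank_mul_minpoly_nextCoeff,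
      trace_eq_finrank_mul_minpoly_nextCoeff, hfr, hfr, h3, h1, ← AddChar.map_nsmul_eq_pow]
    congr 1
    simp only [smul_eq_mul, nsmul_eq_mul]
    ring

lemma Ksum_eq {p : ℕ} [Fact p.Prime] (ψ : AddChar (ZMod p) ℂ) (a b : ZMod p)
    {L : Type*} [Field L] [Fintype L]
    [Algebra (ZMod p) L] (j : ℕ) (hj : Module.finrank (ZMod p) L = j) (d : ℕ) (hd : j ≤ d) :
    Ksum ψ a b d j = ∑ x : L, if x = 0 then 0 else ψ (Algebra.trace (ZMod p) L (a • x + b • x⁻¹)) := by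
  have hjpos : 0 < j := hj ▸ Module.finrank_pos
  simp_rw [← lam_minpoly ψ a b j hj]
  rw [← Finset.sum_fiberwise_of_maps_to (s := (univ : Finset L)) (t := irreds p d)
    (g := fun x => minpoly (ZMod p) x)]
  · unfold Ksum
    refine Finset.sum_congr rfl fun P hP => ?_
    rw [mem_irreds] at hP
    have h1 := minpoly_fiber_card (L := L) j hj P hP.1 hP.2.2
    have h2 : ∀ x ∈ (univ : Finset L).filter (fun x => minpoly (ZMod p) x = P),
      lam p ψ a b (minpoly (ZMod p) x) ^ (j / (minpoly (ZMod p) x).natDegree) =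
        lam p ψ a b P ^ (j / P.natDegree) := by
      intro x hx; rw [(mem_filter.1 hx).2]
    rw [Finset.sum_congr rfl h2, Finset.sum_const, h1]
    split_ifs <;> simp
  · intro x _
    have hIntg : IsIntegral (ZMod p) x := IsIntegral.of_finite _ _
    rw [mem_irreds]
    refine ⟨minpoly.monic hIntg, ?_, minpoly.irreducible hIntg⟩
    exact (Nat.le_of_dvd hjpos (hj ▸ minpoly.degree_dvd hIntg)).trans hd

/-- Kloosterman sums over extensions -/
def Kext (p : ℕ) [Fact p.Prime] (ψ : AddChar (ZMod p) ℂ) (a b : ZMod p) (j : ℕ) : ℂ :=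
  Ksum ψ a b j j

lemma Ksum_eq_Kext {p : ℕ} [Fact p.Prime] (ψ : AddChar (ZMod p) ℂ) (a b : ZMod p) (d j : ℕ)
    (hj : 1 ≤ j) (hjd : j ≤ d) : Ksum ψ a b d j = Kext p ψ a b j := by
  haveI : Fintype (GaloisField p j) := Fintype.ofFinite _
  have h := GaloisField.finrank p (n := j) (by omega)
  unfold Kext
  rw [Ksum_eq (L := GaloisField p j) ψ a b j h d hjd, Ksum_eq (L := GaloisField p j) ψ a b j h j le_rfl]

lemma Kext_rec {p : ℕ} [Fact p.Prime] (ψ : AddChar (ZMod p) ℂ) (a b : ZMod p) (hψ : ψ ≠ 1)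
    (ha : a ≠ 0) (hb : b ≠ 0) :
    Kext p ψ a b 1 = Ssum ψ a b 1 ∧ Kext p ψ a b 2 = 2 * p - Ssum ψ a b 1 ^ 2 ∧
    ∀ d, Kext p ψ a b (d + 3) = - Ssum ψ a b 1 * Kext p ψ a b (d + 2) - p * Kext p ψ a b (d+1) := by
  have hN : ∀ d : ℕ, (d : ℂ) * Ssum ψ a b d =
    ∑ j ∈ Icc 1 d, Kext p ψ a b j * Ssum ψ a b (d - j) := by
    intro d
    rw [newton]
    refine Finset.sum_congr rfl fun j hj => ?_
    rw [mem_Icc] at hj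
    rw [Ksum_eq_Kext ψ a b d j hj.1 hj.2]
  have h1 : Kext p ψ a b 1 = Ssum ψ a b 1 := by
    have := hN 1
    simp [Ssum_zero] at this
    exact this.symm
  refine ⟨h1, ?_, ?_⟩
  · have := hN 2
    rw [show Icc 1 2 = ({1, 2} : Finset ℕ) by rfl] at this
    simp [Ssum_zero, h1, Ssum_two ψ a b hψ ha hb] at this
    linear_combination -this
  · intro d
    have := hN (d+3)
    rw [Ssum_ge_three ψ a b hψ ha _ (by omega), mul_zero] at this
    have hsub : ∑ j ∈ Icc 1 (d+3), Kext p ψ a b j * Ssum ψ a b (d + 3 - j) =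
      ∑ j ∈ ({d+1, d+2, d+3} : Finset ℕ), Kext p ψ a b j * Ssum ψ a b (d + 3 - j) := by
      symm
      apply Finset.sum_subset
      · intro x hx; simp at hx; rw [mem_Icc]; omega
      · intro x hx hx2
        rw [mem_Icc] at hx
        simp at hx2
        rw [Ssum_ge_three ψ a b hψ ha _ (by omega), mul_zero]
    rw [hsub, Finset.sum_insert (by simp), Finset.sum_insert (by simp), Finset.sum_singleton] at this
    rw [show d + 3 - (d+1) = 2 by omega, show d + 3 - (d+2) = 1 by omega, Nat.sub_self, Ssum_zero,
      Ssum_two ψ a b hψ ha hb] at this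
    linear_combination -this

end

section
open Polynomial Finset
open scoped Classical

lemma Nc_bound {p : ℕ} [Fact p.Prime] (a b : ZMod p) (ha : a ≠ 0) (m : ℕ) (hm : 1 ≤ m)
    {L : Type*} [Field L] [Fintype L] [Algebra (ZMod p) L]
    (hL : Module.finrank (ZMod p) L = 2 * m) (c : ZMod p) :
    ((univ : Finset L).filter (fun x => x ≠ 0 ∧ Algebra.trace (ZMod p) L (a • x + b • x⁻¹) = c)).card
      ≤ p ^ (2*m-1) + (4*p+5) * p^m := by
  haveI : CharP L p := charP_of_injective_algebraMap (algebraMap (ZMod p) L).injective p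
  have hcard : Fintype.card L = p ^ (2*m) := by
    rw [Module.card_eq_pow_finrank (K := ZMod p) (V := L), ZMod.card, hL]
  have h := stepanov (F := L) p m hm hcard (algebraMap _ L a) (algebraMap _ L b) (algebraMap _ L c)
    (by simpa using ha)
  have hpp : 0 < p := (Fact.out : p.Prime).pos
  have hset : ((univ : Finset L).filter (fun x => x ≠ 0 ∧ Algebra.trace (ZMod p) L (a • x + b • x⁻¹) = c))
    = (univ : Finset L).filter (fun x => x ≠ 0 ∧ ∑ t ∈ range (2*m), (algebraMap _ L a * x^(p^t) + algebraMap _ L b * (x⁻¹)^(p^t)) = algebraMap _ L c) := by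
    ext x
    simp only [mem_filter, mem_univ, true_and]
    refine and_congr_right fun _ => ?_
    rw [← (algebraMap (ZMod p) L).injective.eq_iff, FiniteField.algebraMap_trace_eq_sum_pow, hL]
    have : ∀ t ∈ range (2*m), (a • x + b • x⁻¹) ^ (Nat.card (ZMod p)) ^ t = (algebraMap _ L a * x^(p^t) + algebraMap _ L b * (x⁻¹)^(p^t)) := by
      intro t _
      rw [Nat.card_eq_fintype_card, ZMod.card, add_pow_char_pow, Algebra.smul_def, Algebra.smul_def,
        mul_pow, mul_pow, ← map_pow, ← map_pow, ZMod.pow_card_pow, ZMod.pow_card_pow]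
    rw [Finset.sum_congr rfl this]
  rw [hset]
  refine Nat.le_of_mul_le_mul_right (h.trans (le_of_eq ?_)) (pow_pos hpp m)
  obtain ⟨n, rfl⟩ : ∃ n, m = n + 1 := ⟨m-1, by omega⟩
  rw [show 2 * (n+1) - 1 = 2*n+1 by omega, show n + 1 - 1 = n by omega]
  ring

lemma Kext_bound {p : ℕ} [Fact p.Prime] (ψ : AddChar (ZMod p) ℂ) (hψ : ψ ≠ 1)
    (a b : ZMod p) (ha : a ≠ 0) (m : ℕ) (hm : 1 ≤ m) :
    ‖Kext p ψ a b (2*m)‖ ≤ p * (4*p+5) * (p:ℝ)^m + 1 := by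
  haveI : Fintype (GaloisField p (2*m)) := Fintype.ofFinite _
  have hL := GaloisField.finrank p (n := 2*m) (by omega)
  set L := GaloisField p (2*m)
  have hcard : Fintype.card L = p ^ (2*m) := by
    rw [Module.card_eq_pow_finrank (K := ZMod p) (V := L), ZMod.card, hL]
  unfold Kext
  rw [Ksum_eq (L := L) ψ a b _ hL _ le_rfl]
  set N : ZMod p → ℕ := fun c =>
    ((univ : Finset L).filter (fun x => x ≠ 0 ∧ Algebra.trace (ZMod p) L (a • x + b • x⁻¹) = c)).card
  set M : ℕ := p ^ (2*m-1) + (4*p+5) * p^m with hM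
  have hN : ∀ c, N c ≤ M := fun c => Nc_bound a b ha m hm hL c
  have hpp : 0 < p := (Fact.out : p.Prime).pos
  have hfil : ∀ c, (((univ : Finset L).filter (fun x => x ≠ 0)).filter
      (fun x => Algebra.trace (ZMod p) L (a • x + b • x⁻¹) = c)).card = N c := by
    intro c; rw [Finset.filter_filter]
  have hsum : ∑ c, N c + 1 = p ^ (2*m) := by
    have h1 := Finset.card_eq_sum_card_fiberwise (s := (univ : Finset L).filter (fun x => x ≠ 0))
      (t := univ) (f := fun x : L => Algebra.trace (ZMod p) L (a • x + b • x⁻¹)) (by intro x _; simp)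
    simp_rw [hfil] at h1
    rw [← h1, ← hcard, Finset.filter_ne', Finset.card_erase_of_mem (mem_univ _), card_univ]
    have : 0 < Fintype.card L := Fintype.card_pos
    omega
  have hK : (∑ x : L, if x = 0 then 0 else ψ (Algebra.trace (ZMod p) L (a • x + b • x⁻¹))) =
      ∑ c, (N c : ℂ) * ψ c := by
    have h1 : (∑ x : L, if x = 0 then 0 else ψ (Algebra.trace (ZMod p) L (a • x + b • x⁻¹))) =
      ∑ x ∈ (univ : Finset L).filter (fun x => x ≠ 0), ψ (Algebra.trace (ZMod p) L (a • x + b • x⁻¹)) := by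
      rw [Finset.sum_filter]
      refine Finset.sum_congr rfl fun x _ => ?_
      by_cases hx : x = 0 <;> simp [hx]
    rw [h1, ← Finset.sum_fiberwise (s := (univ : Finset L).filter (fun x => x ≠ 0))
      (g := fun x : L => Algebra.trace (ZMod p) L (a • x + b • x⁻¹))]
    refine Finset.sum_congr rfl fun c _ => ?_
    rw [← hfil c, ← nsmul_eq_mul, ← Finset.sum_const]
    refine Finset.sum_congr rfl fun x hx => ?_
    rw [(mem_filter.1 hx).2]
  rw [hK]
  have h0 : ∑ c, ψ c = 0 := by
    rw [AddChar.sum_eq_zero_iff_ne_zero]; exact hψ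
  have h2 : ∑ c, (N c : ℂ) * ψ c = - ∑ c, ((M : ℂ) - N c) * ψ c := by
    simp_rw [sub_mul]
    rw [Finset.sum_sub_distrib, ← Finset.mul_sum, h0]; ring
  rw [h2, norm_neg]
  have h3 : ∀ c, ‖((M : ℂ) - N c) * ψ c‖ = (M : ℝ) - N c := by
    intro c
    rw [norm_mul, AddChar.norm_apply, mul_one]
    have : (M : ℂ) - N c = ((M - N c : ℕ) : ℂ) := by rw [Nat.cast_sub (hN c)]
    rw [this, Complex.norm_natCast, Nat.cast_sub (hN c)]
  refine (norm_sum_le _ _).trans ?_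
  rw [Finset.sum_congr rfl (fun c _ => h3 c), Finset.sum_sub_distrib]
  have h4 : (∑ c, (N c : ℝ)) = (p:ℝ)^(2*m) - 1 := by
    have := congrArg (fun n : ℕ => (n : ℝ)) hsum
    push_cast at this
    linarith
  rw [h4, Finset.sum_const, card_univ, ZMod.card, hM, nsmul_eq_mul]
  push_cast
  obtain ⟨n, rfl⟩ : ∃ n, m = n + 1 := ⟨m-1, by omega⟩
  rw [show 2 * (n+1) - 1 = 2*n+1 by omega]
  apply le_of_eq
  ring

theorem weil_prime {p : ℕ} [Fact p.Prime] (ψ : AddChar (ZMod p) ℂ) (hψ : ψ ≠ 1)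
    (a b : ZMod p) (ha : a ≠ 0) (hb : b ≠ 0) :
    ‖∑ x : ZMod p, if x = 0 then 0 else ψ (a * x + b * x⁻¹)‖ ≤ 2 * Real.sqrt p := by
  obtain ⟨h1, h2, h3⟩ := Kext_rec ψ a b hψ ha hb
  have hS := Ssum_one ψ a b
  rw [← hS]
  have hreal : (starRingEnd ℂ) (Ssum ψ a b 1) = Ssum ψ a b 1 := by
    rw [hS, map_sum, ← Equiv.sum_comp (Equiv.neg (ZMod p))]
    refine Finset.sum_congr rfl fun x _ => ?_
    simp only [Equiv.neg_apply, neg_eq_zero]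
    split_ifs
    · simp
    · rw [← AddChar.map_neg_eq_conj]; congr 1; rw [inv_neg]; ring
  obtain ⟨s, hs⟩ := Complex.conj_eq_iff_real.1 hreal
  rw [hs] at h1 h2 h3 ⊢
  rw [Complex.norm_real, Real.norm_eq_abs]
  have hpp : 0 < (p:ℝ) := by exact_mod_cast (Fact.out : p.Prime).pos
  by_contra hcon
  push Not at hcon
  have hsq : 4 * (p:ℝ) < s ^ 2 := by
    have : (2 * Real.sqrt p)^2 < |s|^2 := by
      apply pow_lt_pow_left₀ hcon (by positivity) (by norm_num)
    rw [sq_abs, mul_pow, Real.sq_sqrt hpp.le] at this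
    linarith
  set D := Real.sqrt (s^2 - 4*p) with hD
  have hDD : D^2 = s^2 - 4*p := Real.sq_sqrt (by linarith)
  have hDpos : 0 < D := Real.sqrt_pos.2 (by linarith)
  set al := (-s + D)/2 with hal
  set be := (-s - D)/2 with hbe
  have hsum : al + be = -s := by rw [hal, hbe]; ring
  have hprod : al * be = p := by rw [hal, hbe]; linear_combination (-1/4) * hDD
  have hform : ∀ n : ℕ, Kext p ψ a b (n+1) = ((-(al^(n+1) + be^(n+1)) : ℝ) : ℂ) ∧
     Kext p ψ a b (n+2) = ((-(al^(n+2) + be^(n+2)) : ℝ) : ℂ) := by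
    intro n
    induction n with
    | zero =>
      constructor
      · rw [zero_add, h1]; norm_cast; linarith
      · rw [zero_add, h2]; norm_cast
        push_cast
        have : s = -(al + be) := by linarith
        rw [this, ← hprod]; ring
    | succ n ih =>
      refine ⟨ih.2, ?_⟩
      rw [show n + 1 + 2 = n + 3 by ring, h3, ih.1, ih.2]
      have : (-s * (-(al ^ (n + 2) + be ^ (n + 2))) - p * (-(al ^ (n + 1) + be ^ (n + 1)))) = (-(al^(n+3) + be^(n+3)) : ℝ) := by
        rw [← hsum, ← hprod]; ring
      rw [← this]; push_cast; ring
  set ρ := max (al^2) (be^2) with hρ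
  have hρp : 1 < ρ / p := by
    rw [lt_div_iff₀ hpp, one_mul]
    have : al ^2 + be^2 > 2 * p := by nlinarith
    rcases max_cases (al^2) (be^2) with h | h <;> linarith
  have hb2 : ∀ m : ℕ, 1 ≤ m → ρ ^ m ≤ p * (4*p+5) * (p:ℝ)^m + 1 := by
    intro m hm
    have := Kext_bound ψ hψ a b ha m hm
    obtain ⟨n, hn⟩ : ∃ n, 2 * m = n + 1 := ⟨2*m-1, by omega⟩
    rw [hn, (hform n).1, Complex.norm_real, Real.norm_eq_abs, abs_neg, ← hn, pow_mul, pow_mul] at this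
    have h5 : 0 ≤ (al^2)^m := by positivity
    have h6 : 0 ≤ (be^2)^m := by positivity
    rw [abs_of_nonneg (by positivity)] at this
    rcases max_cases (al^2) (be^2) with h | h
    · rw [hρ, h.1]; linarith
    · rw [hρ, h.1]; linarith
  obtain ⟨n, hn⟩ := pow_unbounded_of_one_lt (p * (4*p+5) + 1 : ℝ) hρp
  have h7 := hb2 (n+1) (by omega)
  have h8 : (ρ/p)^(n+1) > p * (4*p+5) + 1 := by
    rw [pow_succ]; nlinarith [pow_pos (lt_trans one_pos hρp) n]
  rw [div_pow, gt_iff_lt, lt_div_iff₀ (by positivity)] at h8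
  have h9 : (1:ℝ) ≤ (p:ℝ)^(n+1) := one_le_pow₀ (by exact_mod_cast (Fact.out : p.Prime).one_le)
  nlinarith

end

section
open Finset
open scoped Classical

/-- Kloosterman sum of a pair of additive characters -/
def Kl (m : ℕ) [NeZero m] (φ χ : AddChar (ZMod m) ℂ) : ℂ :=
  ∑ u : (ZMod m)ˣ, φ (u : ZMod m) * χ ((u⁻¹ : (ZMod m)ˣ) : ZMod m)

lemma Kl_swap (m : ℕ) [NeZero m] (φ χ : AddChar (ZMod m) ℂ) : Kl m φ χ = Kl m χ φ := by
  unfold Kl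
  rw [← Equiv.sum_comp (Equiv.inv (ZMod m)ˣ)]
  refine Finset.sum_congr rfl fun u _ => ?_
  simp [mul_comm]

lemma Kl_trivial (m : ℕ) [NeZero m] (φ χ : AddChar (ZMod m) ℂ) : ‖Kl m φ χ‖ ≤ m := by
  unfold Kl
  refine (norm_sum_le _ _).trans ?_
  have : ∀ u ∈ (univ : Finset (ZMod m)ˣ), ‖φ (u : ZMod m) * χ ((u⁻¹ : (ZMod m)ˣ) : ZMod m)‖ = 1 := by
    intro u _
    rw [norm_mul, AddChar.norm_apply, AddChar.norm_apply, mul_one]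
  rw [Finset.sum_congr rfl this, sum_const, card_univ, nsmul_eq_mul, mul_one, ZMod.card_units_eq_totient]
  exact_mod_cast Nat.totient_le m

lemma sum_units_field {p : ℕ} [Fact p.Prime] (f : ZMod p → ℂ) :
    ∑ u : (ZMod p)ˣ, f u = ∑ x : ZMod p, if x = 0 then 0 else f x := by
  rw [← Finset.sum_filter_add_sum_filter_not univ (fun x : ZMod p => x = 0)]
  rw [Finset.sum_eq_zero (s := univ.filter (fun x : ZMod p => x = 0))
    (fun x hx => by rw [if_pos (mem_filter.1 hx).2]), zero_add]
  refine Finset.sum_bij (fun u _ => (u : ZMod p)) ?_ ?_ ?_ ?_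
  · intro u _; simp
  · intro u _ v _ h; exact Units.ext h
  · intro x hx
    refine ⟨Units.mk0 x (by simpa using hx), mem_univ _, rfl⟩
  · intro u _; simp

lemma mulShift_surj (m : ℕ) [NeZero m] (χ : AddChar (ZMod m) ℂ) (hχ : χ.IsPrimitive)
    (φ : AddChar (ZMod m) ℂ) : ∃ b, χ.mulShift b = φ := by
  have h1 := AddChar.to_mulShift_inj_of_isPrimitive hχ
  have h2 : Function.Bijective (χ.mulShift) := by
    rw [Fintype.bijective_iff_injective_and_card]
    refine ⟨h1, ?_⟩
    rw [AddChar.card_eq]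
  exact h2.2 φ

lemma Kl_prime {p : ℕ} [Fact p.Prime] (φ χ : AddChar (ZMod p) ℂ) (hχ : χ ≠ 1) :
    ‖Kl p φ χ‖ ≤ 2 * Real.sqrt p := by
  have hp1 : (1:ℝ) ≤ p := by exact_mod_cast (Fact.out : p.Prime).one_le
  have hs1 : (1:ℝ) ≤ Real.sqrt p := Real.one_le_sqrt.2 hp1
  by_cases hφ : φ = 1
  · subst hφ
    rw [Kl_swap]
    unfold Kl
    simp only [AddChar.one_apply, mul_one]
    have h0 : ∑ c, χ c = 0 := by
      rw [AddChar.sum_eq_zero_iff_ne_zero]; exact hχ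
    rw [sum_units_field]
    have : ∀ x : ZMod p, (if x = 0 then 0 else χ x) = χ x - if x = 0 then 1 else 0 := by
      intro x; split_ifs with h <;> simp [h]
    simp_rw [this]
    rw [Finset.sum_sub_distrib, h0]
    simp
    linarith
  · -- both nontrivial
    have hprim : χ.IsPrimitive := AddChar.IsPrimitive.of_ne_one hχ
    obtain ⟨b, hb⟩ := mulShift_surj p χ hprim φ
    have hb0 : b ≠ 0 := by
      rintro rfl; apply hφ; rw [← hb]; simp
    have := weil_prime χ hχ b 1 hb0 one_ne_zero
    convert this using 2
    unfold Kl
    rw [← sum_units_field]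
    refine Finset.sum_congr rfl fun u _ => ?_
    rw [← hb, AddChar.mulShift_apply, ← AddChar.map_add_eq_mul]
    rw [one_mul, Units.val_inv_eq_inv_val]

lemma Kl_mul {m n : ℕ} [NeZero m] [NeZero n] (h : m.Coprime n)
    (φ χ : AddChar (ZMod (m * n)) ℂ) :
    haveI : NeZero (m * n) := ⟨mul_ne_zero (NeZero.ne m) (NeZero.ne n)⟩
    ∃ (φ1 χ1 : AddChar (ZMod m) ℂ) (φ2 χ2 : AddChar (ZMod n) ℂ),
      Kl (m * n) φ χ = Kl m φ1 χ1 * Kl n φ2 χ2 ∧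
      (∀ k, χ1 ^ k = 1 → χ ^ (k * n) = 1) ∧ (∀ k, χ2 ^ k = 1 → χ ^ (k * m) = 1) := by
  haveI : NeZero (m * n) := ⟨mul_ne_zero (NeZero.ne m) (NeZero.ne n)⟩
  set e := ZMod.chineseRemainder h
  let i1 : ZMod m →+ ZMod (m*n) := (e.symm : ZMod m × ZMod n →+ ZMod (m*n)).comp (AddMonoidHom.inl _ _)
  let i2 : ZMod n →+ ZMod (m*n) := (e.symm : ZMod m × ZMod n →+ ZMod (m*n)).comp (AddMonoidHom.inr _ _)
  have hsplit : ∀ (φ : AddChar (ZMod (m*n)) ℂ) (x : ZMod (m*n)),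
      φ x = φ (i1 (e x).1) * φ (i2 (e x).2) := by
    intro φ x
    rw [← AddChar.map_add_eq_mul]
    congr 1
    apply e.injective
    simp [i1, i2]
  refine ⟨φ.compAddMonoidHom i1, χ.compAddMonoidHom i1, φ.compAddMonoidHom i2, χ.compAddMonoidHom i2,
    ?_, ?_, ?_⟩
  · unfold Kl
    rw [Finset.sum_mul_sum, ← Finset.sum_product', Finset.univ_product_univ]
    refine Fintype.sum_equiv ((Units.mapEquiv (e : ZMod (m*n) ≃* ZMod m × ZMod n)).toEquiv.trans
      (MulEquiv.prodUnits).toEquiv) _ _ ?_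
    intro u
    rw [hsplit φ, hsplit χ]
    simp only [AddChar.compAddMonoidHom_apply]
    have hu1 : ((e ((u⁻¹ : (ZMod (m*n))ˣ) : ZMod (m*n)))) =
      (((Units.mapEquiv (e : ZMod (m*n) ≃* ZMod m × ZMod n) u)⁻¹ : (ZMod m × ZMod n)ˣ) : ZMod m × ZMod n) := by
      rw [← map_inv]; rfl
    rw [hu1]
    simp only [Equiv.trans_apply]
    have e1 : ∀ v : (ZMod m × ZMod n)ˣ, (((MulEquiv.prodUnits v).1⁻¹ : (ZMod m)ˣ) : ZMod m) = ((v⁻¹ : (ZMod m × ZMod n)ˣ) : ZMod m × ZMod n).1 := fun v => rfl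
    have e2 : ∀ v : (ZMod m × ZMod n)ˣ, (((MulEquiv.prodUnits v).2⁻¹ : (ZMod n)ˣ) : ZMod n) = ((v⁻¹ : (ZMod m × ZMod n)ˣ) : ZMod m × ZMod n).2 := fun v => rfl
    have e3 : ∀ v : (ZMod m × ZMod n)ˣ, (((MulEquiv.prodUnits v).1 : (ZMod m)ˣ) : ZMod m) = (v : ZMod m × ZMod n).1 := fun v => rfl
    have e4 : ∀ v : (ZMod m × ZMod n)ˣ, (((MulEquiv.prodUnits v).2 : (ZMod n)ˣ) : ZMod n) = (v : ZMod m × ZMod n).2 := fun v => rfl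
    simp only [MulEquiv.toEquiv_eq_coe, MulEquiv.coe_toEquiv, e1, e2, e3, e4, Units.coe_mapEquiv]
    simp only [RingEquiv.coe_toMulEquiv]
    ring
  · intro k hk
    ext x
    have h1 := DFunLike.congr_fun hk (n • (e x).1)
    rw [AddChar.pow_apply, AddChar.compAddMonoidHom_apply, AddChar.one_apply] at h1
    rw [AddChar.pow_apply, AddChar.one_apply, hsplit χ x, mul_pow, mul_comm k n, pow_mul, pow_mul,
      ← AddChar.map_nsmul_eq_pow χ n, ← map_nsmul, h1, one_mul, ← AddChar.map_nsmul_eq_pow χ n,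
      ← map_nsmul]
    simp
  · intro k hk
    ext x
    have h1 := DFunLike.congr_fun hk (m • (e x).2)
    rw [AddChar.pow_apply, AddChar.compAddMonoidHom_apply, AddChar.one_apply] at h1
    rw [AddChar.pow_apply, AddChar.one_apply, hsplit χ x, mul_pow, mul_comm k m, pow_mul, pow_mul,
      ← AddChar.map_nsmul_eq_pow χ m (i2 _), ← map_nsmul, h1, mul_one, ← AddChar.map_nsmul_eq_pow χ m,
      ← map_nsmul]
    simp

lemma Kl_squarefree (m : ℕ) : ∀ [NeZero m], Squarefree m → ∀ (φ χ : AddChar (ZMod m) ℂ) (n : ℕ),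
    n ∣ m → (∀ k, χ ^ k = 1 → n ∣ k) →
    ‖Kl m φ χ‖ ≤ m.divisors.card * Real.sqrt m * (m / n : ℕ) := by
  induction m using Nat.recOnPosPrimePosCoprime with
  | prime_pow p v hp hv =>
    intro _ hsq φ χ n hn hk
    have hv1 : v = 1 := by
      by_contra hne
      have : p * p ∣ p ^ v := by rw [← sq]; exact pow_dvd_pow p (by omega)
      have := hsq p this
      exact hp.one_lt.ne' (Nat.isUnit_iff.1 this)
    subst hv1
    revert φ χ
    rw! [pow_one] 
    intro φ χ hk
    rw [pow_one] at hn
    haveI : Fact p.Prime := ⟨hp⟩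
    rw [hp.divisors, Finset.card_pair hp.one_lt.ne]
    rcases (Nat.dvd_prime hp).1 hn with rfl | rfl
    · refine (Kl_trivial p φ χ).trans ?_
      have hp1 : (1:ℝ) ≤ p := by exact_mod_cast hp.one_le
      have hs1 : (1:ℝ) ≤ Real.sqrt p := Real.one_le_sqrt.2 hp1
      rw [Nat.div_one]; push_cast
      nlinarith
    · rw [Nat.div_self hp.pos]
      have : χ ≠ 1 := by
        rintro rfl
        have := hk 1 (by simp)
        exact hp.one_lt.ne' (Nat.dvd_one.1 this)
      simpa using Kl_prime φ χ this
  | zero => intro h; exact absurd rfl h.out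
  | one =>
    intro _ _ φ χ n hn _
    refine (Kl_trivial 1 φ χ).trans ?_
    rw [Nat.dvd_one.1 hn]; simp
  | coprime a b ha hb hab iha ihb =>
    intro hne hsq φ χ n hn hk
    haveI : NeZero a := ⟨by omega⟩
    haveI : NeZero b := ⟨by omega⟩
    have hsqa : Squarefree a := hsq.squarefree_of_dvd (dvd_mul_right _ _)
    have hsqb : Squarefree b := hsq.squarefree_of_dvd (dvd_mul_left _ _)
    obtain ⟨φ1, χ1, φ2, χ2, hK, h1, h2⟩ := Kl_mul hab φ χ
    have hK' : Kl (a*b) φ χ = Kl a φ1 χ1 * Kl b φ2 χ2 := hK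
    rw [hK', norm_mul]
    have hn1 : Nat.gcd n a ∣ a := Nat.gcd_dvd_right _ _
    have hn2 : Nat.gcd n b ∣ b := Nat.gcd_dvd_right _ _
    have i1 := iha hsqa φ1 χ1 (Nat.gcd n a) hn1 (by
      intro k hk1
      have h3 := (Nat.gcd_dvd_left n a).trans (hk _ (h1 k hk1))
      exact ((Nat.Coprime.coprime_dvd_left hn1 hab).dvd_of_dvd_mul_right h3))
    have i2 := ihb hsqb φ2 χ2 (Nat.gcd n b) hn2 (by
      intro k hk1
      have h3 := (Nat.gcd_dvd_left n b).trans (hk _ (h2 k hk1))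
      exact ((Nat.Coprime.coprime_dvd_left hn2 hab.symm).dvd_of_dvd_mul_right h3))
    have hnn : n = Nat.gcd n a * Nat.gcd n b := by
      rw [← Nat.Coprime.gcd_mul n hab, Nat.gcd_eq_left hn]
    have hdiv : a * b / n = (a / Nat.gcd n a) * (b / Nat.gcd n b) := by
      conv_lhs => rw [hnn]
      rw [Nat.mul_div_mul_comm hn1 hn2]
    rw [hdiv, Nat.Coprime.card_divisors_mul hab]
    push_cast
    rw [Real.sqrt_mul (by positivity)]
    refine (mul_le_mul i1 i2 (norm_nonneg _) (mul_nonneg (mul_nonneg (Nat.cast_nonneg _) (Real.sqrt_nonneg _)) (Nat.cast_nonneg _))).trans (le_of_eq ?_)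
    ring

/-- weight used for the general modulus: `m = a b ^ 2` with `a` squarefree -/
lemma Kl_general (m : ℕ) [NeZero m] (a b : ℕ) (hm : m = a * b ^ 2) (hsq : Squarefree a)
    (φ χ : AddChar (ZMod m) ℂ) (n : ℕ) (hn : n ∣ m) (hk : ∀ k, χ ^ k = 1 → n ∣ k) :
    ‖Kl m φ χ‖ ≤ m.divisors.card * Real.sqrt m * (b * Nat.gcd a b : ℕ) * (m / n : ℕ) := by
  have hm0 : m ≠ 0 := NeZero.ne m
  have hb0 : b ≠ 0 := by rintro rfl; simp at hm; exact hm0 hm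
  have ha0 : a ≠ 0 := by rintro rfl; simp at hm; exact hm0 hm
  set g := Nat.gcd a b with hg
  have hg0 : 0 < g := Nat.gcd_pos_of_pos_left _ (Nat.pos_of_ne_zero ha0)
  obtain ⟨a1, ha1⟩ : g ∣ a := Nat.gcd_dvd_left a b
  have hcop : a1.Coprime b := by
    rw [Nat.coprime_iff_gcd_eq_one]
    have h1 : Nat.gcd a1 b ∣ g := Nat.dvd_gcd ((Nat.gcd_dvd_left _ _).trans ⟨g, by rw [ha1]; ring⟩)
      (Nat.gcd_dvd_right _ _)
    have h2 : Nat.gcd a1 b * Nat.gcd a1 b ∣ a := by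
      rw [ha1]; exact mul_dvd_mul h1 (Nat.gcd_dvd_left _ _)
    exact Nat.isUnit_iff.1 (hsq _ h2)
  have hcopg : a1.Coprime g := Nat.Coprime.coprime_dvd_right (Nat.gcd_dvd_right a b) hcop
  set q := g * b ^ 2 with hq
  have hmq : m = a1 * q := by rw [hm, hq]; conv_lhs => rw [ha1]
                              ring
  have hcopq : a1.Coprime q := Nat.Coprime.mul_right hcopg (Nat.Coprime.pow_right 2 hcop)
  have ha10 : a1 ≠ 0 := by rintro rfl; simp at ha1; exact ha0 ha1
  have hq0 : q ≠ 0 := by rw [hq]; positivity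
  haveI : NeZero a1 := ⟨ha10⟩
  haveI : NeZero q := ⟨hq0⟩
  have hsq1 : Squarefree a1 := hsq.squarefree_of_dvd ⟨g, by rw [ha1]; ring⟩
  clear_value q g
  subst hmq
  obtain ⟨φ1, χ1, φ2, χ2, hK, h1, h2⟩ := Kl_mul hcopq φ χ
  have hK' : Kl (a1*q) φ χ = Kl a1 φ1 χ1 * Kl q φ2 χ2 := hK
  rw [hK', norm_mul]
  have hn1 : Nat.gcd n a1 ∣ a1 := Nat.gcd_dvd_right _ _
  have hn2 : Nat.gcd n q ∣ q := Nat.gcd_dvd_right _ _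
  have i1 := Kl_squarefree a1 hsq1 φ1 χ1 (Nat.gcd n a1) hn1 (by
      intro k hk1
      have h3 := (Nat.gcd_dvd_left n a1).trans (hk _ (h1 k hk1))
      exact ((Nat.Coprime.coprime_dvd_left hn1 hcopq).dvd_of_dvd_mul_right h3))
  have hnn : n = Nat.gcd n a1 * Nat.gcd n q := by
    rw [← Nat.Coprime.gcd_mul n hcopq, Nat.gcd_eq_left hn]
  have hnpos : 0 < n := Nat.pos_of_dvd_of_pos hn (by positivity)
  have hdiv : a1 * q / n = (a1 / Nat.gcd n a1) * (q / Nat.gcd n q) := by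
    conv_lhs => rw [hnn]
    rw [Nat.mul_div_mul_comm hn1 hn2]
  have hge : 1 ≤ q / Nat.gcd n q :=
    Nat.div_pos (Nat.le_of_dvd (Nat.pos_of_ne_zero hq0) hn2) (Nat.gcd_pos_of_pos_left _ hnpos)
  have i2 := Kl_trivial q φ2 χ2
  refine (mul_le_mul i1 i2 (norm_nonneg _) (mul_nonneg (mul_nonneg (Nat.cast_nonneg _) (Real.sqrt_nonneg _)) (Nat.cast_nonneg _))).trans ?_
  have hd : (a1.divisors.card : ℝ) ≤ (a1 * q).divisors.card := by
    exact_mod_cast Finset.card_le_card (Nat.divisors_subset_of_dvd hm0 (dvd_mul_right _ _))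
  have hs : Real.sqrt a1 * q ≤ Real.sqrt ((a1 * q : ℕ) : ℝ) * (b * g : ℕ) := by
    have hqs : (q : ℝ) = Real.sqrt q * Real.sqrt q := (Real.mul_self_sqrt (by positivity)).symm
    have : Real.sqrt q ≤ (b * g : ℕ) := by
      rw [Real.sqrt_le_left (by positivity)]
      have : q ≤ (b*g)^2 := by
        rw [hq]; nlinarith [Nat.pos_of_ne_zero hb0, sq_nonneg b, Nat.mul_le_mul_left (b^2 * g) hg0]
      exact_mod_cast this
    push_cast
    rw [Real.sqrt_mul (by positivity)]
    conv_lhs => rw [hqs]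
    rw [← mul_assoc]
    refine mul_le_mul_of_nonneg_left ?_ (by positivity)
    exact_mod_cast this
  rw [hdiv]
  calc (a1.divisors.card * Real.sqrt a1 * (a1 / Nat.gcd n a1 : ℕ)) * q
      = a1.divisors.card * (Real.sqrt a1 * q) * ((a1 / Nat.gcd n a1 : ℕ) : ℝ) := by ring
    _ ≤ (a1 * q).divisors.card * (Real.sqrt ((a1 * q : ℕ) : ℝ) * (b * g : ℕ)) *
        ((a1 / Nat.gcd n a1 * (q / Nat.gcd n q) : ℕ) : ℝ) := by
        have hle := Nat.le_mul_of_pos_right (a1 / Nat.gcd n a1) hge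
        generalize a1 / Nat.gcd n a1 * (q / Nat.gcd n q) = z at hle
        generalize a1 / Nat.gcd n a1 = y at hle
        refine mul_le_mul (mul_le_mul hd hs ?_ (Nat.cast_nonneg _)) (by exact_mod_cast hle)
          (Nat.cast_nonneg _) ?_
        · exact mul_nonneg (Real.sqrt_nonneg _) (Nat.cast_nonneg _)
        · exact mul_nonneg (Nat.cast_nonneg _) (mul_nonneg (Real.sqrt_nonneg _) (Nat.cast_nonneg _))
    _ = _ := by ring

end

section
open Finset

lemma divisor_bound (ε : ℝ) (hε : 0 < ε) : ∃ C : ℝ, 1 ≤ C ∧ ∀ n : ℕ, 1 ≤ n →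
    (n.divisors.card : ℝ) ≤ C * (n : ℝ) ^ ε := by
  set A : ℝ := max 1 (1 / (ε * Real.log 2)) with hA
  have hA1 : 1 ≤ A := le_max_left _ _
  have hl2 : 0 < Real.log 2 := Real.log_pos (by norm_num)
  have hA2 : 1 ≤ A * (ε * Real.log 2) := by
    have : 1 / (ε * Real.log 2) ≤ A := le_max_right _ _
    rwa [div_le_iff₀ (by positivity)] at this
  set P0 : ℕ := ⌈(2:ℝ) ^ (1/ε)⌉₊ with hP0
  refine ⟨A ^ P0, one_le_pow₀ hA1, ?_⟩
  intro n hn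
  have hn0 : n ≠ 0 := by omega
  have hloc1 : ∀ p v : ℕ, p.Prime → ((v:ℝ) + 1) ≤ A * ((p:ℝ) ^ v) ^ ε := by
    intro p v hp
    have hp2 : (2:ℝ) ≤ p := by exact_mod_cast hp.two_le
    have h1 : ((2:ℝ) ^ v) ^ ε ≤ ((p:ℝ) ^ v) ^ ε := by gcongr
    have h2 : ((2:ℝ) ^ v) ^ ε = Real.exp (v * (ε * Real.log 2)) := by
      rw [Real.rpow_def_of_pos (by positivity), Real.log_pow]; congr 1; ring
    have h3 := Real.add_one_le_exp ((v:ℝ) * (ε * Real.log 2))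
    calc ((v:ℝ) + 1) ≤ A * ((v:ℝ) * (ε * Real.log 2) + 1) := by
          have : (0:ℝ) ≤ v := Nat.cast_nonneg v
          nlinarith
      _ ≤ A * ((p:ℝ) ^ v) ^ ε := by gcongr; linarith
  have hloc2 : ∀ p v : ℕ, p.Prime → P0 ≤ p → ((v:ℝ) + 1) ≤ ((p:ℝ) ^ v) ^ ε := by
    intro p v hp hpP
    have h1 : (2:ℝ) ^ (1/ε) ≤ p := (Nat.le_ceil _).trans (by exact_mod_cast hpP)
    have h2 : (2:ℝ) ≤ (p:ℝ) ^ ε := by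
      calc (2:ℝ) = ((2:ℝ) ^ (1/ε)) ^ ε := by
            rw [← Real.rpow_mul (by norm_num)]; field_simp; simp
        _ ≤ _ := by gcongr
    have h3 : ((p:ℝ) ^ v) ^ ε = ((p:ℝ) ^ ε) ^ v := by
      rw [← Real.rpow_natCast, ← Real.rpow_mul (by positivity), mul_comm, Real.rpow_mul (by positivity),
        Real.rpow_natCast]
    rw [h3]
    have h4 : (v:ℝ) + 1 ≤ 2 ^ v := by exact_mod_cast (Nat.lt_two_pow_self (n := v))
    exact h4.trans (by gcongr)
  rw [Nat.card_divisors hn0]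
  push_cast
  have hnprod : (n:ℝ) ^ ε = ∏ p ∈ n.primeFactors, ((p:ℝ) ^ (n.factorization p)) ^ ε := by
    rw [Real.finset_prod_rpow _ _ (fun i _ => by positivity)]
    congr 1
    conv_lhs => rw [← Nat.factorization_prod_pow_eq_self hn0]
    rw [Finsupp.prod]; push_cast; rfl
  rw [hnprod]
  have hstep : ∏ p ∈ n.primeFactors, ((n.factorization p : ℝ) + 1) ≤
      ∏ p ∈ n.primeFactors, ((if p < P0 then A else 1) * ((p:ℝ) ^ (n.factorization p)) ^ ε) := by
    apply Finset.prod_le_prod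
    · intro p _; positivity
    · intro p hp
      have hpp := Nat.prime_of_mem_primeFactors hp
      split_ifs with h
      · exact hloc1 p _ hpp
      · rw [one_mul]; exact hloc2 p _ hpp (by omega)
  refine hstep.trans ?_
  rw [Finset.prod_mul_distrib]
  refine mul_le_mul_of_nonneg_right ?_ (Finset.prod_nonneg fun p _ => by positivity)
  rw [Finset.prod_ite, Finset.prod_const_one, mul_one, Finset.prod_const]
  refine pow_le_pow_right₀ hA1 ?_
  calc _ ≤ (Finset.range P0).card := Finset.card_le_card (by
        intro p hp; rw [mem_filter] at hp; exact mem_range.2 hp.2)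
    _ = P0 := card_range _

lemma log_bound (ε : ℝ) (hε : 0 < ε) (x : ℝ) (hx : 1 ≤ x) : 1 + Real.log x ≤ (1 + 1/ε) * x ^ ε := by
  have h1 := Real.log_le_rpow_div (by linarith : 0 ≤ x) hε
  have h2 : 1 ≤ x ^ ε := Real.one_le_rpow hx hε.le
  calc 1 + Real.log x ≤ x ^ ε + x ^ ε / ε := by linarith
    _ = _ := by ring

/-- square part decomposition `n = sqa n * sqb n ^ 2` -/
def sqb (n : ℕ) : ℕ := (Nat.sq_mul_squarefree n).choose_spec.choose
def sqa (n : ℕ) : ℕ := (Nat.sq_mul_squarefree n).choose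

lemma sq_decomp (n : ℕ) : n = sqa n * sqb n ^ 2 ∧ Squarefree (sqa n) := by
  have := (Nat.sq_mul_squarefree n).choose_spec.choose_spec
  refine ⟨?_, this.2⟩
  rw [mul_comm]; exact this.1.symm

def Gw (n : ℕ) : ℕ := sqb n * Nat.gcd (sqa n) (sqb n)

lemma gcd_le_sum_dvd (a b : ℕ) (hb : 1 ≤ b) :
    (Nat.gcd a b : ℝ) ≤ ∑ g ∈ b.divisors, if g ∣ a then (g:ℝ) else 0 := by
  have h := Finset.single_le_sum (f := fun g : ℕ => if g ∣ a then (g:ℝ) else 0) (s := b.divisors)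
    (fun i _ => by split_ifs <;> positivity) (a := Nat.gcd a b)
    (Nat.mem_divisors.2 ⟨Nat.gcd_dvd_right _ _, by omega⟩)
  rwa [if_pos (Nat.gcd_dvd_left _ _)] at h

lemma sum_gcd_le (b : ℕ) (hb : 1 ≤ b) (A : ℕ) :
    ∑ a ∈ Icc 1 A, (Nat.gcd a b : ℝ) ≤ b.divisors.card * A := by
  calc ∑ a ∈ Icc 1 A, (Nat.gcd a b : ℝ) ≤ ∑ a ∈ Icc 1 A, ∑ g ∈ b.divisors, if g ∣ a then (g:ℝ) else 0 :=
        Finset.sum_le_sum fun a _ => gcd_le_sum_dvd a b hb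
    _ = ∑ g ∈ b.divisors, ∑ a ∈ Icc 1 A, if g ∣ a then (g:ℝ) else 0 := Finset.sum_comm
    _ ≤ ∑ g ∈ b.divisors, (A:ℝ) := by
        refine Finset.sum_le_sum fun g hg => ?_
        have hgpos := Nat.pos_of_mem_divisors hg
        rw [← Finset.sum_filter, Finset.sum_const, nsmul_eq_mul]
        have : ((Icc 1 A).filter (fun a => g ∣ a)).card = A / g := by
          have := Nat.Ioc_filter_dvd_card_eq_div A g
          rw [← this]; congr 1
        rw [this]
        exact_mod_cast Nat.div_mul_le_self A g
    _ = _ := by rw [Finset.sum_const, nsmul_eq_mul]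

lemma sum_Gw_le (ε : ℝ) (hε : 0 < ε) : ∃ C : ℝ, 0 ≤ C ∧ ∀ M : ℕ, 1 ≤ M →
    ∑ m ∈ Icc 1 M, (Gw m : ℝ) ≤ C * (M:ℝ) ^ (1 + ε) := by
  obtain ⟨C, hC1, hC⟩ := divisor_bound (ε/2) (by positivity)
  refine ⟨C * (1 + 1/(ε/2)), by positivity, ?_⟩
  intro M hM
  have hM' : (1:ℝ) ≤ M := by exact_mod_cast hM
  have h1 : ∑ m ∈ Icc 1 M, (Gw m : ℝ) ≤ ∑ b ∈ Icc 1 M, ∑ a ∈ Icc 1 (M / b^2), (b:ℝ) * (Nat.gcd a b : ℝ) := by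
    rw [Finset.sum_sigma']
    have hinj : Set.InjOn (fun m => (⟨sqb m, sqa m⟩ : (_ : ℕ) × ℕ)) (Icc 1 M : Finset ℕ) := by
      intro m hm m' hm' h
      simp only [Sigma.mk.injEq, heq_eq_eq] at h
      rw [(sq_decomp m).1, (sq_decomp m').1, h.1, h.2]
    have himg : (Icc 1 M).image (fun m => (⟨sqb m, sqa m⟩ : (_ : ℕ) × ℕ)) ⊆
        (Icc 1 M).sigma (fun b => Icc 1 (M / b^2)) := by
      rw [Finset.image_subset_iff]
      intro m hm
      rw [Finset.mem_Icc] at hm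
      have hd := (sq_decomp m).1
      have hb : sqb m ≠ 0 := by intro h; rw [h] at hd; simp at hd; omega
      have ha : sqa m ≠ 0 := by intro h; rw [h] at hd; simp at hd; omega
      have hb1 : 1 ≤ sqb m := Nat.pos_of_ne_zero hb
      have ha1 : 1 ≤ sqa m := Nat.pos_of_ne_zero ha
      simp only [Finset.mem_sigma, Finset.mem_Icc]
      refine ⟨⟨hb1, ?_⟩, ha1, ?_⟩
      · nlinarith
      · rw [Nat.le_div_iff_mul_le (by positivity)]; omega
    refine le_trans (le_of_eq ?_) (Finset.sum_le_sum_of_subset_of_nonneg himg ?_)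
    · rw [Finset.sum_image hinj]
      refine Finset.sum_congr rfl fun m _ => ?_
      simp [Gw]
    · intro i _ _; positivity
  refine h1.trans ?_
  have h2 : ∀ b ∈ Icc 1 M, ∑ a ∈ Icc 1 (M / b^2), (b:ℝ) * (Nat.gcd a b : ℝ) ≤
      (C * (M:ℝ) ^ (ε/2) * M) * (b:ℝ)⁻¹ := by
    intro b hb
    rw [mem_Icc] at hb
    have hb' : (1:ℝ) ≤ b := by exact_mod_cast hb.1
    rw [← Finset.mul_sum]
    have h3 := sum_gcd_le b hb.1 (M / b^2)
    have h4 : ((M / b^2 : ℕ) : ℝ) ≤ M / (b:ℝ)^2 := by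
      have := @Nat.cast_div_le ℝ _ _ _ M (b^2)
      push_cast at this; exact this
    have h5 : (b.divisors.card : ℝ) ≤ C * (M:ℝ) ^ (ε/2) :=
      (hC b hb.1).trans (by gcongr; exact_mod_cast hb.2)
    calc (b:ℝ) * ∑ a ∈ Icc 1 (M / b^2), (Nat.gcd a b : ℝ)
        ≤ b * (b.divisors.card * (M / b^2 : ℕ)) := by gcongr
      _ ≤ b * ((C * (M:ℝ) ^ (ε/2)) * (M / (b:ℝ)^2)) := by gcongr
      _ = _ := by field_simp
  refine (Finset.sum_le_sum h2).trans ?_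
  rw [← Finset.mul_sum]
  have h6 : ∑ b ∈ Icc 1 M, (b:ℝ)⁻¹ ≤ 1 + Real.log M := by
    have := harmonic_le_one_add_log M
    rw [harmonic_eq_sum_Icc] at this
    push_cast at this
    exact this
  have h7 := log_bound (ε/2) (by positivity) M hM'
  calc C * (M:ℝ) ^ (ε/2) * M * ∑ b ∈ Icc 1 M, (b:ℝ)⁻¹
      ≤ C * (M:ℝ) ^ (ε/2) * M * ((1 + 1/(ε/2)) * (M:ℝ) ^ (ε/2)) := by gcongr; linarith
    _ = C * (1 + 1/(ε/2)) * (((M:ℝ) ^ (ε/2) * (M:ℝ) ^ (ε/2)) * M) := by ring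
    _ = _ := by
      rw [← Real.rpow_add (by linarith)]
      rw [show 1 + ε = (ε/2+ε/2) + 1 by ring, Real.rpow_add_one (by linarith)]

/-- error weight for modulus `m` -/
def Ew (m : ℕ) : ℝ := (m.divisors.card : ℝ)^2 * (1 + Real.log m)^2 * Real.sqrt m * Gw m

lemma sum_Ew_le (ε : ℝ) (hε : 0 < ε) : ∃ C : ℝ, 0 ≤ C ∧ ∀ M : ℕ, 1 ≤ M →
    ∑ m ∈ Icc 1 M, Ew m ≤ C * (M:ℝ) ^ (3/2 + ε) := by
  obtain ⟨C, hC1, hC⟩ := divisor_bound (ε/8) (by positivity)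
  obtain ⟨C2, hC20, hC2⟩ := sum_Gw_le (ε/2) (by positivity)
  refine ⟨C^2 * (1 + 1/(ε/8))^2 * C2, by positivity, ?_⟩
  intro M hM
  have hM' : (1:ℝ) ≤ M := by exact_mod_cast hM
  have h1 : ∀ m ∈ Icc 1 M, Ew m ≤
     (C^2 * (1 + 1/(ε/8))^2 * (M:ℝ)^(ε/2) * Real.sqrt M) * Gw m := by
    intro m hm
    rw [mem_Icc] at hm
    have hm' : (1:ℝ) ≤ m := by exact_mod_cast hm.1
    have hmM : (m:ℝ) ≤ M := by exact_mod_cast hm.2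
    have hl0 := Real.log_nonneg hm'
    unfold Ew
    have a1 : (m.divisors.card : ℝ) ≤ C * (M:ℝ)^(ε/8) := (hC m hm.1).trans (by gcongr)
    have a2 : 1 + Real.log m ≤ (1 + 1/(ε/8)) * (M:ℝ)^(ε/8) :=
      (log_bound (ε/8) (by positivity) m hm').trans (by gcongr)
    have e : (M:ℝ)^(ε/2) = ((M:ℝ)^(ε/8))^4 := by
      rw [← Real.rpow_natCast, ← Real.rpow_mul (by positivity)]; congr 1; push_cast; ring
    calc (m.divisors.card : ℝ)^2 * (1 + Real.log m)^2 * Real.sqrt m * Gw m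
        ≤ (C * (M:ℝ)^(ε/8))^2 * ((1 + 1/(ε/8)) * (M:ℝ)^(ε/8))^2 * Real.sqrt M * Gw m := by gcongr
      _ = _ := by rw [e]; ring
  refine (Finset.sum_le_sum h1).trans ?_
  rw [← Finset.mul_sum]
  calc _ ≤ (C^2 * (1 + 1/(ε/8))^2 * (M:ℝ)^(ε/2) * Real.sqrt M) * (C2 * (M:ℝ) ^ (1 + ε/2)) := by
        gcongr; exact hC2 M hM
    _ = C^2 * (1 + 1/(ε/8))^2 * C2 * ((M:ℝ)^(ε/2) * (M:ℝ)^((1:ℝ)/2) * (M:ℝ) ^ (1 + ε/2)) := by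
        rw [Real.sqrt_eq_rpow]; ring
    _ = _ := by
        rw [← Real.rpow_add (by linarith), ← Real.rpow_add (by linarith)]
        congr 2; ring

end

section
open Finset

lemma inv_gap (m : ℕ) [NeZero m] (h : ZMod m) (hh : h ≠ 0) :
    1 ≤ ‖1 - ZMod.stdAddChar h‖ * ((m/4 : ℝ) * (1/(h.val:ℝ) + 1/((m:ℝ) - h.val))) := by
  have hv0 : 0 < h.val := Nat.pos_of_ne_zero (by rwa [Ne, ZMod.val_eq_zero])
  have hvm : h.val < m := ZMod.val_lt h
  have hv0' : (0:ℝ) < h.val := by exact_mod_cast hv0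
  have hvm' : (h.val:ℝ) < m := by exact_mod_cast hvm
  have hm0 : (0:ℝ) < m := by linarith
  set v : ℝ := (h.val : ℝ) with hv
  have e1 : ZMod.stdAddChar h = Complex.exp (Complex.I * ((2 * Real.pi * v / m : ℝ) : ℂ)) := by
    have := ZMod.stdAddChar_coe (N := m) (h.val : ℤ)
    rw [show ((h.val : ℤ) : ZMod m) = h by simp] at this
    rw [this]; congr 1; push_cast; rw [hv]; push_cast; ring
  rw [e1, norm_sub_rev, Complex.norm_exp_I_mul_ofReal_sub_one]
  set t : ℝ := v / m with ht
  have ht0 : 0 < t := by positivity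
  have ht1 : t < 1 := by rw [ht, div_lt_one hm0]; exact hvm'
  have e2 : 2 * Real.pi * v / m / 2 = Real.pi * t := by rw [ht]; field_simp
  rw [e2]
  have hs : 2 * (t * (1 - t)) ≤ Real.sin (Real.pi * t) := by
    rcases le_total t (1/2) with h2 | h2
    · have := Real.mul_le_sin (x := Real.pi * t) (by positivity) (by nlinarith [Real.pi_pos])
      have e : 2 / Real.pi * (Real.pi * t) = 2 * t := by field_simp
      rw [e] at this; nlinarith
    · have := Real.mul_le_sin (x := Real.pi * (1 - t)) (by nlinarith [Real.pi_pos]) (by nlinarith [Real.pi_pos])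
      have e : 2 / Real.pi * (Real.pi * (1 - t)) = 2 * (1 - t) := by field_simp
      rw [e, show Real.pi * (1 - t) = Real.pi - Real.pi * t by ring, Real.sin_pi_sub] at this; nlinarith
  have htt : 0 < t * (1 - t) := by nlinarith
  rw [Real.norm_of_nonneg (by nlinarith)]
  have e3 : (m/4 : ℝ) * (1/v + 1/((m:ℝ) - v)) = 1 / (4 * (t * (1 - t))) := by
    have hmv : (m:ℝ) - v ≠ 0 := by linarith
    have hv' : v ≠ 0 := by linarith
    have hx : 1 - v/m ≠ 0 := by rw [← ht]; linarith
    rw [ht]; field_simp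
    ring
  rw [e3, mul_one_div, le_div_iff₀ (by positivity)]
  linarith

lemma sum_gcd_div (m : ℕ) (hm : 1 ≤ m) :
    ∑ k ∈ Ico 1 m, (Nat.gcd k m : ℝ) / k ≤ m.divisors.card * (1 + Real.log m) := by
  have hml : 0 ≤ Real.log m := Real.log_nonneg (by exact_mod_cast hm)
  calc ∑ k ∈ Ico 1 m, (Nat.gcd k m : ℝ) / k
      ≤ ∑ k ∈ Ico 1 m, ∑ g ∈ m.divisors, (if g ∣ k then (g:ℝ)/k else 0) := by
        refine Finset.sum_le_sum fun k hk => ?_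
        have := gcd_le_sum_dvd k m hm
        calc _ ≤ (∑ g ∈ m.divisors, if g ∣ k then (g:ℝ) else 0) / k := by gcongr
          _ = _ := by
            rw [Finset.sum_div]
            refine Finset.sum_congr rfl fun g _ => ?_
            split_ifs <;> simp
    _ = ∑ g ∈ m.divisors, ∑ k ∈ Ico 1 m, (if g ∣ k then (g:ℝ)/k else 0) := Finset.sum_comm
    _ ≤ ∑ g ∈ m.divisors, (1 + Real.log m) := by
        refine Finset.sum_le_sum fun g hg => ?_
        have hg0 : 0 < g := Nat.pos_of_mem_divisors hg
        rw [← Finset.sum_filter]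
        have hsub : (Ico 1 m).filter (fun k => g ∣ k) ⊆ (Icc 1 m).image (fun j => g * j) := by
          intro k hk
          rw [mem_filter, mem_Ico] at hk
          obtain ⟨j, rfl⟩ := hk.2
          rw [mem_image]
          refine ⟨j, ?_, rfl⟩
          rw [mem_Icc]
          constructor
          · rcases Nat.eq_zero_or_pos j with h | h
            · subst h; omega
            · exact h
          · nlinarith
        calc _ ≤ ∑ k ∈ (Icc 1 m).image (fun j => g * j), (g:ℝ)/k :=
              Finset.sum_le_sum_of_subset_of_nonneg hsub (fun _ _ _ => by positivity)
          _ = ∑ j ∈ Icc 1 m, (j:ℝ)⁻¹ := by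
              rw [Finset.sum_image (fun a _ b _ h => Nat.eq_of_mul_eq_mul_left hg0 h)]
              refine Finset.sum_congr rfl fun j _ => ?_
              push_cast
              have : (g:ℝ) ≠ 0 := by positivity
              rw [div_mul_eq_div_div, div_self this, one_div]
          _ ≤ _ := by
              have := harmonic_le_one_add_log m
              rw [harmonic_eq_sum_Icc] at this
              push_cast at this
              exact this
    _ = _ := by rw [Finset.sum_const, nsmul_eq_mul]

lemma zsum_eq (m : ℕ) [NeZero m] (w : ℕ → ℝ) (hw : ∀ k ∈ Ico 1 m, w (m - k) = w k) :
    ∑ k : ZMod m, (if k = 0 then 0 else w k.val * (1/(k.val:ℝ) + 1/((m:ℝ) - k.val)))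
      = 2 * ∑ k ∈ Ico 1 m, w k / k := by
  have hm : 1 ≤ m := NeZero.one_le
  have e1 : ∑ k : ZMod m, (if k = 0 then 0 else w k.val * (1/(k.val:ℝ) + 1/((m:ℝ) - k.val)))
      = ∑ k ∈ Ico 1 m, w k * (1/(k:ℝ) + 1/((m:ℝ) - k)) := by
    simp_rw [← ite_not (p := (_ : ZMod m) = 0)]
    rw [← Finset.sum_filter]
    refine Finset.sum_bij (fun k _ => k.val) ?_ ?_ ?_ ?_
    · intro k hk
      rw [mem_filter] at hk
      rw [mem_Ico]
      refine ⟨Nat.pos_of_ne_zero (by rw [Ne, ZMod.val_eq_zero]; exact hk.2), ZMod.val_lt k⟩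
    · intro a _ b _ h; exact ZMod.val_injective m h
    · intro b hb
      rw [mem_Ico] at hb
      refine ⟨(b : ZMod m), ?_, ZMod.val_natCast_of_lt hb.2⟩
      rw [mem_filter]
      refine ⟨mem_univ _, ?_⟩
      intro h
      rw [ZMod.natCast_eq_zero_iff] at h
      have := Nat.le_of_dvd (by omega) h
      omega
    · intro a _; rfl
  rw [e1]
  have e2 : ∑ k ∈ Ico 1 m, w k * (1/((m:ℝ) - k)) = ∑ k ∈ Ico 1 m, w k / k := by
    refine Finset.sum_nbij' (fun k => m - k) (fun k => m - k) ?_ ?_ ?_ ?_ ?_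
    · intro k hk; rw [mem_Ico] at *; omega
    · intro k hk; rw [mem_Ico] at *; omega
    · intro k hk; rw [mem_Ico] at *; omega
    · intro k hk; rw [mem_Ico] at *; omega
    · intro k hk
      have h1 := hw k hk
      rw [mem_Ico] at hk
      rw [h1, Nat.cast_sub hk.2.le, mul_one_div]
  simp_rw [mul_add]
  rw [Finset.sum_add_distrib, e2]
  simp_rw [mul_one_div]
  ring

lemma sum_gcd_div2 (m : ℕ) [NeZero m] :
    ∑ k : ZMod m, (if k = 0 then 0 else (Nat.gcd k.val m : ℝ) * (1/(k.val:ℝ) + 1/((m:ℝ) - k.val)))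
      ≤ 2 * (m.divisors.card * (1 + Real.log m)) := by
  rw [zsum_eq m (fun k => (Nat.gcd k m : ℝ))]
  · have := sum_gcd_div m NeZero.one_le
    linarith
  · intro k hk
    rw [mem_Ico] at hk
    rw [Nat.gcd_self_sub_left hk.2.le]

lemma kl_bound (m : ℕ) [NeZero m] (k : ZMod m) (c : (ZMod m)ˣ) (φ : AddChar (ZMod m) ℂ) :
    ‖Kl m φ (ZMod.stdAddChar.mulShift (-(k * c)))‖ ≤
      (m.divisors.card : ℝ) * Real.sqrt m * Gw m * (Nat.gcd k.val m : ℝ) := by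
  have hm : 0 < m := NeZero.pos m
  have hgd := Nat.gcd_dvd_right k.val m
  have hgp : 0 < Nat.gcd k.val m := Nat.gcd_pos_of_pos_right _ hm
  have := Kl_general m (sqa m) (sqb m) (sq_decomp m).1 (sq_decomp m).2 φ
    (ZMod.stdAddChar.mulShift (-(k * c))) (m / Nat.gcd k.val m) (Nat.div_dvd_of_dvd hgd) (by
      intro j hj
      have h1 : ZMod.stdAddChar (-(k * (c : ZMod m)) * (j : ZMod m)) = 1 := by
        have h2 := DFunLike.congr_fun hj (1 : ZMod m)
        rw [AddChar.pow_apply, AddChar.mulShift_apply, ← AddChar.map_nsmul_eq_pow] at h2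
        rw [nsmul_eq_mul, mul_one, mul_comm] at h2
        simpa using h2
      rw [← AddChar.map_zero_eq_one (ZMod.stdAddChar (N := m))] at h1
      have h3 := ZMod.injective_stdAddChar h1
      have h4 : k * (j : ZMod m) = 0 := by
        have : (c : ZMod m) * (k * j) = 0 := by linear_combination -h3
        simpa using this
      have h5 : m ∣ k.val * j := by
        rw [← ZMod.natCast_eq_zero_iff]; push_cast; rw [ZMod.natCast_zmod_val]; exact h4
      have h6 : (m / Nat.gcd k.val m) ∣ (k.val / Nat.gcd k.val m) * j := by
        obtain ⟨a, ha⟩ := Nat.gcd_dvd_left k.val m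
        obtain ⟨b, hb⟩ := hgd
        set g := Nat.gcd k.val m with hg
        have e1 : m / g = b := by rw [hb]; exact Nat.mul_div_cancel_left _ hgp
        have e2 : k.val / g = a := by rw [ha]; exact Nat.mul_div_cancel_left _ hgp
        rw [e1, e2]
        have : g * b ∣ g * (a * j) := by rw [← hb, ← mul_assoc, ← ha]; exact h5
        exact Nat.dvd_of_mul_dvd_mul_left hgp this
      exact (Nat.Coprime.dvd_of_dvd_mul_left (Nat.coprime_div_gcd_div_gcd hgp).symm h6))
  rw [Nat.div_div_self hgd hm.ne'] at this
  exact this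

end

section
open Finset

lemma std_norm (m : ℕ) [NeZero m] (h : ZMod m) : ‖ZMod.stdAddChar h‖ = 1 := by
  rw [ZMod.stdAddChar_apply]; exact Circle.norm_coe _

lemma geo_bound (m : ℕ) [NeZero m] (h : ZMod m) (hh : h ≠ 0) (L U : ℤ) :
    ‖∑ y ∈ Icc L U, ZMod.stdAddChar (-(h * (y : ZMod m)))‖ ≤
      2 * ((m/4 : ℝ) * (1/(h.val:ℝ) + 1/((m:ℝ) - h.val))) := by
  set S := ∑ y ∈ Icc L U, ZMod.stdAddChar (-(h * (y : ZMod m))) with hS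
  set D := ((m/4 : ℝ) * (1/(h.val:ℝ) + 1/((m:ℝ) - h.val))) with hD
  have hg := inv_gap m h hh
  rw [← hD] at hg
  have hD0 : 0 ≤ D := by
    have : (h.val:ℝ) < m := by exact_mod_cast ZMod.val_lt h
    have : (0:ℝ) ≤ 1/((m:ℝ) - h.val) := by apply div_nonneg <;> linarith
    positivity
  have h2 : ‖(1 - ZMod.stdAddChar h) * S‖ ≤ 2 := by
    rcases lt_or_ge U L with hUL | hUL
    · rw [hS, Finset.Icc_eq_empty (by omega)]; simp
    have key : ∀ n : ℕ, (1 - ZMod.stdAddChar h) * ∑ y ∈ Icc L (L + n), ZMod.stdAddChar (-(h * (y : ZMod m))) =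
        ZMod.stdAddChar (-(h * ((L + n : ℤ) : ZMod m))) - ZMod.stdAddChar (-(h * ((L - 1 : ℤ) : ZMod m))) := by
      intro n
      induction n with
      | zero =>
        simp only [Nat.cast_zero, add_zero, Icc_self, sum_singleton, sub_mul, one_mul]
        rw [← AddChar.map_add_eq_mul]
        congr 2; push_cast; ring
      | succ n ih =>
        have : Icc L (L + (n + 1 : ℕ)) = insert (L + (n+1 : ℕ)) (Icc L (L + n)) := by
          ext z; simp only [mem_Icc, mem_insert]; push_cast; omega
        rw [this, Finset.sum_insert (by simp), mul_add, ih, sub_mul, one_mul, ← AddChar.map_add_eq_mul]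
        have e : h + -(h * ((L + (n+1 : ℕ) : ℤ) : ZMod m)) = -(h * ((L + n : ℤ) : ZMod m)) := by
          push_cast; ring
        rw [e]; ring
    have := key (U - L).toNat
    rw [show L + ((U - L).toNat : ℤ) = U by omega, ← hS] at this
    rw [this]
    refine (norm_sub_le _ _).trans ?_
    rw [std_norm, std_norm]; norm_num
  rw [norm_mul] at h2
  calc ‖S‖ ≤ (‖1 - ZMod.stdAddChar h‖ * D) * ‖S‖ := le_mul_of_one_le_left (norm_nonneg _) hg
    _ = (‖1 - ZMod.stdAddChar h‖ * ‖S‖) * D := by ring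
    _ ≤ 2 * D := by gcongr

/-- centered sawtooth -/
def saw (m : ℕ) (z : ZMod m) : ℝ := (z.val : ℝ) - ((m:ℝ) - 1)/2

lemma val_sum (m : ℕ) [NeZero m] (f : ℕ → ℂ) : ∑ z : ZMod m, f z.val = ∑ k ∈ range m, f k := by
  refine Finset.sum_bij (fun k _ => k.val) ?_ ?_ ?_ ?_
  · intro k _; exact mem_range.2 (ZMod.val_lt k)
  · intro a _ b _ h; exact ZMod.val_injective m h
  · intro b hb; exact ⟨(b : ZMod m), mem_univ _, ZMod.val_natCast_of_lt (mem_range.1 hb)⟩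
  · intro a _; rfl

lemma saw_sum (m : ℕ) [NeZero m] : ∑ z : ZMod m, (saw m z : ℂ) = 0 := by
  have h := val_sum m (fun k => ((k:ℂ) - ((m:ℂ) - 1)/2))
  have e : ∑ z : ZMod m, (saw m z : ℂ) = ∑ z : ZMod m, (((z.val : ℕ) : ℂ) - ((m:ℂ) - 1)/2) := by
    refine Finset.sum_congr rfl fun z _ => ?_
    unfold saw; push_cast; rfl
  rw [e, h, Finset.sum_sub_distrib, Finset.sum_const, card_range, nsmul_eq_mul]
  have := Finset.sum_range_id_mul_two m
  have h2 : (∑ i ∈ range m, (i:ℂ)) * 2 = m * (m - 1) := by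
    have h3 : 1 ≤ m := NeZero.one_le
    have := congrArg (fun n : ℕ => (n : ℂ)) this
    push_cast [Nat.cast_sub h3] at this
    exact this
  linear_combination h2 / 2

lemma saw_dft_bound (m : ℕ) [NeZero m] (k : ZMod m) (hk : k ≠ 0) :
    ‖∑ z : ZMod m, (saw m z : ℂ) * ZMod.stdAddChar (-(k * z))‖ ≤
      2 * m * ((m/4 : ℝ) * (1/(k.val:ℝ) + 1/((m:ℝ) - k.val))) := by
  set S := ∑ z : ZMod m, (saw m z : ℂ) * ZMod.stdAddChar (-(k * z)) with hS
  set D := ((m/4 : ℝ) * (1/(k.val:ℝ) + 1/((m:ℝ) - k.val))) with hD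
  have hm1 : (1:ℝ) ≤ m := by exact_mod_cast (NeZero.one_le : 1 ≤ m)
  have hg := inv_gap m k hk
  rw [← hD] at hg
  have hD0 : 0 ≤ D := by
    have : (k.val:ℝ) < m := by exact_mod_cast ZMod.val_lt k
    have : (0:ℝ) ≤ 1/((m:ℝ) - k.val) := by apply div_nonneg <;> linarith
    positivity
  have h1 : (1 - ZMod.stdAddChar k) * S = ∑ z : ZMod m, ((saw m z - saw m (z + 1) : ℝ) : ℂ) * ZMod.stdAddChar (-(k * z)) := by
    have : ZMod.stdAddChar k * S = ∑ z : ZMod m, (saw m (z+1) : ℂ) * ZMod.stdAddChar (-(k * z)) := by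
      rw [hS, Finset.mul_sum, ← Equiv.sum_comp (Equiv.addRight (1 : ZMod m))]
      refine Finset.sum_congr rfl fun z _ => ?_
      simp only [Equiv.coe_addRight]
      rw [mul_left_comm, ← AddChar.map_add_eq_mul]
      congr 2; ring
    rw [sub_mul, one_mul, this, hS, ← Finset.sum_sub_distrib]
    refine Finset.sum_congr rfl fun z _ => ?_
    push_cast; ring
  have h2 : ‖(1 - ZMod.stdAddChar k) * S‖ ≤ 2 * m := by
    rw [h1]
    refine (norm_sum_le _ _).trans ?_
    calc ∑ z : ZMod m, ‖((saw m z - saw m (z + 1) : ℝ) : ℂ) * ZMod.stdAddChar (-(k * z))‖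
        = ∑ z : ZMod m, |saw m z - saw m (z+1)| := by
          refine Finset.sum_congr rfl fun z _ => ?_
          rw [norm_mul, std_norm, mul_one, Complex.norm_real, Real.norm_eq_abs]
      _ ≤ ∑ z : ZMod m, (1 + if z = -1 then (m:ℝ) else 0) := by
          refine Finset.sum_le_sum fun z _ => ?_
          unfold saw
          split_ifs with hz
          · subst hz
            have : ((-1 + 1 : ZMod m)).val = 0 := by simp
            rw [this]
            have : ((-1 : ZMod m).val : ℝ) < m := by exact_mod_cast ZMod.val_lt _
            rw [abs_le]; constructor <;> push_cast <;> linarith [Nat.cast_nonneg (α := ℝ) ((-1 : ZMod m).val)]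
          · have : (z + 1).val = z.val + 1 := by
              rcases Nat.lt_or_ge 1 m with hm | hm
              · haveI : Fact (1 < m) := ⟨hm⟩
                rw [ZMod.val_add_of_lt]
                · rw [ZMod.val_one]
                · rw [ZMod.val_one]
                  have h3 := ZMod.val_lt z
                  by_contra h4
                  have h5 : z.val + 1 = m := by omega
                  apply hz
                  have h6 : ((z.val + 1 : ℕ) : ZMod m) = 0 := by rw [h5]; simp
                  push_cast at h6
                  rw [ZMod.natCast_zmod_val] at h6
                  exact eq_neg_of_add_eq_zero_left h6
              · exfalso; apply hz
                have h1 : m = 1 := by have := NeZero.one_le (n := m); omega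
                subst h1; exact Subsingleton.elim _ _
            rw [this]; push_cast
            rw [abs_le]; constructor <;> linarith
      _ = 2 * m := by
          rw [Finset.sum_add_distrib, Finset.sum_ite_eq' ]; simp; ring
  rw [norm_mul] at h2
  calc ‖S‖ ≤ (‖1 - ZMod.stdAddChar k‖ * D) * ‖S‖ := le_mul_of_one_le_left (norm_nonneg _) hg
    _ = (‖1 - ZMod.stdAddChar k‖ * ‖S‖) * D := by ring
    _ ≤ 2 * m * D := by gcongr

lemma dft_inv (m : ℕ) [NeZero m] (f : ZMod m → ℂ) (x : ZMod m) :
    f x = (m:ℂ)⁻¹ * ∑ k : ZMod m, (∑ z : ZMod m, f z * ZMod.stdAddChar (-(k * z))) * ZMod.stdAddChar (k * x) := by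
  have := ZMod.dft.symm_apply_apply f
  have h := congrFun this x
  rw [ZMod.invDFT_apply] at h
  rw [← h, smul_eq_mul]
  congr 1
  refine Finset.sum_congr rfl fun k _ => ?_
  rw [ZMod.dft_apply, smul_eq_mul, mul_comm]
  congr 1
  refine Finset.sum_congr rfl fun z _ => ?_
  rw [smul_eq_mul, mul_comm, mul_comm k z]

lemma exp_sum_bound (m : ℕ) [NeZero m] (c : (ZMod m)ˣ) (T t : ZMod m) (L U : ℤ)
    (hlen : (Icc L U).card ≤ 2 * m) :
    |∑ y ∈ (Icc L U).filter (fun y : ℤ => IsUnit (y : ZMod m)),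
      saw m (T - t * (y : ZMod m) - c * (y : ZMod m)⁻¹)| ≤ 3 * m * Ew m := by
  have hm1 : (1:ℝ) ≤ m := by exact_mod_cast (NeZero.one_le : 1 ≤ m)
  have hmC : (m:ℂ) ≠ 0 := by exact_mod_cast NeZero.ne m
  have hlog : 0 ≤ Real.log m := Real.log_nonneg hm1
  set F : ZMod m → ℂ := fun h => ∑ y ∈ Icc L U, ZMod.stdAddChar (-(h * (y : ZMod m))) with hF
  set G : ZMod m → ℂ := fun k => ∑ z : ZMod m, (saw m z : ℂ) * ZMod.stdAddChar (-(k * z)) with hG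
  set W : ℝ := (m.divisors.card : ℝ) * Real.sqrt m * Gw m with hW
  have hW0 : 0 ≤ W := mul_nonneg (mul_nonneg (Nat.cast_nonneg _) (Real.sqrt_nonneg _)) (Nat.cast_nonneg _)
  -- rewrite over units
  have e1 : ((∑ y ∈ (Icc L U).filter (fun y : ℤ => IsUnit (y : ZMod m)),
      saw m (T - t * (y : ZMod m) - c * (y : ZMod m)⁻¹) : ℝ) : ℂ) =
      ∑ u : (ZMod m)ˣ, ((m:ℂ)⁻¹ * ∑ h : ZMod m, F h * ZMod.stdAddChar (h * (u : ZMod m))) *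
        (saw m (T - t * (u : ZMod m) - c * ((u⁻¹ : (ZMod m)ˣ) : ZMod m)) : ℂ) := by
    have e2 : ∀ u : (ZMod m)ˣ, ((m:ℂ)⁻¹ * ∑ h : ZMod m, F h * ZMod.stdAddChar (h * (u : ZMod m))) =
        ∑ y ∈ Icc L U, if (y : ZMod m) = u then 1 else 0 := by
      intro u
      have : ∀ h : ZMod m, F h * ZMod.stdAddChar (h * (u : ZMod m)) =
          ∑ y ∈ Icc L U, ZMod.stdAddChar (h * ((u : ZMod m) - (y : ZMod m))) := by
        intro h
        rw [hF]; simp only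
        rw [Finset.sum_mul]
        refine Finset.sum_congr rfl fun y _ => ?_
        rw [← AddChar.map_add_eq_mul]; congr 1; ring
      simp_rw [this]
      rw [Finset.sum_comm, Finset.mul_sum]
      refine Finset.sum_congr rfl fun y _ => ?_
      rw [AddChar.sum_mulShift _ (ZMod.isPrimitive_stdAddChar m), ZMod.card]
      by_cases hy : (y : ZMod m) = u
      · rw [if_pos hy, if_pos (by rw [hy, sub_self])]; push_cast; field_simp
      · rw [if_neg hy, if_neg (by rw [sub_eq_zero]; exact fun h => hy h.symm)]; simp
    simp_rw [e2, Finset.sum_mul]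
    rw [Finset.sum_comm, Finset.sum_filter]
    push_cast
    refine Finset.sum_congr rfl fun y _ => ?_
    by_cases hy : IsUnit (y : ZMod m)
    · rw [if_pos hy]
      obtain ⟨u, hu⟩ := hy
      rw [Finset.sum_eq_single u]
      · rw [if_pos hu.symm, one_mul, ← hu]
        have : ((u : ZMod m))⁻¹ = ((u⁻¹ : (ZMod m)ˣ) : ZMod m) := by
          rw [ZMod.inv_coe_unit]
        rw [this]
      · intro v _ hv
        rw [if_neg, zero_mul]
        intro h; apply hv; rw [← hu] at h; exact (Units.ext h).symm
      · intro h; exact absurd (mem_univ _) h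
    · rw [if_neg hy]
      symm
      apply Finset.sum_eq_zero
      intro u _
      rw [if_neg, zero_mul]
      intro h; apply hy; rw [h]; exact u.isUnit
  -- expand saw
  have e3 : (∑ u : (ZMod m)ˣ, ((m:ℂ)⁻¹ * ∑ h : ZMod m, F h * ZMod.stdAddChar (h * (u : ZMod m))) *
        (saw m (T - t * (u : ZMod m) - c * ((u⁻¹ : (ZMod m)ˣ) : ZMod m)) : ℂ)) =
      (m:ℂ)⁻¹ * (m:ℂ)⁻¹ * ∑ h : ZMod m, ∑ k : ZMod m, F h * G k * ZMod.stdAddChar (k * T) *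
        Kl m (ZMod.stdAddChar.mulShift (h - k * t)) (ZMod.stdAddChar.mulShift (-(k * c))) := by
    unfold Kl
    simp_rw [Finset.mul_sum]
    rw [Finset.sum_congr rfl fun h _ => Finset.sum_comm, Finset.sum_comm]
    refine Finset.sum_congr (by congr!) fun u _ => ?_
    rw [dft_inv m (fun z => (saw m z : ℂ)) (T - t * (u : ZMod m) - c * ((u⁻¹ : (ZMod m)ˣ) : ZMod m))]
    rw [Finset.sum_mul]
    refine Finset.sum_congr rfl fun h _ => ?_
    rw [Finset.mul_sum, Finset.mul_sum]
    refine Finset.sum_congr rfl fun k _ => ?_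
    rw [AddChar.mulShift_apply, AddChar.mulShift_apply]
    have e4 : ZMod.stdAddChar (h * (u : ZMod m)) * ZMod.stdAddChar (k * (T - t * (u : ZMod m) - (c : ZMod m) * ((u⁻¹ : (ZMod m)ˣ) : ZMod m)))
       = ZMod.stdAddChar (k * T) * (ZMod.stdAddChar ((h - k * t) * (u : ZMod m)) *
          ZMod.stdAddChar (-(k * (c : ZMod m)) * ((u⁻¹ : (ZMod m)ˣ) : ZMod m))) := by
      simp only [← AddChar.map_add_eq_mul]
      congr 1; ring
    rw [hG]
    simp only
    linear_combination (m:ℂ)⁻¹ * (m:ℂ)⁻¹ * F h * (∑ z : ZMod m, (saw m z : ℂ) * ZMod.stdAddChar (-(k * z))) * e4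
  have hFs : ∑ h : ZMod m, ‖F h‖ ≤ 3 * m * (1 + Real.log m) := by
    calc ∑ h : ZMod m, ‖F h‖ ≤ ∑ h : ZMod m, ((if h = 0 then (2 * m : ℝ) else 0) +
          (m/2 : ℝ) * (if h = 0 then 0 else (1:ℝ) * (1/(h.val:ℝ) + 1/((m:ℝ) - h.val)))) := by
          refine Finset.sum_le_sum fun h _ => ?_
          by_cases hh : h = 0
          · rw [if_pos hh, if_pos hh, mul_zero, add_zero, hF]
            refine (norm_sum_le _ _).trans ?_
            simp_rw [std_norm]
            rw [Finset.sum_const, nsmul_eq_mul, mul_one]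
            exact_mod_cast hlen
          · rw [if_neg hh, if_neg hh]
            have := geo_bound m h hh L U
            refine this.trans (le_of_eq ?_); ring
      _ = 2 * m + (m/2) * (2 * ∑ k ∈ Ico 1 m, (1:ℝ) / k) := by
          rw [Finset.sum_add_distrib, ← Finset.mul_sum, zsum_eq m (fun _ => 1) (fun _ _ => rfl)]
          simp
      _ ≤ _ := by
          have h1 : ∑ k ∈ Ico 1 m, (1:ℝ) / k ≤ 1 + Real.log m := by
            have := harmonic_le_one_add_log m
            rw [harmonic_eq_sum_Icc] at this
            push_cast at this
            refine le_trans ?_ this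
            simp_rw [one_div]
            refine Finset.sum_le_sum_of_subset_of_nonneg ?_ (fun _ _ _ => by positivity)
            intro k hk; rw [mem_Ico] at hk; rw [mem_Icc]; omega
          nlinarith [mul_nonneg (by linarith : (0:ℝ) ≤ m) hlog]
  have hGs : ∑ k : ZMod m, ‖G k‖ * (Nat.gcd k.val m : ℝ) ≤ m^2 * (m.divisors.card * (1 + Real.log m)) := by
    calc _ ≤ ∑ k : ZMod m, (m^2/2 : ℝ) * (if k = 0 then 0 else (Nat.gcd k.val m : ℝ) * (1/(k.val:ℝ) + 1/((m:ℝ) - k.val))) := by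
          refine Finset.sum_le_sum fun k _ => ?_
          by_cases hk : k = 0
          · rw [if_pos hk, hk]
            have : G 0 = 0 := by
              have := saw_sum m
              rw [hG]; simpa using this
            rw [this]; simp
          · rw [if_neg hk]
            have := saw_dft_bound m k hk
            calc _ ≤ (2 * m * ((m/4 : ℝ) * (1/(k.val:ℝ) + 1/((m:ℝ) - k.val)))) * (Nat.gcd k.val m : ℝ) :=
                  mul_le_mul_of_nonneg_right this (Nat.cast_nonneg _)
              _ = _ := by ring
      _ ≤ _ := by
          rw [← Finset.mul_sum]
          have := sum_gcd_div2 m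
          calc _ ≤ (m^2/2 : ℝ) * (2 * (m.divisors.card * (1 + Real.log m))) :=
                mul_le_mul_of_nonneg_left this (by positivity)
            _ = _ := by ring
  have h1 : ‖((∑ y ∈ (Icc L U).filter (fun y : ℤ => IsUnit (y : ZMod m)),
      saw m (T - t * (y : ZMod m) - c * (y : ZMod m)⁻¹) : ℝ) : ℂ)‖ ≤
      (m:ℝ)⁻¹ * (m:ℝ)⁻¹ * ((∑ h : ZMod m, ‖F h‖) * (∑ k : ZMod m, ‖G k‖ * (Nat.gcd k.val m : ℝ)) * W) := by
    rw [e1, e3, norm_mul, norm_mul, norm_inv, Complex.norm_natCast]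
    refine mul_le_mul_of_nonneg_left ?_ (by positivity)
    refine (norm_sum_le _ _).trans ?_
    rw [Finset.sum_mul, Finset.sum_mul]
    refine Finset.sum_le_sum fun h _ => ?_
    refine (norm_sum_le _ _).trans ?_
    rw [Finset.mul_sum, Finset.sum_mul]
    refine Finset.sum_le_sum fun k _ => ?_
    rw [norm_mul, norm_mul, norm_mul, std_norm, mul_one]
    have := kl_bound m k c (ZMod.stdAddChar.mulShift (h - k * t))
    calc _ ≤ ‖F h‖ * ‖G k‖ * (W * (Nat.gcd k.val m : ℝ)) := by gcongr
      _ = _ := by ring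
  rw [Complex.norm_real, Real.norm_eq_abs] at h1
  refine h1.trans ?_
  calc _ ≤ (m:ℝ)⁻¹ * (m:ℝ)⁻¹ * ((3 * m * (1 + Real.log m)) * (m^2 * (m.divisors.card * (1 + Real.log m))) * W) := by
        refine mul_le_mul_of_nonneg_left ?_ (by positivity)
        refine mul_le_mul_of_nonneg_right ?_ hW0
        refine mul_le_mul hFs hGs (Finset.sum_nonneg fun k _ => by positivity) (by positivity)
    _ = 3 * m * Ew m := by
        unfold Ew
        rw [hW]; field_simp

end

section
open Finset

lemma floor_div_eq (m : ℕ) [NeZero m] (z : ℤ) :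
    ((⌊(z:ℚ) / ((m:ℤ):ℚ)⌋ : ℤ) : ℝ) = (z:ℝ)/m - ((z : ZMod m).val : ℝ)/m := by
  have h0 : ((⌊(z:ℚ) / ((m:ℤ):ℚ)⌋ : ℤ) : ℚ) = (z:ℚ)/m - ((z : ZMod m).val : ℚ)/m := by
    have h1 := Int.fract_div_intCast_eq_div_intCast_mod (k := ℚ) (m := z) (n := m)
    have h2 := ZMod.val_intCast (n := m) z
    have h3 := Int.self_sub_fract ((z:ℚ) / ((m:ℤ):ℚ))
    rw [← h3]
    push_cast at h1 ⊢
    rw [h1]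
    have h4 : (((z : ZMod m).val : ℕ) : ℚ) = ((z % (m:ℤ) : ℤ) : ℚ) := by rw [← h2]; push_cast; rfl
    rw [h4]
  have := congrArg (fun q : ℚ => (q:ℝ)) h0
  push_cast at this
  exact_mod_cast this

lemma count_ap (m : ℕ) [NeZero m] (a b : ℤ) (hab : a ≤ b) (v : ZMod m) :
    (((Ioc a b).filter (fun x : ℤ => (x : ZMod m) = v)).card : ℝ) =
      ((b:ℝ) - a)/m - (saw m ((b : ZMod m) - v))/m + (saw m ((a : ZMod m) - v))/m := by
  have hm : (0:ℤ) < m := by exact_mod_cast NeZero.pos m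
  have h1 := Int.Ioc_filter_modEq_card a b hm (v.val : ℤ)
  have e : (Ioc a b).filter (fun x : ℤ => (x : ZMod m) = v) =
      (Ioc a b).filter (fun x : ℤ => x ≡ (v.val : ℤ) [ZMOD m]) := by
    refine Finset.filter_congr fun x _ => ?_
    rw [← ZMod.intCast_eq_intCast_iff]
    simp
  rw [e]
  have hmR : (0:ℚ) < ((m:ℤ):ℚ) := by exact_mod_cast hm
  have hmono : ⌊((a:ℚ) - ((v.val:ℤ):ℚ)) / ((m:ℤ):ℚ)⌋ ≤ ⌊((b:ℚ) - ((v.val:ℤ):ℚ)) / ((m:ℤ):ℚ)⌋ := by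
    apply Int.floor_le_floor
    have : (a:ℚ) ≤ b := by exact_mod_cast hab
    gcongr
  rw [max_eq_left (by linarith)] at h1
  have h2 := congrArg (fun z : ℤ => (z:ℝ)) h1
  simp only [Int.cast_natCast, Int.cast_sub] at h2
  rw [h2]
  have f1 := floor_div_eq m (b - (v.val:ℤ))
  have f2 := floor_div_eq m (a - (v.val:ℤ))
  push_cast at f1 f2
  simp only [Int.cast_natCast] at *
  rw [f1, f2]
  unfold saw
  simp only [ZMod.natCast_val, ZMod.cast_id', id]
  field_simp
  ring

lemma count_main (m : ℕ) [NeZero m] (c : (ZMod m)ˣ) (Y A0 L U : ℤ) (hU : U ≤ Y - A0 + 1)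
    (hlen : (Icc L U).card ≤ 2 * m) :
    |((∑ y ∈ (Icc L U).filter (fun y : ℤ => IsUnit (y : ZMod m)),
        ((Icc A0 (Y - y)).filter (fun x : ℤ => (x : ZMod m) * y = c)).card : ℕ) : ℝ) -
      (1/(m:ℝ)) * ∑ y ∈ (Icc L U).filter (fun y : ℤ => IsUnit (y : ZMod m)), ((Y:ℝ) - y - A0 + 1)|
    ≤ 6 * Ew m := by
  have hm1 : (1:ℝ) ≤ m := by exact_mod_cast (NeZero.one_le : 1 ≤ m)
  have b1 := exp_sum_bound m c (Y : ZMod m) 1 L U hlen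
  have b2 := exp_sum_bound m c ((A0 - 1 : ℤ) : ZMod m) 0 L U hlen
  have e : ((∑ y ∈ (Icc L U).filter (fun y : ℤ => IsUnit (y : ZMod m)),
        ((Icc A0 (Y - y)).filter (fun x : ℤ => (x : ZMod m) * y = c)).card : ℕ) : ℝ) -
      (1/(m:ℝ)) * ∑ y ∈ (Icc L U).filter (fun y : ℤ => IsUnit (y : ZMod m)), ((Y:ℝ) - y - A0 + 1)
      = - ((1/(m:ℝ)) * ∑ y ∈ (Icc L U).filter (fun y : ℤ => IsUnit (y : ZMod m)),
           saw m ((Y : ZMod m) - 1 * (y : ZMod m) - c * (y : ZMod m)⁻¹)) +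
        (1/(m:ℝ)) * ∑ y ∈ (Icc L U).filter (fun y : ℤ => IsUnit (y : ZMod m)),
           saw m (((A0 - 1 : ℤ) : ZMod m) - 0 * (y : ZMod m) - c * (y : ZMod m)⁻¹) := by
    push_cast
    simp only [Finset.mul_sum]
    rw [← Finset.sum_neg_distrib, ← Finset.sum_add_distrib, ← Finset.sum_sub_distrib]
    refine Finset.sum_congr rfl fun y hy => ?_
    rw [mem_filter, mem_Icc] at hy
    have h1 := count_ap m (A0 - 1) (Y - y) (by omega) (c * (y : ZMod m)⁻¹)
    have h2 : (Icc A0 (Y - y)).filter (fun x : ℤ => (x : ZMod m) * y = c) =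
        (Ioc (A0 - 1) (Y - y)).filter (fun x : ℤ => (x : ZMod m) = c * (y : ZMod m)⁻¹) := by
      ext x
      simp only [mem_filter, mem_Icc, mem_Ioc]
      obtain ⟨u, hu⟩ := hy.2
      rw [← hu, ZMod.inv_coe_unit, Units.eq_mul_inv_iff_mul_eq]
      constructor
      · rintro ⟨h1, h2⟩; exact ⟨by omega, h2⟩
      · rintro ⟨h1, h2⟩; exact ⟨by omega, h2⟩
    rw [h2, h1]
    push_cast
    rw [one_mul, zero_mul, sub_zero]
    ring
  rw [e]
  refine (abs_add_le _ _).trans ?_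
  rw [abs_neg, abs_mul, abs_mul, abs_of_pos (by positivity : 0 < 1/(m:ℝ))]
  calc _ ≤ 1/(m:ℝ) * (3 * m * Ew m) + 1/(m:ℝ) * (3 * m * Ew m) := by gcongr
    _ = _ := by field_simp; ring

end

section
open Finset

lemma ap_sum_one (f h : ℝ → ℝ) (P Q : ℝ) (hPQ : P ≤ Q) (hf0 : ∀ x, 0 ≤ f x) (hanti : Antitone f)
    (hh : ∀ x y, x ≤ y → (y - x) * f y ≤ h x - h y ∧ h x - h y ≤ (y - x) * f x) :
    |∑ y ∈ Icc ⌈P⌉ ⌊Q⌋, f y - (h P - h Q)| ≤ f P := by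
  have hdec : ∀ x y, x ≤ y → h y ≤ h x := by
    intro x y hxy
    have := (hh x y hxy).1
    have := mul_nonneg (sub_nonneg.2 hxy) (hf0 y)
    linarith
  have hc1 : P ≤ ⌈P⌉ := Int.le_ceil P
  have hc2 : (⌈P⌉ : ℝ) < P + 1 := Int.ceil_lt_add_one P
  have hq1 : (⌊Q⌋ : ℝ) ≤ Q := Int.floor_le Q
  have hq2 : Q < ⌊Q⌋ + 1 := Int.lt_floor_add_one Q
  rcases lt_or_ge ⌊Q⌋ ⌈P⌉ with hlt | hle
  · rw [Finset.Icc_eq_empty (by omega), Finset.sum_empty, zero_sub, abs_neg]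
    have h1 := hdec P Q hPQ
    rw [abs_of_nonneg (by linarith)]
    have h2 := (hh P Q hPQ).2
    have h3 : Q - P ≤ 1 := by
      have h4 : ⌊Q⌋ + 1 ≤ ⌈P⌉ := hlt
      by_contra h5
      push Not at h5
      have : ⌈P⌉ ≤ ⌊Q⌋ := Int.le_floor.2 (by linarith)
      omega
    nlinarith [hf0 P]
  have key : ∀ n : ℕ, h ⌈P⌉ - h ((⌈P⌉ + n : ℤ) + 1 : ℝ) ≤ ∑ y ∈ Icc ⌈P⌉ (⌈P⌉ + n), f y ∧
      ∑ y ∈ Icc ⌈P⌉ (⌈P⌉ + n), f y ≤ f ⌈P⌉ + (h ⌈P⌉ - h ((⌈P⌉ + n : ℤ) : ℝ)) := by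
    intro n
    induction n with
    | zero =>
      simp only [Nat.cast_zero, add_zero, Icc_self, sum_singleton]
      have := (hh (⌈P⌉ : ℝ) (⌈P⌉ + 1 : ℝ) (by linarith)).2
      constructor <;> linarith
    | succ n ih =>
      have : Icc ⌈P⌉ (⌈P⌉ + (n + 1 : ℕ)) = insert (⌈P⌉ + (n+1 : ℕ)) (Icc ⌈P⌉ (⌈P⌉ + n)) := by
        ext z; simp only [mem_Icc, mem_insert]; push_cast; omega
      rw [this, Finset.sum_insert (by simp)]
      have h1 := (hh ((⌈P⌉ + (n+1:ℕ) : ℤ) : ℝ) ((⌈P⌉ + (n+1:ℕ) : ℤ) + 1 : ℝ) (by linarith)).2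
      have h2 := (hh ((⌈P⌉ + n : ℤ) : ℝ) ((⌈P⌉ + (n+1:ℕ) : ℤ) : ℝ) (by push_cast; linarith)).1
      push_cast at h1 h2 ih ⊢
      rw [← add_assoc] at h1 h2 ⊢
      constructor
      · linarith [ih.1]
      · linarith [ih.2]
  have := key (⌊Q⌋ - ⌈P⌉).toNat
  rw [show ⌈P⌉ + (((⌊Q⌋ - ⌈P⌉).toNat : ℕ) : ℤ) = ⌊Q⌋ by omega] at this
  have a1 := hdec Q (⌊Q⌋ + 1) hq2.le
  have a2 := hdec ⌊Q⌋ Q hq1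
  have a3 := hdec P ⌈P⌉ hc1
  have a4 := (hh P ⌈P⌉ hc1).2
  have a5 := hanti hc1
  have a6 := hf0 P
  rw [abs_le]
  constructor
  · nlinarith [this.1]
  · linarith [this.2]

lemma ap_sum (f h : ℝ → ℝ) (P Q : ℝ) (hPQ : P ≤ Q) (l : ℕ) (hl : 0 < l) (b : ℤ)
    (hf0 : ∀ x, 0 ≤ f x) (hanti : Antitone f)
    (hh : ∀ x y, x ≤ y → (y - x) * f y ≤ h x - h y ∧ h x - h y ≤ (y - x) * f x) :
    |∑ y ∈ (Icc ⌈P⌉ ⌊Q⌋).filter (fun y : ℤ => y ≡ b [ZMOD l]), f y - (h P - h Q) / l| ≤ f P := by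
  have hl' : (0:ℝ) < l := by exact_mod_cast hl
  have := ap_sum_one (fun t => f (b + l * t)) (fun t => h (b + l * t) / l) ((P - b)/l) ((Q - b)/l)
    (by gcongr) (fun x => hf0 _) (fun x y hxy => hanti (by gcongr)) (by
      intro x y hxy
      have := hh (b + l * x) (b + l * y) (by gcongr)
      have e : h (b + l * x) / l - h (b + l * y) / l = (h (b + l * x) - h (b + l * y)) / l := by ring
      rw [e, le_div_iff₀ hl', div_le_iff₀ hl']
      constructor
      · nlinarith [this.1]
      · nlinarith [this.2])
  rw [show (b:ℝ) + l * ((P - b)/l) = P by field_simp; ring,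
    show (b:ℝ) + l * ((Q - b)/l) = Q by field_simp; ring, ← sub_div] at this
  convert this using 3
  symm
  refine Finset.sum_bij (fun j _ => b + l * j) ?_ ?_ ?_ ?_
  · intro j hj
    rw [mem_Icc, Int.ceil_le, Int.le_floor, div_le_iff₀ hl', le_div_iff₀ hl'] at hj
    rw [mem_filter, mem_Icc, Int.ceil_le, Int.le_floor]
    push_cast
    refine ⟨⟨by nlinarith, by nlinarith⟩, ?_⟩
    unfold Int.ModEq; simp
  · intro a _ c _ h
    have hl2 : (l:ℤ) ≠ 0 := by exact_mod_cast hl.ne'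
    exact mul_left_cancel₀ hl2 (by simpa using h)
  · intro y hy
    rw [mem_filter, mem_Icc, Int.ceil_le, Int.le_floor] at hy
    obtain ⟨j, hj⟩ := hy.2.symm.dvd
    have hj' : (y:ℝ) = b + l * j := by
      have : y = b + l * j := by linarith
      rw [this]; push_cast; ring
    refine ⟨j, ?_, by linarith⟩
    rw [mem_Icc, Int.ceil_le, Int.le_floor, div_le_iff₀ hl', le_div_iff₀ hl']
    constructor <;> nlinarith [hy.1]
  · intro j _; push_cast; rfl

lemma pp_hh (T θ : ℝ) (hθ : 0 < θ) (x y : ℝ) (hxy : x ≤ y) :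
    (y - x) * max (T - θ * y) 0 ≤ (max (T - θ * x) 0)^2/(2*θ) - (max (T - θ * y) 0)^2/(2*θ) ∧
    (max (T - θ * x) 0)^2/(2*θ) - (max (T - θ * y) 0)^2/(2*θ) ≤ (y - x) * max (T - θ * x) 0 := by
  rw [← sub_div, le_div_iff₀ (by positivity), div_le_iff₀ (by positivity)]
  set a := max (T - θ * x) 0 with ha
  set b := max (T - θ * y) 0 with hb
  have ha0 : 0 ≤ a := le_max_right _ _
  have hb0 : 0 ≤ b := le_max_right _ _
  have hd : 0 ≤ θ * (y - x) := mul_nonneg hθ.le (by linarith)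
  have hba : b ≤ a := max_le_max (by nlinarith) le_rfl
  have hab : a - b ≤ θ * (y - x) := by
    have h1 : T - θ * y ≤ b := le_max_left _ _
    have : a ≤ b + θ * (y - x) := max_le (by linarith) (by linarith)
    linarith
  constructor
  · rcases eq_or_lt_of_le hb0 with h | h
    · rw [← h]; nlinarith
    · have h1 : b = T - θ * y := by
        rcases max_choice (T - θ * y) 0 with h2 | h2
        · rw [hb, h2]
        · rw [← hb] at h2; linarith
      have h2 : T - θ * x ≤ a := le_max_left _ _
      have h3 : a - b = θ * (y - x) := by linarith
      have h4 : a^2 - b^2 = θ * (y - x) * (a + b) := by rw [← h3]; ring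
      rw [h4]; nlinarith
  · nlinarith [mul_le_mul_of_nonneg_right hab (by linarith : 0 ≤ a + b)]

lemma ap_pp (T θ P Q : ℝ) (hθ : 0 < θ) (hPQ : P ≤ Q) (l : ℕ) (hl : 0 < l) (b : ℤ) :
    |∑ y ∈ (Icc ⌈P⌉ ⌊Q⌋).filter (fun y : ℤ => y ≡ b [ZMOD l]), max (T - θ * y) 0 -
      ((max (T - θ * P) 0)^2 - (max (T - θ * Q) 0)^2) / (2 * θ * l)| ≤ max (T - θ * P) 0 := by
  have := ap_sum (fun y => max (T - θ * y) 0) (fun y => (max (T - θ * y) 0)^2/(2*θ)) P Q hPQ l hl b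
    (fun x => le_max_right _ _) (fun x y hxy => max_le_max (by nlinarith) le_rfl)
    (fun x y hxy => pp_hh T θ hθ x y hxy)
  rwa [← sub_div, div_div] at this

end

section
open Finset

lemma hasDeriv_pp (x : ℝ) : HasDerivAt (fun x : ℝ => (max x 0)^2/2) (max x 0) x := by
  rcases lt_trichotomy x 0 with h | h | h
  · rw [max_eq_right h.le]
    refine (hasDerivAt_const x (0:ℝ)).congr_of_eventuallyEq ?_
    filter_upwards [Iio_mem_nhds h] with y hy
    rw [max_eq_right (le_of_lt hy)]; simp
  · subst h
    rw [← hasDerivWithinAt_univ, ← Set.Iic_union_Ici (a := (0:ℝ))]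
    refine HasDerivWithinAt.union ?_ ?_
    · rw [max_self]
      refine (hasDerivWithinAt_const (0:ℝ) _ (0:ℝ)).congr ?_ ?_
      · intro y hy; rw [max_eq_right hy]; simp
      · simp
    · have : HasDerivAt (fun x : ℝ => x^2/2) (max 0 0) (0:ℝ) := by
        have := ((hasDerivAt_id (0:ℝ)).pow 2).div_const 2
        simpa using this
      refine this.hasDerivWithinAt.congr ?_ ?_
      · intro y hy; rw [max_eq_left hy]
      · simp
  · rw [max_eq_left h.le]
    have : HasDerivAt (fun x : ℝ => x^2/2) x x := by
      have := ((hasDerivAt_id x).pow 2).div_const 2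
      simpa using this
    refine this.congr_of_eventuallyEq ?_
    filter_upwards [Ioi_mem_nhds h] with y hy
    rw [max_eq_left (le_of_lt hy)]

lemma integral_pp (Y m θ₁ θ₂ : ℝ) (hm : 0 < m) :
    ∫ θ in θ₁..θ₂, max (Y - θ * m) 0 = ((max (Y - θ₁ * m) 0)^2 - (max (Y - θ₂ * m) 0)^2)/(2*m) := by
  have h : ∀ θ ∈ Set.uIcc θ₁ θ₂, HasDerivAt (fun θ => -((max (Y - θ * m) 0)^2/2)/m) (max (Y - θ * m) 0) θ := by
    intro θ _
    have h1 : HasDerivAt (fun θ => Y - θ * m) (-m) θ := by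
      have := ((hasDerivAt_id θ).mul_const m).const_sub Y
      simpa using this
    have h2 := (hasDeriv_pp (Y - θ * m)).comp θ h1
    have h3 := h2.neg.div_const m
    refine HasDerivAt.congr_deriv h3 ?_
    field_simp
  rw [intervalIntegral.integral_eq_sub_of_hasDerivAt h (by
    apply Continuous.intervalIntegrable; fun_prop)]
  field_simp
  ring

/-- smooth lattice sum -/
def Esum (κ u₁ u₂ : ℝ) (k l : ℕ) (a b : ℤ) (M : ℕ) (Y : ℝ) : ℝ :=
  ∑ m ∈ (Icc 1 M).filter (fun m : ℕ => (m:ℤ) ≡ a [ZMOD k]), (1/(m:ℝ)) *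
    ∑ y ∈ (Icc ⌈-(u₁ * m)⌉ ⌊u₂ * m⌋).filter (fun y : ℤ => y ≡ b [ZMOD l]), max (Y - κ * m - y) 0

lemma msum_est (Y θ : ℝ) (hY : 0 < Y) (hθ : 0 < θ) (k : ℕ) (hk : 0 < k) (a : ℤ) (M : ℕ) (hM : Y ≤ θ * M) :
    |∑ m ∈ (Icc 1 M).filter (fun m : ℕ => (m:ℤ) ≡ a [ZMOD k]), max (Y - θ * m) 0 - Y^2/(2*k) * θ⁻¹| ≤ 2 * Y := by
  have hk1 : (1:ℝ) ≤ k := by exact_mod_cast hk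
  have hM1 : (1:ℝ) ≤ M := by
    have : M ≠ 0 := by rintro rfl; simp at hM; linarith
    exact_mod_cast Nat.one_le_iff_ne_zero.2 this
  have h1 := ap_pp Y θ 1 M hθ hM1 k hk a
  have e : ∑ m ∈ (Icc 1 M).filter (fun m : ℕ => (m:ℤ) ≡ a [ZMOD k]), max (Y - θ * m) 0 =
     ∑ y ∈ (Icc ⌈(1:ℝ)⌉ ⌊(M:ℝ)⌋).filter (fun y : ℤ => y ≡ a [ZMOD k]), max (Y - θ * y) 0 := by
    refine Finset.sum_bij (fun m _ => (m:ℤ)) ?_ ?_ ?_ ?_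
    · intro m hm
      simp only [mem_filter, mem_Icc, Int.ceil_one, Int.floor_natCast] at hm ⊢
      exact ⟨by omega, hm.2⟩
    · intro a _ b _ h; exact_mod_cast h
    · intro y hy
      simp only [mem_filter, mem_Icc, Int.ceil_one, Int.floor_natCast] at hy
      refine ⟨y.toNat, ?_, by omega⟩
      simp only [mem_filter, mem_Icc]
      have : ((y.toNat : ℕ) : ℤ) = y := by omega
      rw [this]
      exact ⟨by omega, hy.2⟩
    · intro m _; push_cast; rfl
  rw [e]
  set S := ∑ y ∈ (Icc ⌈(1:ℝ)⌉ ⌊(M:ℝ)⌋).filter (fun y : ℤ => y ≡ a [ZMOD k]), max (Y - θ * y) 0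
  rw [max_eq_right (by linarith : Y - θ * M ≤ 0)] at h1
  have hp : max (Y - θ * 1) 0 ≤ Y := max_le (by linarith) hY.le
  have hp0 : 0 ≤ max (Y - θ * 1) 0 := le_max_right _ _
  have hp1 : Y - θ ≤ max (Y - θ * 1) 0 := by simp
  set w := max (Y - θ * 1) 0
  have h2 : |(w^2 - 0^2)/(2*θ*k) - Y^2/(2*k) * θ⁻¹| ≤ Y := by
    have e2 : (w^2 - 0^2)/(2*θ*k) - Y^2/(2*k) * θ⁻¹ = -((Y^2 - w^2)/(2*θ*k)) := by
      field_simp; ring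
    rw [e2, abs_neg, abs_of_nonneg (by
      apply div_nonneg _ (by positivity); nlinarith), div_le_iff₀ (by positivity)]
    have : Y^2 - w^2 ≤ θ * (2 * Y) := by
      have : (Y - w) * (Y + w) ≤ θ * (2*Y) := by
        apply mul_le_mul <;> linarith
      linarith
    nlinarith [mul_pos hY hθ]
  calc _ = |(S - (w^2 - 0^2)/(2*θ*k)) + ((w^2 - 0^2)/(2*θ*k) - Y^2/(2*k) * θ⁻¹)| := by congr 1; ring
    _ ≤ _ := (abs_add_le _ _).trans (by linarith)

lemma Esum_est (κ u₁ u₂ : ℝ) (hu1 : 0 ≤ u₁) (hu2 : 0 ≤ u₂) (hu1' : u₁ ≤ 1/2) (hu2' : u₂ ≤ 1/2) (hκ : u₁ < κ)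
    (k l : ℕ) (hk : 0 < k) (hl : 0 < l) (a b : ℤ) (M : ℕ) (Y : ℝ) (hY : 0 < Y) (hM : Y ≤ (κ - u₁) * M) :
    |Esum κ u₁ u₂ k l a b M Y - Y^2/(2*k*l) * Real.log ((κ + u₂)/(κ - u₁))| ≤ 3 * Y * (1 + Real.log M) := by
  have hk1 : (1:ℝ) ≤ k := by exact_mod_cast hk
  have hl1 : (1:ℝ) ≤ l := by exact_mod_cast hl
  have hM1 : 1 ≤ M := by
    have : M ≠ 0 := by rintro rfl; simp at hM; linarith
    exact Nat.one_le_iff_ne_zero.2 this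
  have hlog : 0 ≤ Real.log M := Real.log_nonneg (by exact_mod_cast hM1)
  set θ₁ := κ - u₁ with hθ1
  set θ₂ := κ + u₂ with hθ2
  have hθpp : 0 < θ₁ := by linarith
  have hθ12 : θ₁ ≤ θ₂ := by linarith
  set A := (Icc 1 M).filter (fun m : ℕ => (m:ℤ) ≡ a [ZMOD k]) with hA
  have hApos : ∀ m ∈ A, (0:ℝ) < m := by
    intro m hm; rw [hA, mem_filter, mem_Icc] at hm; exact_mod_cast hm.1.1
  -- step A
  have hStepA : |Esum κ u₁ u₂ k l a b M Y - (1/(l:ℝ)) * ∑ m ∈ A, ∫ θ in θ₁..θ₂, max (Y - θ * m) 0| ≤ Y * (1 + Real.log M) := by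
    unfold Esum
    rw [Finset.mul_sum, ← Finset.sum_sub_distrib]
    refine (Finset.abs_sum_le_sum_abs _ _).trans ?_
    calc _ ≤ ∑ m ∈ A, Y * (m:ℝ)⁻¹ := by
          refine Finset.sum_le_sum fun m hm => ?_
          have hm0 := hApos m hm
          have h1 := ap_pp (Y - κ * m) 1 (-(u₁ * m)) (u₂ * m) one_pos (by nlinarith) l hl b
          rw [integral_pp Y m θ₁ θ₂ hm0]
          simp only [one_mul, mul_one] at h1
          rw [show Y - κ * m - -(u₁ * m) = Y - θ₁ * m by rw [hθ1]; ring,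
            show Y - κ * m - u₂ * m = Y - θ₂ * m by rw [hθ2]; ring] at h1
          set S := ∑ y ∈ (Icc ⌈-(u₁ * m)⌉ ⌊u₂ * m⌋).filter (fun y : ℤ => y ≡ b [ZMOD l]), max (Y - κ * m - y) 0
          have e : 1/(m:ℝ) * S - 1/(l:ℝ) * (((max (Y - θ₁ * m) 0)^2 - (max (Y - θ₂ * m) 0)^2)/(2*m)) =
            (m:ℝ)⁻¹ * (S - ((max (Y - θ₁ * m) 0)^2 - (max (Y - θ₂ * m) 0)^2)/(2*l)) := by
            field_simp
          rw [e, abs_mul, abs_of_pos (by positivity), mul_comm]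
          refine mul_le_mul_of_nonneg_right (h1.trans ?_) (by positivity)
          exact max_le (by nlinarith) hY.le
      _ ≤ Y * ∑ m ∈ Icc 1 M, (m:ℝ)⁻¹ := by
          rw [← Finset.mul_sum]
          refine mul_le_mul_of_nonneg_left ?_ hY.le
          exact Finset.sum_le_sum_of_subset_of_nonneg (Finset.filter_subset _ _) (fun _ _ _ => by positivity)
      _ ≤ _ := by
          have := harmonic_le_one_add_log M
          rw [harmonic_eq_sum_Icc] at this
          push_cast at this
          exact mul_le_mul_of_nonneg_left this hY.le
  have hStepB : |∑ m ∈ A, (∫ θ in θ₁..θ₂, max (Y - θ * m) 0) - Y^2/(2*k) * Real.log (θ₂/θ₁)| ≤ 2 * Y := by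
    have hlogint : ∫ θ in θ₁..θ₂, Y^2/(2*k) * θ⁻¹ = Y^2/(2*k) * Real.log (θ₂/θ₁) := by
      rw [intervalIntegral.integral_const_mul, integral_inv_of_pos hθpp (by linarith)]
    rw [← hlogint, ← intervalIntegral.integral_finset_sum (fun m _ => by
      apply Continuous.intervalIntegrable; fun_prop), ← intervalIntegral.integral_sub]
    · have := intervalIntegral.norm_integral_le_of_norm_le_const (a := θ₁) (b := θ₂) (C := 2 * Y)
        (f := fun θ => ∑ m ∈ A, max (Y - θ * m) 0 - Y^2/(2*k) * θ⁻¹) (by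
          intro θ hθ
          rw [Set.uIoc_of_le hθ12] at hθ
          rw [Real.norm_eq_abs]
          refine msum_est Y θ hY (by linarith [hθ.1]) k hk a M ?_
          refine hM.trans ?_
          have := hθ.1.le
          gcongr)
      rw [Real.norm_eq_abs] at this
      refine this.trans ?_
      rw [abs_of_nonneg (by linarith)]
      have : θ₂ - θ₁ ≤ 1 := by linarith
      nlinarith
    · apply Continuous.intervalIntegrable; fun_prop
    · apply ContinuousOn.intervalIntegrable
      rw [Set.uIcc_of_le hθ12]
      apply ContinuousOn.mul continuousOn_const
      apply ContinuousOn.inv₀ continuousOn_id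
      intro x hx; have := hx.1; simp only [id]; linarith
  have e : Esum κ u₁ u₂ k l a b M Y - Y^2/(2*k*l) * Real.log (θ₂/θ₁) =
     (Esum κ u₁ u₂ k l a b M Y - (1/(l:ℝ)) * ∑ m ∈ A, ∫ θ in θ₁..θ₂, max (Y - θ * m) 0) +
     (1/(l:ℝ)) * (∑ m ∈ A, (∫ θ in θ₁..θ₂, max (Y - θ * m) 0) - Y^2/(2*k) * Real.log (θ₂/θ₁)) := by
    field_simp; ring
  rw [e]
  refine (abs_add_le _ _).trans ?_
  rw [abs_mul, abs_of_pos (by positivity : 0 < 1/(l:ℝ))]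
  have : 1/(l:ℝ) * |∑ m ∈ A, (∫ θ in θ₁..θ₂, max (Y - θ * m) 0) - Y^2/(2*k) * Real.log (θ₂/θ₁)| ≤ 1 * (2 * Y) := by
    apply mul_le_mul _ hStepB (abs_nonneg _) (by norm_num)
    rw [div_le_one (by positivity)]; exact hl1
  nlinarith [mul_nonneg hY.le hlog]

end

section
open Finset

lemma moebius_sum : HasSum (fun n : ℕ => (ArithmeticFunction.moebius n : ℝ) / (n:ℝ)^2) (6 / Real.pi^2) := by
  have h2 : 1 < (2:ℂ).re := by norm_num
  have hs := (ArithmeticFunction.LSeriesSummable_moebius_iff (s := 2)).2 h2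
  have hv := ArithmeticFunction.LSeries_zeta_mul_Lseries_moebius (s := 2) h2
  rw [ArithmeticFunction.LSeries_zeta_eq_riemannZeta h2, riemannZeta_two] at hv
  have hh := hs.LSeriesHasSum
  unfold LSeriesHasSum at hh
  have hpi : (Real.pi : ℂ) ≠ 0 := by exact_mod_cast Real.pi_ne_zero
  have e1 : LSeries (fun n => ((ArithmeticFunction.moebius n : ℤ) : ℂ)) 2 = ((6 / Real.pi^2 : ℝ) : ℂ) := by
    push_cast
    field_simp at hv ⊢
    linear_combination hv
  rw [e1] at hh
  have e2 : LSeries.term (fun n => ((ArithmeticFunction.moebius n : ℤ) : ℂ)) 2 =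
      fun n : ℕ => (((ArithmeticFunction.moebius n : ℝ) / (n:ℝ)^2 : ℝ) : ℂ) := by
    funext n
    rw [LSeries.term_def]
    split_ifs with h
    · subst h; simp
    · push_cast
      congr 1
      exact_mod_cast Complex.cpow_natCast (n:ℂ) 2
  rw [e2] at hh
  exact_mod_cast hh

lemma moebius_odd_sum : HasSum (fun n : ℕ => if Odd n then (ArithmeticFunction.moebius n : ℝ) / (n:ℝ)^2 else 0)
    (8 / Real.pi^2) := by
  set f : ℕ → ℝ := fun n => (ArithmeticFunction.moebius n : ℝ) / (n:ℝ)^2 with hf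
  set g : ℕ → ℝ := fun n => if Odd n then f n else 0 with hg
  have hfs : HasSum f (6 / Real.pi^2) := moebius_sum
  have hgs : Summable g := by
    have := hfs.summable.indicator {n | Odd n}
    refine this.congr ?_
    intro n; simp [hg, Set.indicator_apply]
  obtain ⟨S, hS⟩ := hgs
  have ho : HasSum (fun k => f (2 * k + 1)) S := by
    have hinj : Function.Injective (fun k : ℕ => 2 * k + 1) := fun a b h => by simp at h; exact h
    have h1 := (hinj.hasSum_iff (f := g) (a := S) (by
      intro n hn
      rw [hg]; simp only
      rw [if_neg]
      rintro ⟨k, hk⟩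
      exact hn ⟨k, hk.symm⟩)).2 hS
    refine h1.congr_fun ?_
    intro k
    simp [hg]
  have he : HasSum (fun k => f (2 * k)) (-(1/4) * S) := by
    refine (hS.mul_left (-(1/4))).congr_fun ?_
    intro k
    simp only [hg, hf]
    split_ifs with h
    · have hc : Nat.Coprime 2 k := (Nat.coprime_two_left).2 h
      have := ArithmeticFunction.isMultiplicative_moebius.map_mul_of_coprime hc
      rw [ArithmeticFunction.moebius_apply_prime Nat.prime_two] at this
      rw [this]; push_cast
      ring
    · have hk : Even k := Nat.not_odd_iff_even.1 h
      obtain ⟨j, hj⟩ := hk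
      have : ¬ Squarefree (2 * k) := by
        intro hsq
        have := hsq 2 ⟨j, by rw [hj]; ring⟩
        simp at this
      rw [ArithmeticFunction.moebius_eq_zero_of_not_squarefree this]; simp
  have h3 := he.even_add_odd ho
  have h4 := h3.unique hfs
  have : S = 8 / Real.pi^2 := by
    have h5 : S = (4/3) * (6 / Real.pi^2) := by linarith
    rw [h5]; ring
  rw [← this]; exact hS

lemma moebius_odd_partial (M : ℕ) (hM : 1 ≤ M) :
    |∑ d ∈ (Icc 1 M).filter Odd, (ArithmeticFunction.moebius d : ℝ) / (d:ℝ)^2 - 8 / Real.pi^2| ≤ 1 / (M:ℝ) := by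
  set g : ℕ → ℝ := fun n : ℕ => if Odd n then (ArithmeticFunction.moebius n : ℝ) / (n:ℝ)^2 else 0 with hg
  have hS : HasSum g (8 / Real.pi^2) := moebius_odd_sum
  have hb : ∀ n, |g n| ≤ ((n:ℝ)^2)⁻¹ := by
    intro n
    rw [hg]; simp only
    split_ifs
    · rw [abs_div, abs_of_nonneg (by positivity : (0:ℝ) ≤ (n:ℝ)^2), div_eq_mul_inv]
      have : |(ArithmeticFunction.moebius n : ℝ)| ≤ 1 := by
        exact_mod_cast ArithmeticFunction.abs_moebius_le_one (n := n)
      calc _ ≤ 1 * ((n:ℝ)^2)⁻¹ := by gcongr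
        _ = _ := one_mul _
    · simp
  have e1 : ∀ N, ∑ d ∈ (Icc 1 N).filter Odd, (ArithmeticFunction.moebius d : ℝ) / (d:ℝ)^2 = ∑ d ∈ range (N+1), g d := by
    intro N
    rw [Finset.sum_filter]
    have : range (N+1) = insert 0 (Icc 1 N) := by
      ext x; simp only [mem_range, mem_insert, mem_Icc]; omega
    rw [this, Finset.sum_insert (by simp)]
    simp [hg]
  rw [e1]
  have ht := hS.tendsto_sum_nat
  have ht2 : Filter.Tendsto (fun N => |∑ d ∈ range (M+1), g d - ∑ d ∈ range N, g d|) Filter.atTop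
      (nhds |∑ d ∈ range (M+1), g d - 8 / Real.pi^2|) := (tendsto_const_nhds.sub ht).abs
  refine le_of_tendsto ht2 ?_
  filter_upwards [Filter.eventually_ge_atTop (M+1)] with N hN
  rw [abs_sub_comm, ← Finset.sum_Ico_eq_sub _ hN]
  refine (Finset.abs_sum_le_sum_abs _ _).trans ?_
  refine (Finset.sum_le_sum fun n _ => hb n).trans ?_
  have h1 := sum_Ioc_inv_sq_le_sub (α := ℝ) (k := M) (n := N - 1) (by omega) (by omega)
  have e2 : Ico (M+1) N = Ioc M (N-1) := by ext x; simp only [mem_Ico, mem_Ioc]; omega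
  rw [e2]
  refine h1.trans ?_
  rw [one_div]
  have : (0:ℝ) ≤ ((N-1:ℕ):ℝ)⁻¹ := by positivity
  linarith

end

section
open Finset

/-- lattice sum with coprimality -/
def Msum (κ u₁ u₂ : ℝ) (k l : ℕ) (a b : ℤ) (M : ℕ) (Y : ℝ) : ℝ :=
  ∑ m ∈ (Icc 1 M).filter (fun m : ℕ => (m:ℤ) ≡ a [ZMOD k]), (1/(m:ℝ)) *
    ∑ y ∈ (Icc ⌈-(u₁ * m)⌉ ⌊u₂ * m⌋).filter (fun y : ℤ => y ≡ b [ZMOD l] ∧ Int.gcd y m = 1),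
      max (Y - κ * m - y) 0

lemma moebius_ind (M m : ℕ) (y : ℤ) (hm1 : 1 ≤ m) (hmM : m ≤ M) (hodd : Odd (Int.gcd y m)) :
    (∑ d ∈ (Icc 1 M).filter Odd, if (d ∣ m ∧ (d:ℤ) ∣ y) then (ArithmeticFunction.moebius d : ℝ) else 0) =
      if Int.gcd y m = 1 then 1 else 0 := by
  have hg0 : Int.gcd y m ≠ 0 := by rintro h; rw [h] at hodd; simp at hodd
  have e : (((Icc 1 M).filter Odd).filter (fun d => d ∣ m ∧ (d:ℤ) ∣ y)) = (Int.gcd y m).divisors := by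
    ext d
    simp only [mem_filter, mem_Icc, Nat.mem_divisors]
    have hd : d ∣ Int.gcd y m ↔ (d ∣ m ∧ (d:ℤ) ∣ y) := by
      constructor
      · intro h
        have h' : (d:ℤ) ∣ (Int.gcd y m : ℤ) := Int.natCast_dvd_natCast.mpr h
        exact ⟨Int.natCast_dvd_natCast.mp (h'.trans (Int.gcd_dvd_right _ _)), h'.trans (Int.gcd_dvd_left _ _)⟩
      · rintro ⟨h1, h2⟩
        exact Int.natCast_dvd_natCast.mp (Int.dvd_coe_gcd h2 (Int.natCast_dvd_natCast.mpr h1))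
    constructor
    · rintro ⟨_, h⟩
      exact ⟨hd.mpr h, hg0⟩
    · rintro ⟨h, _⟩
      have h2 := hd.mp h
      have hdm := Nat.le_of_dvd (by omega) h2.1
      have hd0 : d ≠ 0 := by
        rintro rfl
        have := Nat.eq_zero_of_zero_dvd h2.1
        omega
      refine ⟨⟨⟨by omega, by omega⟩, ?_⟩, h2⟩
      exact Odd.of_dvd_nat hodd h
  rw [← Finset.sum_filter, e]
  have := @ArithmeticFunction.coe_mul_zeta_apply ℤ _ ArithmeticFunction.moebius (Int.gcd y m)
  rw [ArithmeticFunction.moebius_mul_coe_zeta, ArithmeticFunction.one_apply] at this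
  have h2 := congrArg (fun z : ℤ => (z:ℝ)) this
  push_cast at h2
  rw [← h2]


lemma Esum_scale (κ u₁ u₂ : ℝ) (hu1 : 0 ≤ u₁) (hκ : u₁ < κ) (k l : ℕ) (a b : ℤ) (M : ℕ) (Y : ℝ)
    (hM : Y ≤ (κ - u₁) * M) (d : ℕ) (hd : 1 ≤ d)
    (H1 : ∀ m : ℤ, (d * m ≡ a [ZMOD k] ↔ m ≡ a [ZMOD k]))
    (H2 : ∀ m : ℤ, (d * m ≡ b [ZMOD l] ↔ m ≡ b [ZMOD l])) :
    ∑ m ∈ ((Icc 1 M).filter (fun m : ℕ => (m:ℤ) ≡ a [ZMOD k])).filter (fun m => d ∣ m), (1/(m:ℝ)) *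
      ∑ y ∈ ((Icc ⌈-(u₁ * m)⌉ ⌊u₂ * m⌋).filter (fun y : ℤ => y ≡ b [ZMOD l])).filter (fun y => (d:ℤ) ∣ y),
      max (Y - κ * m - y) 0 = Esum κ u₁ u₂ k l a b M (Y / d) := by
  have hd0 : (0:ℝ) < d := by exact_mod_cast hd
  unfold Esum
  rw [← Finset.sum_subset (s₁ := ((Icc 1 M).filter (fun m : ℕ => (m:ℤ) ≡ a [ZMOD k])).filter (fun m => d * m ≤ M))
    (Finset.filter_subset _ _)]
  · symm
    refine Finset.sum_nbij' (fun m => d * m) (fun m => m / d) ?_ ?_ ?_ ?_ ?_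
    · intro m hm
      simp only [mem_filter, mem_Icc] at hm ⊢
      refine ⟨⟨⟨Nat.mul_pos (by omega) (by omega), hm.2⟩, ?_⟩, dvd_mul_right _ _⟩
      push_cast
      exact (H1 m).mpr hm.1.2
    · intro m hm
      simp only [mem_filter, mem_Icc] at hm ⊢
      obtain ⟨⟨⟨h1, h2⟩, h3⟩, ⟨c, rfl⟩⟩ := hm
      rw [Nat.mul_div_cancel_left _ (by omega)]
      have hc : 1 ≤ c := by
        rcases Nat.eq_zero_or_pos c with h | h
        · subst h; omega
        · exact h
      refine ⟨⟨⟨hc, ?_⟩, ?_⟩, h2⟩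
      · nlinarith
      · push_cast at h3; exact (H1 c).mp h3
    · intro m hm
      exact Nat.mul_div_cancel_left _ (by omega)
    · intro m hm
      simp only [mem_filter] at hm
      exact Nat.mul_div_cancel' hm.2
    · intro m hm
      simp only [mem_filter, mem_Icc] at hm
      have hm0 : (0:ℝ) < m := by exact_mod_cast hm.1.1.1
      have e : ∑ y ∈ ((Icc ⌈-(u₁ * ((d * m : ℕ):ℝ))⌉ ⌊u₂ * ((d * m : ℕ):ℝ)⌋).filter (fun y : ℤ => y ≡ b [ZMOD l])).filter (fun y => (d:ℤ) ∣ y),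
          max (Y - κ * ((d * m : ℕ):ℝ) - y) 0 = ∑ y ∈ (Icc ⌈-(u₁ * m)⌉ ⌊u₂ * m⌋).filter (fun y : ℤ => y ≡ b [ZMOD l]), (d:ℝ) * max (Y / d - κ * m - y) 0 := by
        have hdz : (d:ℤ) ≠ 0 := by positivity
        symm
        refine Finset.sum_nbij' (fun y => d * y) (fun y => y / d) ?_ ?_ ?_ ?_ ?_
        · intro y hy
          simp only [mem_filter, mem_Icc, Int.ceil_le, Int.le_floor] at hy ⊢
          refine ⟨⟨⟨?_, ?_⟩, (H2 y).mpr hy.2⟩, dvd_mul_right _ _⟩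
          · push_cast; nlinarith [mul_le_mul_of_nonneg_left hy.1.1 hd0.le]
          · push_cast; nlinarith [mul_le_mul_of_nonneg_left hy.1.2 hd0.le]
        · intro y hy
          simp only [mem_filter, mem_Icc, Int.ceil_le, Int.le_floor] at hy ⊢
          obtain ⟨⟨⟨h1, h2⟩, h3⟩, ⟨c, rfl⟩⟩ := hy
          rw [Int.mul_ediv_cancel_left _ hdz]
          push_cast at h1 h2
          refine ⟨⟨?_, ?_⟩, (H2 c).mp h3⟩
          · refine le_of_mul_le_mul_left ?_ hd0; linarith
          · refine le_of_mul_le_mul_left ?_ hd0; linarith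
        · intro y hy; exact Int.mul_ediv_cancel_left _ hdz
        · intro y hy
          simp only [mem_filter] at hy
          exact Int.mul_ediv_cancel' hy.2
        · intro y hy
          rw [mul_max_of_nonneg _ _ hd0.le]
          congr 1
          · push_cast; field_simp
          · simp
      rw [e, ← Finset.mul_sum]
      push_cast
      field_simp
  · intro m hm hm2
    simp only [mem_filter, mem_Icc] at hm hm2
    have hm3 : M < d * m := by
      by_contra h
      exact hm2 ⟨hm, by omega⟩
    have hm4 : (M:ℝ) < d * m := by exact_mod_cast hm3
    rw [Finset.sum_eq_zero, mul_zero]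
    intro y hy
    simp only [mem_filter, mem_Icc, Int.ceil_le, Int.le_floor] at hy
    apply max_eq_right
    have : Y / d ≤ (κ - u₁) * m := by
      rw [div_le_iff₀ hd0]
      nlinarith [mul_lt_mul_of_pos_left hm4 (sub_pos.mpr hκ)]
    nlinarith [hy.1.1]

lemma Msum_eq (κ u₁ u₂ : ℝ) (hu1 : 0 ≤ u₁) (hκ : u₁ < κ) (k l : ℕ) (a b : ℤ) (M : ℕ) (Y : ℝ)
    (hM : Y ≤ (κ - u₁) * M)
    (H1 : ∀ d : ℕ, Odd d → ∀ m : ℤ, (d * m ≡ a [ZMOD k] ↔ m ≡ a [ZMOD k]))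
    (H2 : ∀ d : ℕ, Odd d → ∀ m : ℤ, (d * m ≡ b [ZMOD l] ↔ m ≡ b [ZMOD l]))
    (H3 : ∀ m y : ℤ, m ≡ a [ZMOD k] → y ≡ b [ZMOD l] → Odd (Int.gcd y m)) :
    Msum κ u₁ u₂ k l a b M Y =
      ∑ d ∈ (Icc 1 M).filter Odd, (ArithmeticFunction.moebius d : ℝ) * Esum κ u₁ u₂ k l a b M (Y / d) := by
  have e1 : ∀ m ∈ (Icc 1 M).filter (fun m : ℕ => (m:ℤ) ≡ a [ZMOD k]), (1/(m:ℝ)) *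
    ∑ y ∈ (Icc ⌈-(u₁ * m)⌉ ⌊u₂ * m⌋).filter (fun y : ℤ => y ≡ b [ZMOD l] ∧ Int.gcd y m = 1),
      max (Y - κ * m - y) 0 = ∑ d ∈ (Icc 1 M).filter Odd, (ArithmeticFunction.moebius d : ℝ) *
        (if d ∣ m then (1/(m:ℝ)) * ∑ y ∈ ((Icc ⌈-(u₁ * m)⌉ ⌊u₂ * m⌋).filter (fun y : ℤ => y ≡ b [ZMOD l])).filter (fun y => (d:ℤ) ∣ y),
      max (Y - κ * m - y) 0 else 0) := by
    intro m hm
    simp only [mem_filter, mem_Icc] at hm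
    rw [← Finset.filter_filter, Finset.sum_filter]
    have : ∀ y ∈ (Icc ⌈-(u₁ * m)⌉ ⌊u₂ * m⌋).filter (fun y : ℤ => y ≡ b [ZMOD l]),
        (if Int.gcd y m = 1 then max (Y - κ * m - y) 0 else 0) =
        ∑ d ∈ (Icc 1 M).filter Odd, (if (d ∣ m ∧ (d:ℤ) ∣ y) then (ArithmeticFunction.moebius d : ℝ) else 0) * max (Y - κ * m - y) 0 := by
      intro y hy
      simp only [mem_filter] at hy
      rw [← Finset.sum_mul, moebius_ind M m y hm.1.1 hm.1.2 (H3 _ _ hm.2 hy.2)]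
      split_ifs <;> simp
    rw [Finset.sum_congr rfl this, Finset.sum_comm, Finset.mul_sum]
    refine Finset.sum_congr rfl fun d hd => ?_
    by_cases hdm : d ∣ m
    · simp only [hdm, true_and, if_true]
      rw [Finset.sum_filter (fun y : ℤ => (d:ℤ) ∣ y), ← mul_assoc, mul_comm (ArithmeticFunction.moebius d : ℝ), mul_assoc, Finset.mul_sum (a := (ArithmeticFunction.moebius d : ℝ))]
      congr 1
      refine Finset.sum_congr rfl fun y hy => ?_
      split_ifs <;> simp
    · simp [hdm]
  unfold Msum
  rw [Finset.sum_congr rfl e1, Finset.sum_comm]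
  refine Finset.sum_congr rfl fun d hd => ?_
  simp only [mem_filter, mem_Icc] at hd
  rw [← Finset.mul_sum, ← Finset.sum_filter, Esum_scale κ u₁ u₂ hu1 hκ k l a b M Y hM d hd.1.1 (H1 d hd.2) (H2 d hd.2)]

lemma Msum_est (κ u₁ u₂ : ℝ) (hu1 : 0 ≤ u₁) (hu2 : 0 ≤ u₂) (hu1' : u₁ ≤ 1/2) (hu2' : u₂ ≤ 1/2) (hκ : u₁ < κ)
    (k l : ℕ) (hk : 1 ≤ k) (hl : 1 ≤ l) (a b : ℤ) (M : ℕ) (Y : ℝ) (hY : 0 < Y)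
    (hM : Y ≤ (κ - u₁) * M)
    (H1 : ∀ d : ℕ, Odd d → ∀ m : ℤ, (d * m ≡ a [ZMOD k] ↔ m ≡ a [ZMOD k]))
    (H2 : ∀ d : ℕ, Odd d → ∀ m : ℤ, (d * m ≡ b [ZMOD l] ↔ m ≡ b [ZMOD l]))
    (H3 : ∀ m y : ℤ, m ≡ a [ZMOD k] → y ≡ b [ZMOD l] → Odd (Int.gcd y m)) :
    |Msum κ u₁ u₂ k l a b M Y - 8 / Real.pi^2 * (Y^2/(2*k*l) * Real.log ((κ + u₂)/(κ - u₁)))|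
      ≤ (3 + (κ - u₁) * Real.log ((κ + u₂)/(κ - u₁))) * Y * (1 + Real.log M)^2 := by
  set W := Real.log ((κ + u₂)/(κ - u₁)) with hW
  have hW0 : 0 ≤ W := by
    apply Real.log_nonneg
    rw [le_div_iff₀ (by linarith)]; linarith
  have hM1 : 1 ≤ M := by
    rcases Nat.eq_zero_or_pos M with h | h
    · subst h; simp at hM; linarith
    · exact h
  have hM0 : (0:ℝ) < M := by exact_mod_cast hM1
  have hlM : 0 ≤ Real.log M := Real.log_nonneg (by exact_mod_cast hM1)
  rw [Msum_eq κ u₁ u₂ hu1 hκ k l a b M Y hM H1 H2 H3]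
  have hk' : (1:ℝ) ≤ k := by exact_mod_cast hk
  have hl' : (1:ℝ) ≤ l := by exact_mod_cast hl
  set S := (Icc 1 M).filter Odd with hS
  have est : ∀ d ∈ S, |(ArithmeticFunction.moebius d : ℝ) * Esum κ u₁ u₂ k l a b M (Y / d) -
      (ArithmeticFunction.moebius d : ℝ) / (d:ℝ)^2 * (Y^2/(2*k*l) * W)| ≤ 3 * Y * (1 + Real.log M) * (1/(d:ℝ)) := by
    intro d hd
    simp only [hS, mem_filter, mem_Icc] at hd
    have hd1 : (1:ℝ) ≤ d := by exact_mod_cast hd.1.1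
    have hd0 : (0:ℝ) < d := by linarith
    have h := Esum_est κ u₁ u₂ hu1 hu2 hu1' hu2' hκ k l hk hl a b M (Y/d) (by positivity)
      ((div_le_self hY.le hd1).trans hM)
    have e : (ArithmeticFunction.moebius d : ℝ) * Esum κ u₁ u₂ k l a b M (Y / d) -
      (ArithmeticFunction.moebius d : ℝ) / (d:ℝ)^2 * (Y^2/(2*k*l) * W) = (ArithmeticFunction.moebius d : ℝ) *
        (Esum κ u₁ u₂ k l a b M (Y / d) - (Y/d)^2/(2*k*l) * W) := by
      field_simp
    rw [e, abs_mul]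
    have hmu : |(ArithmeticFunction.moebius d : ℝ)| ≤ 1 := by
      have := @ArithmeticFunction.abs_moebius_le_one d
      exact_mod_cast this
    calc _ ≤ 1 * (3 * (Y/d) * (1 + Real.log M)) := mul_le_mul hmu h (abs_nonneg _) (by norm_num)
      _ = _ := by field_simp
  have hsum : ∑ d ∈ S, (1/(d:ℝ)) ≤ 1 + Real.log M := by
    calc _ ≤ ∑ d ∈ Icc 1 M, (1/(d:ℝ)) := by
          apply Finset.sum_le_sum_of_subset_of_nonneg (Finset.filter_subset _ _)
          intros; positivity
      _ ≤ _ := by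
          have := harmonic_le_one_add_log M
          rw [harmonic_eq_sum_Icc] at this
          push_cast at this
          simpa using this
  have h1 : |∑ d ∈ S, (ArithmeticFunction.moebius d : ℝ) * Esum κ u₁ u₂ k l a b M (Y / d) -
      (∑ d ∈ S, (ArithmeticFunction.moebius d : ℝ) / (d:ℝ)^2) * (Y^2/(2*k*l) * W)| ≤ 3 * Y * (1 + Real.log M) * (1 + Real.log M) := by
    rw [Finset.sum_mul, ← Finset.sum_sub_distrib]
    refine (Finset.abs_sum_le_sum_abs _ _).trans ((Finset.sum_le_sum est).trans ?_)
    rw [← Finset.mul_sum]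
    exact mul_le_mul_of_nonneg_left hsum (by positivity)
  have h2 := moebius_odd_partial M hM1
  rw [← hS] at h2
  have hP : 0 ≤ Y^2/(2*k*l) * W := by positivity
  have h3 : |(∑ d ∈ S, (ArithmeticFunction.moebius d : ℝ) / (d:ℝ)^2) * (Y^2/(2*k*l) * W) - 8 / Real.pi^2 * (Y^2/(2*k*l) * W)|
      ≤ (κ - u₁) * W * Y := by
    rw [← sub_mul, abs_mul, abs_of_nonneg hP]
    calc _ ≤ 1/(M:ℝ) * (Y^2 / 1 * W) := by
          apply mul_le_mul h2 _ hP (by positivity)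
          apply mul_le_mul_of_nonneg_right _ hW0
          apply div_le_div_of_nonneg_left (by positivity) (by norm_num)
          nlinarith
      _ = (Y / M) * (W * Y) := by field_simp
      _ ≤ (κ - u₁) * (W * Y) := by
          apply mul_le_mul_of_nonneg_right _ (by positivity)
          rw [div_le_iff₀ hM0]; exact hM
      _ = _ := by ring
  have h4 := abs_sub_le (∑ d ∈ S, (ArithmeticFunction.moebius d : ℝ) * Esum κ u₁ u₂ k l a b M (Y / d))
    ((∑ d ∈ S, (ArithmeticFunction.moebius d : ℝ) / (d:ℝ)^2) * (Y^2/(2*k*l) * W)) (8 / Real.pi^2 * (Y^2/(2*k*l) * W))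
  refine h4.trans ((add_le_add h1 h3).trans ?_)
  have : (κ - u₁) * W * Y ≤ (κ - u₁) * W * Y * (1 + Real.log M)^2 := by
    apply le_mul_of_one_le_right
    · have : 0 ≤ κ - u₁ := by linarith
      positivity
    · nlinarith
  nlinarith

end

section
open Finset

/-- number of lattice points on the modular hyperbola -/
def Gc (κ u₁ u₂ : ℝ) (m : ℕ) (c : ZMod m) (Y : ℝ) : ℕ :=
  ∑ y ∈ Icc ⌈-(u₁ * m)⌉ ⌊u₂ * m⌋, ((Icc ⌈κ * m⌉ (⌊Y⌋ - y)).filter (fun x : ℤ => (x : ZMod m) * (y : ZMod m) = c)).card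

lemma isUnit_zmod_iff (m : ℕ) (y : ℤ) : IsUnit (y : ZMod m) ↔ Int.gcd y m = 1 := by
  rw [ZMod.coe_int_isUnit_iff_isCoprime, isCoprime_comm, Int.isCoprime_iff_gcd_eq_one]

lemma Gc_est (κ u₁ u₂ : ℝ) (hu1 : 0 ≤ u₁) (hu2 : 0 ≤ u₂) (hu1' : u₁ ≤ 1/2) (hu2' : u₂ ≤ 1/2)
    (m : ℕ) [NeZero m] (c : (ZMod m)ˣ) (Y : ℝ) :
    |(Gc κ u₁ u₂ m c Y : ℝ) - (1/(m:ℝ)) * ∑ y ∈ (Icc ⌈-(u₁ * m)⌉ ⌊u₂ * m⌋).filter (fun y : ℤ => Int.gcd y m = 1),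
      max (Y - κ * m - y) 0| ≤ 6 * Ew m + 2 := by
  have hm0 : (0:ℝ) < m := by exact_mod_cast NeZero.pos m
  have hm1 : (1:ℝ) ≤ m := by exact_mod_cast NeZero.pos m
  set L := ⌈-(u₁ * m)⌉ with hL
  set V := ⌊u₂ * m⌋ with hV
  set A0 := ⌈κ * m⌉ with hA
  set U := min V (⌊Y⌋ - A0 + 1) with hU
  have hsub : Icc L U ⊆ Icc L V := Finset.Icc_subset_Icc le_rfl (min_le_left _ _)
  have hlenV : ((Icc L V).card : ℝ) ≤ 2 * m := by
    rw [Int.card_Icc]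
    have h1 : (V:ℝ) ≤ u₂ * m := Int.floor_le _
    have h2 : -(u₁ * m) ≤ (L:ℝ) := Int.le_ceil _
    rcases le_total (V + 1 - L) 0 with h | h
    · rw [Int.toNat_of_nonpos h]; simp
    · have : (((V + 1 - L).toNat : ℤ) : ℝ) = ((V + 1 - L : ℤ):ℝ) := by rw [Int.toNat_of_nonneg h]
      rw [Int.cast_natCast] at this
      rw [this]; push_cast
      nlinarith
  have hlen : (Icc L U).card ≤ 2 * m := by
    have : ((Icc L U).card : ℝ) ≤ ((2 * m : ℕ):ℝ) := by
      push_cast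
      refine le_trans ?_ hlenV
      exact_mod_cast Finset.card_le_card hsub
    exact_mod_cast this
  have hmain := count_main m c ⌊Y⌋ A0 L U (min_le_right _ _) hlen
  have eG : Gc κ u₁ u₂ m c Y = ∑ y ∈ (Icc L U).filter (fun y : ℤ => IsUnit (y : ZMod m)), ((Icc A0 (⌊Y⌋ - y)).filter (fun x : ℤ => (x : ZMod m) * y = c)).card := by
    unfold Gc
    symm
    apply Finset.sum_subset ((Finset.filter_subset _ _).trans hsub)
    intro y hy hy2
    rw [Finset.card_eq_zero, Finset.filter_eq_empty_iff]
    intro x hx hxy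
    apply hy2
    have hy' := Finset.mem_Icc.mp hy
    have hx' := Finset.mem_Icc.mp hx
    rw [Finset.mem_filter, Finset.mem_Icc]
    refine ⟨⟨hy'.1, le_min hy'.2 (by omega)⟩, ?_⟩
    have : IsUnit ((x : ZMod m) * (y : ZMod m)) := by rw [hxy]; exact c.isUnit
    exact isUnit_of_mul_isUnit_right this
  rw [← eG] at hmain
  have e2 : ∑ y ∈ (Icc L V).filter (fun y : ℤ => Int.gcd y m = 1), max (Y - κ * m - y) 0 =
      ∑ y ∈ (Icc L U).filter (fun y : ℤ => IsUnit (y : ZMod m)), max (Y - κ * m - y) 0 := by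
    simp only [isUnit_zmod_iff]
    symm
    apply Finset.sum_subset (Finset.filter_subset_filter _ hsub)
    intro y hy hy2
    have hy' := Finset.mem_filter.mp hy
    have hy3 := Finset.mem_Icc.mp hy'.1
    have : U < y := by
      by_contra h
      exact hy2 (Finset.mem_filter.mpr ⟨Finset.mem_Icc.mpr ⟨hy3.1, by omega⟩, hy'.2⟩)
    have h4 : ⌊Y⌋ - A0 + 1 + 1 ≤ y := by
      have h40 := hy3.2
      rcases min_lt_iff.mp (hU ▸ this : min V (⌊Y⌋ - A0 + 1) < y) with h | h <;> omega
    have h5 : (⌊Y⌋:ℝ) - A0 + 1 + 1 ≤ y := by exact_mod_cast h4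
    apply max_eq_right
    have h6 := Int.lt_floor_add_one Y
    have h7 := Int.ceil_lt_add_one (κ * m)
    linarith
  rw [e2]
  have h3 : |(1/(m:ℝ)) * ∑ y ∈ (Icc L U).filter (fun y : ℤ => IsUnit (y : ZMod m)), (((⌊Y⌋:ℤ):ℝ) - y - A0 + 1) -
      (1/(m:ℝ)) * ∑ y ∈ (Icc L U).filter (fun y : ℤ => IsUnit (y : ZMod m)), max (Y - κ * m - y) 0| ≤ 2 := by
    rw [← mul_sub, ← Finset.sum_sub_distrib, abs_mul, abs_of_pos (by positivity : (0:ℝ) < 1/m)]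
    have : |∑ y ∈ (Icc L U).filter (fun y : ℤ => IsUnit (y : ZMod m)), ((((⌊Y⌋:ℤ):ℝ) - y - A0 + 1) - max (Y - κ * m - y) 0)| ≤ 2 * m := by
      refine (Finset.abs_sum_le_sum_abs _ _).trans ?_
      calc _ ≤ ∑ y ∈ (Icc L U).filter (fun y : ℤ => IsUnit (y : ZMod m)), (1:ℝ) := by
            apply Finset.sum_le_sum
            intro y hy
            have hy3 := Finset.mem_Icc.mp (Finset.mem_filter.mp hy).1
            have h4 : y ≤ ⌊Y⌋ - A0 + 1 := hy3.2.trans (min_le_right _ _)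
            have h5 : (y:ℝ) ≤ ⌊Y⌋ - A0 + 1 := by exact_mod_cast h4
            have h6 := Int.lt_floor_add_one Y
            have h7 := Int.ceil_lt_add_one (κ * m)
            have h8 := Int.floor_le Y
            have h9 := Int.le_ceil (κ * m)
            rw [abs_le]
            rcases max_cases (Y - κ * m - y) 0 with ⟨h, _⟩ | ⟨h, _⟩ <;> rw [h] <;> constructor <;> linarith
        _ = (((Icc L U).filter (fun y : ℤ => IsUnit (y : ZMod m))).card : ℝ) := by simp
        _ ≤ 2 * m := by
            refine le_trans ?_ hlenV
            exact_mod_cast Finset.card_le_card ((Finset.filter_subset _ _).trans hsub)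
    calc _ ≤ 1/(m:ℝ) * (2 * m) := mul_le_mul_of_nonneg_left this (by positivity)
      _ = 2 := by field_simp
  refine (abs_sub_le _ _ _).trans (add_le_add hmain h3)

lemma Gsum_est (κ u₁ u₂ : ℝ) (hu1 : 0 ≤ u₁) (hu2 : 0 ≤ u₂) (hu1' : u₁ ≤ 1/2) (hu2' : u₂ ≤ 1/2)
    (k l : ℕ) (a b : ℤ) (c : ∀ m : ℕ, (ZMod m)ˣ)
    (H4 : ∀ m y : ℤ, m ≡ a [ZMOD k] → Int.gcd y m = 1 → y ≡ b [ZMOD l]) (M : ℕ) (Y : ℝ) :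
    |((∑ m ∈ (Icc 1 M).filter (fun m : ℕ => (m:ℤ) ≡ a [ZMOD k]), Gc κ u₁ u₂ m (c m) Y : ℕ) : ℝ) - Msum κ u₁ u₂ k l a b M Y|
      ≤ ∑ m ∈ Icc 1 M, (6 * Ew m + 2) := by
  have hE : ∀ m : ℕ, 1 ≤ m → 0 ≤ 6 * Ew m + 2 := by
    intro m hm
    haveI : NeZero m := ⟨by omega⟩
    exact (abs_nonneg _).trans (Gc_est κ u₁ u₂ hu1 hu2 hu1' hu2' m (c m) Y)
  unfold Msum
  push_cast
  rw [← Finset.sum_sub_distrib]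
  refine (Finset.abs_sum_le_sum_abs _ _).trans ?_
  calc _ ≤ ∑ m ∈ (Icc 1 M).filter (fun m : ℕ => (m:ℤ) ≡ a [ZMOD k]), (6 * Ew m + 2) := by
        apply Finset.sum_le_sum
        intro m hm
        simp only [mem_filter, mem_Icc] at hm
        haveI : NeZero m := ⟨by omega⟩
        have e : (Icc ⌈-(u₁ * m)⌉ ⌊u₂ * m⌋).filter (fun y : ℤ => y ≡ b [ZMOD l] ∧ Int.gcd y m = 1) =
          (Icc ⌈-(u₁ * m)⌉ ⌊u₂ * m⌋).filter (fun y : ℤ => Int.gcd y m = 1) := by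
          apply Finset.filter_congr
          intro y _
          exact ⟨fun h => h.2, fun h => ⟨H4 m y hm.2 h, h⟩⟩
        rw [e]
        exact Gc_est κ u₁ u₂ hu1 hu2 hu1' hu2' m (c m) Y
    _ ≤ _ := by
        apply Finset.sum_le_sum_of_subset_of_nonneg (Finset.filter_subset _ _)
        intro m hm _
        exact hE m (Finset.mem_Icc.mp hm).1

end

section
open Finset

/-- congruence condition on `(p, r, s)` -/
def P3 (p r s : ℤ) : Prop := (Even r ∧ 2 * r ∣ p * s - 1) ∨ (Odd r ∧ Even p ∧ Even s ∧ r ∣ p * s - 1)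

/-- the approximate counting set -/
def Bset (α β₁ β₂ X : ℝ) : Set (ℤ × ℤ × ℤ) :=
  {t | 0 < t.2.1 ∧ α * t.2.1 ≤ t.1 ∧ -(t.2.1:ℝ) ≤ β₁ * t.2.2 ∧ β₂ * t.2.2 ≤ t.2.1 ∧ (t.1:ℝ) + t.2.2 ≤ X ∧
    P3 t.1 t.2.1 t.2.2}

/-- residue `1/4` for odd modulus -/
def cJ (m : ℕ) : (ZMod m)ˣ := if h : Nat.Coprime 4 m then (ZMod.unitOfCoprime 4 h)⁻¹ else 1

lemma cJ_iff (m : ℕ) (h : Odd m) (z : ZMod m) : z = (cJ m : ZMod m) ↔ 4 * z = 1 := by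
  have h4 : Nat.Coprime 4 m := by
    have : Nat.Coprime 2 m := (Nat.coprime_two_left).mpr h
    exact Nat.Coprime.pow_left 2 this
  unfold cJ
  rw [dif_pos h4]
  have e : ((ZMod.unitOfCoprime 4 h4 : (ZMod m)ˣ) : ZMod m) = 4 := by
    rw [ZMod.coe_unitOfCoprime]; norm_num
  rw [← e]
  constructor
  · rintro rfl; simp
  · intro hz
    calc z = ((ZMod.unitOfCoprime 4 h4)⁻¹ : (ZMod m)ˣ) * (((ZMod.unitOfCoprime 4 h4 : (ZMod m)ˣ) : ZMod m) * z) := by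
          rw [← mul_assoc, Units.inv_mul, one_mul]
      _ = _ := by rw [hz, mul_one]

lemma card_GcSum (κ u₁ u₂ : ℝ) (k : ℕ) (a : ℤ) (c : ∀ m : ℕ, (ZMod m)ˣ) (M : ℕ) (Y : ℝ) :
    (((Icc 1 M).filter (fun m : ℕ => (m:ℤ) ≡ a [ZMOD k])).sigma (fun m => (Icc ⌈-(u₁ * m)⌉ ⌊u₂ * m⌋).sigma
      (fun y => (Icc ⌈κ * m⌉ (⌊Y⌋ - y)).filter (fun x : ℤ => (x : ZMod m) * (y : ZMod m) = c m)))).card =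
    ∑ m ∈ (Icc 1 M).filter (fun m : ℕ => (m:ℤ) ≡ a [ZMOD k]), Gc κ u₁ u₂ m (c m) Y := by
  unfold Gc
  rw [Finset.card_sigma]
  refine Finset.sum_congr rfl fun m _ => ?_
  rw [Finset.card_sigma]

/-- even part parametrization -/
def fI (t : Σ _ : ℕ, Σ _ : ℤ, ℤ) : ℤ × ℤ × ℤ := (t.2.2, (t.1:ℤ) / 2, t.2.1)
/-- odd part parametrization -/
def fJ (t : Σ _ : ℕ, Σ _ : ℤ, ℤ) : ℤ × ℤ × ℤ := (2 * t.2.2, (t.1:ℤ), 2 * t.2.1)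

lemma Bset_eq (α β₁ β₂ : ℝ) (hα : 1 ≤ α) (hβ₁ : 1 ≤ β₁) (hβ₂ : 1 ≤ β₂) (hκ : 1/(2*β₁) < α/2) (X : ℝ) (M : ℕ)
    (hX : 0 < X) (hM : X ≤ (α/2 - 1/(2*β₁)) * M) :
    (Bset α β₁ β₂ X).Finite ∧ (Bset α β₁ β₂ X).ncard =
      ∑ m ∈ (Icc 1 M).filter (fun m : ℕ => (m:ℤ) ≡ 0 [ZMOD (4:ℕ)]), Gc (α/2) (1/(2*β₁)) (1/(2*β₂)) m ((fun m => (1 : (ZMod m)ˣ)) m) X +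
      ∑ m ∈ (Icc 1 M).filter (fun m : ℕ => (m:ℤ) ≡ 1 [ZMOD (2:ℕ)]), Gc (α/2) (1/(2*β₁)) (1/(2*β₂)) m (cJ m) (X/2) := by
  have hb1 : (0:ℝ) < β₁ := by linarith
  have hb2 : (0:ℝ) < β₂ := by linarith
  rw [← card_GcSum, ← card_GcSum]
  set FI := (((Icc 1 M).filter (fun m : ℕ => (m:ℤ) ≡ 0 [ZMOD (4:ℕ)])).sigma (fun m => (Icc ⌈-((1/(2*β₁)) * m)⌉ ⌊(1/(2*β₂)) * m⌋).sigma
      (fun y => (Icc ⌈(α/2) * m⌉ (⌊X⌋ - y)).filter (fun x : ℤ => (x : ZMod m) * (y : ZMod m) = ((fun m => (1 : (ZMod m)ˣ)) m : (ZMod m)ˣ))))) with hFI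
  set FJ := (((Icc 1 M).filter (fun m : ℕ => (m:ℤ) ≡ 1 [ZMOD (2:ℕ)])).sigma (fun m => (Icc ⌈-((1/(2*β₁)) * m)⌉ ⌊(1/(2*β₂)) * m⌋).sigma
      (fun y => (Icc ⌈(α/2) * m⌉ (⌊X/2⌋ - y)).filter (fun x : ℤ => (x : ZMod m) * (y : ZMod m) = cJ m)))) with hFJ
  have mI : ∀ (m : ℕ) (y x : ℤ), (⟨m, y, x⟩ : Σ _ : ℕ, Σ _ : ℤ, ℤ) ∈ FI ↔ ((1 ≤ m ∧ m ≤ M) ∧ (4:ℤ) ∣ m) ∧ (-(m:ℝ) ≤ β₁ * (2 * y) ∧ β₂ * (2 * y) ≤ m) ∧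
      (α * m ≤ 2 * x ∧ (x:ℝ) + y ≤ X) ∧ (m:ℤ) ∣ x * y - 1 := by
    intro m y x
    rw [hFI]
    simp only [mem_sigma, mem_filter, mem_Icc, Int.ceil_le, Int.le_floor, le_sub_iff_add_le, Units.val_one]
    refine and_congr (and_congr Iff.rfl ?_) (and_congr (and_congr ?_ ?_) (and_congr (and_congr ?_ ?_) ?_))
    · rw [Int.modEq_zero_iff_dvd]; norm_num
    · rw [neg_le, neg_le, one_div, inv_mul_eq_div, ← neg_le, le_div_iff₀ (by positivity), neg_le]
      constructor <;> intro h <;> linarith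
    · rw [one_div, inv_mul_eq_div, le_div_iff₀ (by positivity)]
      constructor <;> intro h <;> linarith
    · constructor <;> intro h <;> linarith
    · push_cast; rfl
    · rw [← ZMod.intCast_zmod_eq_zero_iff_dvd]
      push_cast
      rw [sub_eq_zero]
  have mJ : ∀ (m : ℕ) (y x : ℤ), (⟨m, y, x⟩ : Σ _ : ℕ, Σ _ : ℤ, ℤ) ∈ FJ ↔ ((1 ≤ m ∧ m ≤ M) ∧ Odd (m:ℤ)) ∧ (-(m:ℝ) ≤ β₁ * (2 * y) ∧ β₂ * (2 * y) ≤ m) ∧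
      (α * m ≤ 2 * x ∧ (x:ℝ) + y ≤ X / 2) ∧ (m:ℤ) ∣ (2 * x) * (2 * y) - 1 := by
    intro m y x
    rw [hFJ]
    simp only [mem_sigma, mem_filter, mem_Icc, Int.ceil_le, Int.le_floor, le_sub_iff_add_le]
    have hodd : (m:ℤ) ≡ 1 [ZMOD (2:ℕ)] ↔ Odd (m:ℤ) := by
      rw [Int.odd_iff]; rfl
    rw [hodd]
    refine and_congr_right fun hm => (and_congr (and_congr ?_ ?_) (and_congr (and_congr ?_ ?_) ?_))
    · rw [neg_le, neg_le, one_div, inv_mul_eq_div, ← neg_le, le_div_iff₀ (by positivity), neg_le]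
      constructor <;> intro h <;> linarith
    · rw [one_div, inv_mul_eq_div, le_div_iff₀ (by positivity)]
      constructor <;> intro h <;> linarith
    · constructor <;> intro h <;> linarith
    · push_cast; rfl
    · rw [cJ_iff m (by exact_mod_cast hm.2), ← ZMod.intCast_zmod_eq_zero_iff_dvd]
      push_cast
      rw [sub_eq_zero]
      ring_nf
  have injI : Set.InjOn fI (FI : Set (Σ _ : ℕ, Σ _ : ℤ, ℤ)) := by
    rintro ⟨m, y, x⟩ h ⟨m', y', x'⟩ h' heq
    rw [Finset.mem_coe, mI] at h h'
    simp only [fI, Prod.mk.injEq] at heq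
    obtain ⟨rfl, h2, rfl⟩ := heq
    have h3 := h.1.2
    have h4 := h'.1.2
    have : m = m' := by omega
    subst this
    rfl
  have injJ : Set.InjOn fJ (FJ : Set (Σ _ : ℕ, Σ _ : ℤ, ℤ)) := by
    rintro ⟨m, y, x⟩ h ⟨m', y', x'⟩ h' heq
    simp only [fJ, Prod.mk.injEq] at heq
    obtain ⟨h1, h2, h3⟩ := heq
    have e1 : m = m' := by omega
    have e2 : x = x' := by omega
    have e3 : y = y' := by omega
    subst e1 e2 e3
    rfl
  have hdis : Disjoint (FI.image fI) (FJ.image fJ) := by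
    rw [Finset.disjoint_left]
    intro t h1 h2
    rw [Finset.mem_image] at h1 h2
    obtain ⟨⟨m, y, x⟩, ha, rfl⟩ := h1
    obtain ⟨⟨m', y', x'⟩, hb, hc⟩ := h2
    rw [mI] at ha
    rw [mJ] at hb
    simp only [fI, fJ, Prod.mk.injEq] at hc
    have h3 := ha.1.2
    have h4 := hb.1.2
    rw [Int.odd_iff] at h4
    omega
  have hB : Bset α β₁ β₂ X = ((FI.image fI ∪ FJ.image fJ : Finset (ℤ × ℤ × ℤ)) : Set (ℤ × ℤ × ℤ)) := by
    ext ⟨p, r, s⟩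
    rw [Finset.mem_coe, Finset.mem_union, Finset.mem_image, Finset.mem_image]
    simp only [Bset, Set.mem_setOf_eq]
    constructor
    · rintro ⟨hr, h1, h2, h3, h4, h5⟩
      have hr0 : (0:ℝ) < r := by exact_mod_cast hr
      have hq : (α/2 - 1/(2*β₁)) * (2 * r) ≤ X := by
        have : -(r:ℝ) / β₁ ≤ s := by rw [div_le_iff₀ hb1]; linarith
        have e : (α/2 - 1/(2*β₁)) * (2 * r) = α * r + -(r:ℝ)/β₁ := by field_simp; ring
        rw [e]; linarith
      have hq2 : (2 * r : ℝ) ≤ M := le_of_mul_le_mul_left (hq.trans hM) (by linarith)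
      have hq3 : 2 * r ≤ (M:ℤ) := by exact_mod_cast hq2
      rcases h5 with ⟨⟨r', hr'⟩, hd⟩ | ⟨ho, ⟨p', hp'⟩, ⟨s', hs'⟩, hd⟩
      · left
        have em : (((2 * r).toNat : ℤ)) = 2 * r := Int.toNat_of_nonneg (by omega)
        have em2 : (((2 * r).toNat : ℝ)) = 2 * r := by exact_mod_cast em
        refine ⟨⟨(2 * r).toNat, s, p⟩, ?_, ?_⟩
        · rw [mI, em, em2]
          refine ⟨⟨⟨by omega, by omega⟩, by omega⟩, ⟨by linarith, by linarith⟩, ⟨by linarith, by linarith⟩, hd⟩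
        · simp only [fI, Prod.mk.injEq, em]
          refine ⟨trivial, by omega, trivial⟩
      · right
        have em : ((r.toNat : ℤ)) = r := Int.toNat_of_nonneg (by omega)
        have em2 : ((r.toNat : ℝ)) = r := by exact_mod_cast em
        have p2 : p = 2 * p' := by omega
        have s2 : s = 2 * s' := by omega
        subst p2 s2
        push_cast at h1 h2 h3 h4
        refine ⟨⟨r.toNat, s', p'⟩, ?_, ?_⟩
        · rw [mJ, em, em2]
          refine ⟨⟨⟨by omega, by omega⟩, ho⟩, ⟨by linarith, by linarith⟩, ⟨by linarith, by linarith⟩, hd⟩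
        · simp only [fJ, Prod.mk.injEq, em, and_self]
    · rintro (⟨⟨m, y, x⟩, ha, hc⟩ | ⟨⟨m, y, x⟩, ha, hc⟩)
      · rw [mI] at ha
        obtain ⟨⟨⟨h1, h2⟩, ⟨r', h3⟩⟩, ⟨h4, h5⟩, ⟨h6, h7⟩, h8⟩ := ha
        simp only [fI, Prod.mk.injEq] at hc
        obtain ⟨rfl, hr, rfl⟩ := hc
        have er : r = 2 * r' := by omega
        have em : (m:ℝ) = 2 * r := by
          have : (m:ℤ) = 2 * r := by omega
          exact_mod_cast this
        rw [em] at h4 h5 h6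
        refine ⟨by omega, by linarith, by linarith, by linarith, h7, Or.inl ⟨⟨r', by omega⟩, ?_⟩⟩
        rwa [show 2 * r = (m:ℤ) by omega]
      · rw [mJ] at ha
        obtain ⟨⟨⟨h1, h2⟩, h3⟩, ⟨h4, h5⟩, ⟨h6, h7⟩, h8⟩ := ha
        simp only [fJ, Prod.mk.injEq] at hc
        obtain ⟨rfl, rfl, rfl⟩ := hc
        push_cast
        refine ⟨by omega, by linarith, by linarith, by linarith, by linarith, Or.inr ⟨h3, ⟨x, by ring⟩, ⟨y, by ring⟩, h8⟩⟩
  rw [hB]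
  refine ⟨Finset.finite_toSet _, ?_⟩
  rw [Set.ncard_coe_finset, Finset.card_union_of_disjoint hdis, Finset.card_image_of_injOn injI, Finset.card_image_of_injOn injJ]

end

section
open Finset

lemma odd_mul_mod4 (d : ℕ) (hd : Odd d) (m : ℤ) : (d * m ≡ 0 [ZMOD (4:ℕ)] ↔ m ≡ 0 [ZMOD (4:ℕ)]) := by
  rw [Int.modEq_zero_iff_dvd, Int.modEq_zero_iff_dvd]
  have : IsCoprime ((4:ℕ):ℤ) (d:ℤ) := by
    rw [Nat.isCoprime_iff_coprime]
    exact Nat.Coprime.pow_left 2 ((Nat.coprime_two_left).mpr hd)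
  exact ⟨fun h => this.dvd_of_dvd_mul_left h, fun h => Dvd.dvd.mul_left h _⟩

lemma odd_mul_mod2 (d : ℕ) (hd : Odd d) (m : ℤ) : (d * m ≡ 1 [ZMOD (2:ℕ)] ↔ m ≡ 1 [ZMOD (2:ℕ)]) := by
  have h : ∀ z : ℤ, z ≡ 1 [ZMOD (2:ℕ)] ↔ Odd z := fun z => by rw [Int.odd_iff]; rfl
  rw [h, h, Int.odd_mul]
  have : Odd (d:ℤ) := by exact_mod_cast hd
  tauto

set_option maxHeartbeats 800000 in
lemma B_asymp (α β₁ β₂ : ℝ) (hα : 1 ≤ α) (hβ₁ : 1 ≤ β₁) (hβ₂ : 1 ≤ β₂) (hκ : 1/(2*β₁) < α/2) (ε : ℝ) (hε : 0 < ε) :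
    ∃ K, 0 ≤ K ∧ ∀ X : ℝ, 2 ≤ X → (Bset α β₁ β₂ X).Finite ∧ |((Bset α β₁ β₂ X).ncard : ℝ) -
      X^2 / Real.pi^2 * Real.log ((α/2 + 1/(2*β₂))/(α/2 - 1/(2*β₁)))| ≤ K * X^(3/2+ε) := by
  obtain ⟨C, hC0, hC⟩ := sum_Ew_le ε hε
  have hb1 : (0:ℝ) < β₁ := by linarith
  have hb2 : (0:ℝ) < β₂ := by linarith
  set u₁ := 1/(2*β₁) with hu1
  set u₂ := 1/(2*β₂) with hu2
  set κ := α/2 with hk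
  have hu1p : 0 ≤ u₁ := by positivity
  have hu2p : 0 ≤ u₂ := by positivity
  have hu1' : u₁ ≤ 1/2 := by
    rw [hu1]; apply one_div_le_one_div_of_le <;> linarith
  have hu2' : u₂ ≤ 1/2 := by
    rw [hu2]; apply one_div_le_one_div_of_le <;> linarith
  set W := Real.log ((κ + u₂)/(κ - u₁)) with hW
  set θ := κ - u₁ with hθ
  have hθ0 : 0 < θ := by linarith
  have hW0 : 0 ≤ W := by
    apply Real.log_nonneg
    rw [le_div_iff₀ (by linarith)]; linarith
  set c := 1/θ + 1 with hc
  have hc1 : 1 ≤ c := by rw [hc]; have : 0 < 1/θ := by positivity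
                         linarith
  refine ⟨(2*(6*C+2) + 50*(3 + θ*W)) * c^(3/2+ε), by positivity, fun X hX => ?_⟩
  set M := ⌈X/θ⌉₊ with hMdef
  have hX0 : 0 < X := by linarith
  have hM : X ≤ θ * M := by
    have := Nat.le_ceil (X/θ)
    rw [div_le_iff₀ hθ0] at this
    linarith
  have hM1 : 1 ≤ M := Nat.ceil_pos.mpr (by positivity)
  have hM1' : (1:ℝ) ≤ M := by exact_mod_cast hM1
  have hMc : (M:ℝ) ≤ c * X := by
    have := (Nat.ceil_lt_add_one (by positivity : 0 ≤ X/θ)).le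
    have e : c * X = X/θ + X := by rw [hc]; field_simp
    rw [e]; linarith
  obtain ⟨hfin, hcard⟩ := Bset_eq α β₁ β₂ hα hβ₁ hβ₂ hκ X M hX0 hM
  refine ⟨hfin, ?_⟩
  have g1 := Gsum_est κ u₁ u₂ hu1p hu2p hu1' hu2' 4 2 0 1 (fun m => (1 : (ZMod m)ˣ)) (by
    intro m y hm hy
    have hm' : (4:ℤ) ∣ m := by
      have := Int.modEq_zero_iff_dvd.mp hm
      exact_mod_cast this
    have : Odd y := by
      by_contra h
      rw [Int.not_odd_iff_even] at h
      have h2 : (2:ℤ) ∣ (Int.gcd y m : ℤ) := Int.dvd_coe_gcd h.two_dvd (Dvd.dvd.trans (by norm_num) hm')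
      rw [hy] at h2
      norm_num at h2
    rw [Int.odd_iff] at this
    exact this) M X
  have g2 := Gsum_est κ u₁ u₂ hu1p hu2p hu1' hu2' 2 1 1 0 cJ (by
    intro m y _ _
    exact Int.modEq_one) M (X/2)
  have m1 := Msum_est κ u₁ u₂ hu1p hu2p hu1' hu2' hκ 4 2 (by norm_num) (by norm_num) 0 1 M X hX0 hM
    odd_mul_mod4 odd_mul_mod2 (by
      intro m y _ hy
      have hy' : Odd y := by rw [Int.odd_iff]; exact hy
      have h2 := Int.gcd_dvd_left y m
      have h3 : Odd ((Int.gcd y m : ℕ) : ℤ) := by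
        obtain ⟨z, hz⟩ := h2
        rw [hz] at hy'
        exact (Int.odd_mul.mp hy').1
      exact_mod_cast h3)
  have m2 := Msum_est κ u₁ u₂ hu1p hu2p hu1' hu2' hκ 2 1 (by norm_num) (by norm_num) 1 0 M (X/2) (by linarith) (by linarith)
    odd_mul_mod2 (fun d _ m => ⟨fun _ => Int.modEq_one, fun _ => Int.modEq_one⟩) (by
      intro m y hm _
      have hy' : Odd m := by rw [Int.odd_iff]; exact hm
      have h2 := Int.gcd_dvd_right y m
      have h3 : Odd ((Int.gcd y m : ℕ) : ℤ) := by
        obtain ⟨z, hz⟩ := h2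
        rw [hz] at hy'
        exact (Int.odd_mul.mp hy').1
      exact_mod_cast h3)
  rw [← hW] at m1 m2
  rw [hcard]
  set S1 := ∑ m ∈ (Icc 1 M).filter (fun m : ℕ => (m:ℤ) ≡ 0 [ZMOD (4:ℕ)]), Gc κ u₁ u₂ m ((fun m => (1 : (ZMod m)ˣ)) m) X
  set S2 := ∑ m ∈ (Icc 1 M).filter (fun m : ℕ => (m:ℤ) ≡ 1 [ZMOD (2:ℕ)]), Gc κ u₁ u₂ m (cJ m) (X/2)
  set E := ∑ m ∈ Icc 1 M, (6 * Ew m + 2) with hE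
  have hEle : E ≤ (6*C+2) * (c*X)^(3/2+ε) := by
    rw [hE, Finset.sum_add_distrib, ← Finset.mul_sum]
    simp only [sum_const, Nat.card_Icc, nsmul_eq_mul]
    have h1 := hC M hM1
    have h2 : (M:ℝ) ≤ (M:ℝ)^(3/2+ε) := by
      calc (M:ℝ) = (M:ℝ)^(1:ℝ) := (Real.rpow_one _).symm
        _ ≤ _ := Real.rpow_le_rpow_of_exponent_le hM1' (by linarith)
    have h3 : (M:ℝ)^(3/2+ε) ≤ (c*X)^(3/2+ε) := Real.rpow_le_rpow (by linarith) hMc (by linarith)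
    have e : ((M + 1 - 1 : ℕ) : ℝ) = M := by norm_num
    rw [e]
    calc 6 * ∑ m ∈ Icc 1 M, Ew m + M * 2 ≤ (6*C+2) * (M:ℝ)^(3/2+ε) := by linarith
      _ ≤ _ := mul_le_mul_of_nonneg_left h3 (by positivity)
  have hL : X * (1 + Real.log M)^2 ≤ 25 * (c*X)^(3/2+ε) := by
    have h1 := log_bound (1/4) (by norm_num) M hM1'
    have h0 : 0 ≤ 1 + Real.log M := by have := Real.log_nonneg hM1'; linarith
    have hcX : 1 ≤ c * X := by
      have := mul_le_mul hc1 (by linarith : (1:ℝ) ≤ X) (by norm_num) (by linarith)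
      linarith
    have h2 : (1 + Real.log M)^2 ≤ ((1 + 1/(1/4)) * (M:ℝ)^(1/4:ℝ))^2 := pow_le_pow_left₀ h0 h1 2
    have h3 : ((M:ℝ)^(1/4:ℝ))^2 = (M:ℝ)^(1/2:ℝ) := by
      rw [← Real.rpow_natCast, ← Real.rpow_mul (by linarith)]; norm_num
    rw [mul_pow, h3] at h2
    have h4 : (M:ℝ)^(1/2:ℝ) ≤ (c*X)^(1/2:ℝ) := Real.rpow_le_rpow (by linarith) hMc (by norm_num)
    have h5 : X ≤ c * X := le_mul_of_one_le_left hX0.le hc1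
    calc X * (1 + Real.log M)^2 ≤ (c * X) * (25 * (c*X)^(1/2:ℝ)) := by
          apply mul_le_mul h5 _ (by positivity) (by linarith)
          refine h2.trans ?_
          norm_num
          norm_num at h4
          linarith
      _ = 25 * ((c*X)^(1:ℝ) * (c*X)^(1/2:ℝ)) := by rw [Real.rpow_one]; ring
      _ = 25 * (c*X)^(3/2:ℝ) := by rw [← Real.rpow_add (by linarith)]; norm_num
      _ ≤ _ := by
          apply mul_le_mul_of_nonneg_left _ (by norm_num)
          exact Real.rpow_le_rpow_of_exponent_le hcX (by linarith)
  have hmul : (c*X)^(3/2+ε) = c^(3/2+ε) * X^(3/2+ε) := Real.mul_rpow (by linarith) hX0.le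
  have hsplit : X^2/Real.pi^2 * W = 8 / Real.pi^2 * (X^2/(2*(4:ℕ)*(2:ℕ)) * W) + 8 / Real.pi^2 * ((X/2)^2/(2*(2:ℕ)*(1:ℕ)) * W) := by
    push_cast
    ring
  have hθW : 0 ≤ 3 + θ * W := by positivity
  have hX2 : (3 + θ*W) * (X/2) * (1 + Real.log M)^2 ≤ (3 + θ*W) * X * (1 + Real.log M)^2 := by
    apply mul_le_mul_of_nonneg_right _ (by positivity)
    apply mul_le_mul_of_nonneg_left _ hθW
    linarith
  have hfinal : (3 + θ*W) * X * (1 + Real.log M)^2 ≤ (3 + θ*W) * (25 * (c*X)^(3/2+ε)) := by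
    rw [mul_assoc]; exact mul_le_mul_of_nonneg_left hL hθW
  rw [hsplit]
  push_cast
  rw [mul_assoc (2 * (6 * C + 2) + 50 * (3 + θ * W)), ← hmul]
  rw [← hθ] at m1 m2
  push_cast at g1 g2 m1 m2
  rw [abs_le] at g1 g2 m1 m2 ⊢
  obtain ⟨g11, g12⟩ := g1
  obtain ⟨g21, g22⟩ := g2
  obtain ⟨m11, m12⟩ := m1
  obtain ⟨m21, m22⟩ := m2
  constructor <;> linarith

end

section
open Finset

lemma eE_cases (u : ℝ) : eE u = 1 ∨ eE u = -1 := by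
  unfold eE; split_ifs <;> simp

lemma eE_sq (u : ℝ) : eE u * eE u = 1 := by
  rcases eE_cases u with h | h <;> rw [h] <;> norm_num

lemma aE_even (u : ℝ) : Even (aE u) := ⟨⌊(u + 1) / 2⌋, by unfold aE; ring⟩

lemma aE_bounds (u : ℝ) (hu : Irrational u) : (aE u : ℝ) - 1 < u ∧ u < aE u + 1 := by
  have h1 := Int.floor_le ((u+1)/2)
  have h2 := Int.lt_floor_add_one ((u+1)/2)
  have e : (aE u : ℝ) = 2 * (⌊(u+1)/2⌋ : ℝ) := by unfold aE; push_cast; ring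
  refine ⟨lt_of_le_of_ne (by linarith) ?_, by linarith⟩
  have := hu.ne_int (aE u - 1)
  push_cast at this
  exact fun h => this h.symm

lemma aE_ge (u : ℝ) (h1 : 1 < u) : 2 ≤ aE u := by
  unfold aE
  have : 1 ≤ ⌊(u+1)/2⌋ := by rw [Int.le_floor]; push_cast; linarith
  omega

lemma TE_abs (u : ℝ) : TE u = 1 / |u - aE u| := by
  unfold TE eE
  split_ifs with h
  · rw [abs_of_pos (by linarith)]; simp
  · rw [abs_of_nonpos (by linarith)]; push_cast; rw [← neg_div_neg_eq, neg_neg]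

lemma TE_gt (u : ℝ) (hu : Irrational u) : 1 < TE u := by
  rw [TE_abs]
  have hne : u - aE u ≠ 0 := sub_ne_zero.mpr (hu.ne_int _)
  have := aE_bounds u hu
  rw [lt_div_iff₀ (abs_pos.mpr hne), one_mul, abs_lt]
  constructor <;> linarith

lemma TE_rel (u : ℝ) (hu : Irrational u) : (aE u : ℝ) * TE u + eE u = TE u * u := by
  have hne : u - aE u ≠ 0 := sub_ne_zero.mpr (hu.ne_int _)
  unfold TE
  field_simp
  ring

lemma TE_irr (u : ℝ) (hu : Irrational u) : Irrational (TE u) := by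
  have h : Irrational (u - aE u) := by
    simpa using hu.sub_intCast (aE u)
  unfold TE
  have he : (eE u) ≠ 0 := by rcases eE_cases u with h | h <;> rw [h] <;> norm_num
  exact h.intCast_div he

lemma TE_iter (u : ℝ) (hu : Irrational u) (h1 : 1 < u) (n : ℕ) : Irrational (TE^[n] u) ∧ 1 < TE^[n] u := by
  induction n with
  | zero => exact ⟨hu, h1⟩
  | succ n ih => rw [Function.iterate_succ_apply']; exact ⟨TE_irr _ ih.1, TE_gt _ ih.1⟩

/-- product of the first `n` digit matrices -/
def Pm (u : ℝ) (n : ℕ) : Matrix (Fin 2) (Fin 2) ℤ :=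
  ((List.range n).map (fun i => Mmat (aE (TE^[i] u)) (eE (TE^[i] u)))).prod

lemma Pm_zero (u : ℝ) : Pm u 0 = 1 := by simp [Pm]

lemma Pm_succ (u : ℝ) (n : ℕ) : Pm u (n+1) = Mmat (aE u) (eE u) * Pm (TE u) n := by
  unfold Pm
  rw [List.range_succ_eq_map, List.map_cons, List.prod_cons, List.map_map]
  rfl

lemma Pm_add (u : ℝ) (m n : ℕ) : Pm u (m+n) = Pm u m * Pm (TE^[m] u) n := by
  induction m generalizing u with
  | zero => simp [Pm_zero]
  | succ m ih =>
    rw [show m + 1 + n = (m + n) + 1 by ring, Pm_succ, ih, Pm_succ, Function.iterate_succ_apply, Matrix.mul_assoc]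

lemma Pm_mul (u : ℝ) (n : ℕ) (h : TE^[n] u = u) (k : ℕ) : Pm u (n * k) = Pm u n ^ k ∧ TE^[n*k] u = u := by
  induction k with
  | zero => simp [Pm_zero]
  | succ k ih =>
    rw [show n * (k+1) = n * k + n by ring, Pm_add, ih.1, ih.2, pow_succ]
    refine ⟨rfl, ?_⟩
    rw [Function.iterate_add_apply, h, ih.2]

/-- congruent to `I` or `J` mod 2 -/
def Par (A : Matrix (Fin 2) (Fin 2) ℤ) : Prop := Odd (A 0 0 + A 1 0) ∧ Even (A 0 0 + A 1 1) ∧ Even (A 0 1 + A 1 0)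

lemma Par_mul (A B : Matrix (Fin 2) (Fin 2) ℤ) (hA : Par A) (hB : Par B) : Par (A * B) := by
  unfold Par at *
  simp only [Matrix.mul_apply, Fin.sum_univ_two]
  obtain ⟨a1, a2, a3⟩ := hA
  obtain ⟨b1, b2, b3⟩ := hB
  simp only [← Int.not_even_iff_odd, Int.even_add, Int.even_mul] at *
  tauto

lemma Par_one : Par 1 := by
  unfold Par; simp

lemma Par_M (u : ℝ) : Par (Mmat (aE u) (eE u)) := by
  unfold Par Mmat
  have := aE_even u
  rcases eE_cases u with h | h <;> rw [h] <;> simp [this, Int.odd_add]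

lemma det_M (a e : ℤ) : (Mmat a e).det = -e := by simp [Mmat, Matrix.det_fin_two]

lemma Par_Pm (u : ℝ) (n : ℕ) : Par (Pm u n) := by
  induction n generalizing u with
  | zero => rw [Pm_zero]; exact Par_one
  | succ n ih => rw [Pm_succ]; exact Par_mul _ _ (Par_M u) (ih _)

lemma det_Pm (u : ℝ) (n : ℕ) : (Pm u n).det = 1 ∨ (Pm u n).det = -1 := by
  induction n generalizing u with
  | zero => rw [Pm_zero]; simp
  | succ n ih =>
    rw [Pm_succ, Matrix.det_mul, det_M]
    rcases ih (TE u) with h | h <;> rcases eE_cases u with h' | h' <;> rw [h, h'] <;> simp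

/-- `A (v,1)^T = l (u,1)^T` -/
def Act (A : Matrix (Fin 2) (Fin 2) ℤ) (v l u : ℝ) : Prop :=
  (A 0 0 : ℝ) * v + A 0 1 = l * u ∧ (A 1 0 : ℝ) * v + A 1 1 = l

lemma Act_mul (A B : Matrix (Fin 2) (Fin 2) ℤ) (u v w l m : ℝ) (hA : Act A v l u) (hB : Act B w m v) :
    Act (A * B) w (l * m) u := by
  unfold Act at *
  simp only [Matrix.mul_apply, Fin.sum_univ_two]
  push_cast
  constructor
  · linear_combination (A 0 0 : ℝ) * hB.1 + (A 0 1 : ℝ) * hB.2 + m * hA.1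
  · linear_combination (A 1 0 : ℝ) * hB.1 + (A 1 1 : ℝ) * hB.2 + m * hA.2

lemma Act_one (u : ℝ) : Act 1 u 1 u := by simp [Act]

lemma Act_M (u : ℝ) (hu : Irrational u) : Act (Mmat (aE u) (eE u)) (TE u) (TE u) u := by
  unfold Act Mmat
  simp
  exact TE_rel u hu

lemma Act_pow (A : Matrix (Fin 2) (Fin 2) ℤ) (u l : ℝ) (h : Act A u l u) (k : ℕ) : Act (A^k) u (l^k) u := by
  induction k with
  | zero => simpa using Act_one u
  | succ k ih => rw [pow_succ, pow_succ]; exact Act_mul _ _ _ _ _ _ _ ih h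

lemma Act_Pm (u : ℝ) (hu : Irrational u) (n : ℕ) : ∃ l : ℝ, 1 ≤ l ∧ (0 < n → 1 < l) ∧ Act (Pm u n) (TE^[n] u) l u := by
  induction n generalizing u with
  | zero => exact ⟨1, le_rfl, by simp, by rw [Pm_zero]; exact Act_one u⟩
  | succ n ih =>
    obtain ⟨l, h1, h2, h3⟩ := ih (TE u) (TE_irr u hu)
    have := TE_gt u hu
    refine ⟨TE u * l, by nlinarith, fun _ => by nlinarith, ?_⟩
    rw [Pm_succ, Function.iterate_succ_apply]
    exact Act_mul _ _ _ _ _ _ _ (Act_M u hu) h3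

end

section
open Finset

lemma peel_bound (p q r s a : ℤ) (u v l : ℝ) (hv : 1 < v) (hdet : p * s - q * r = 1 ∨ p * s - q * r = -1)
    (hpar : Odd (p + r)) (hr : 0 < r) (hs : |s| < r) (hl : 0 < l)
    (h1 : (p:ℝ) * v + q = l * u) (h2 : (r:ℝ) * v + s = l) (ha : Even a) (hb : (a:ℝ) - 1 < u ∧ u < a + 1) :
    |p - a * r| < r := by
  rw [abs_lt] at hs
  obtain ⟨a', ha'⟩ := ha
  obtain ⟨w, hw⟩ := hpar
  -- general statement with sign
  have key : ∀ k : ℤ, (p - k * r) < 0 → 0 < u - k → False := by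
    intro k hx hu
    have h3 : 0 < ((p - k * r : ℤ):ℝ) * v + ((q - k * s : ℤ):ℝ) := by
      push_cast
      have : (p - k * r) * v + (q - k * s) = l * (u - k) := by linear_combination h1 - k * h2
      rw [this]; positivity
    have hx' : ((p - k * r : ℤ):ℝ) < 0 := by exact_mod_cast hx
    have h4 : (0:ℝ) < ((p - k * r : ℤ):ℝ) + ((q - k * s : ℤ):ℝ) := by nlinarith
    have h5 : 0 < (p - k * r) + (q - k * s) := by exact_mod_cast h4
    have h6 : (p - k * r) * s - (q - k * s) * r = p * s - q * r := by ring
    have h7 : (p - k * r) * (r + s) ≤ -1 * (r + s) := by nlinarith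
    have h8 : 1 * r ≤ ((p - k * r) + (q - k * s)) * r := mul_le_mul_of_nonneg_right h5 hr.le
    have h9 : p * s - q * r = (p - k * r) * (r + s) - ((p - k * r) + (q - k * s)) * r := by ring
    rcases hdet with h | h <;> rw [h] at h9 <;> linarith
  have key2 : ∀ k : ℤ, 0 < (p - k * r) → u - k < 0 → False := by
    intro k hx hu
    have h3 : ((p - k * r : ℤ):ℝ) * v + ((q - k * s : ℤ):ℝ) < 0 := by
      push_cast
      have : (p - k * r) * v + (q - k * s) = l * (u - k) := by linear_combination h1 - k * h2
      rw [this]; exact mul_neg_of_pos_of_neg hl hu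
    have hx' : 0 < ((p - k * r : ℤ):ℝ) := by exact_mod_cast hx
    have h4 : ((p - k * r : ℤ):ℝ) + ((q - k * s : ℤ):ℝ) < 0 := by nlinarith
    have h5 : (p - k * r) + (q - k * s) < 0 := by exact_mod_cast h4
    have h6 : (p - k * r) * s - (q - k * s) * r = p * s - q * r := by ring
    have h7 : 1 * (r + s) ≤ (p - k * r) * (r + s) := by nlinarith
    have h8 : ((p - k * r) + (q - k * s)) * r ≤ (-1) * r := mul_le_mul_of_nonneg_right (by omega) hr.le
    have h9 : p * s - q * r = (p - k * r) * (r + s) - ((p - k * r) + (q - k * s)) * r := by ring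
    rcases hdet with h | h <;> rw [h] at h9 <;> linarith
  have e1 : ∀ z : ℤ, (z - (a - 1) * r) = (z - a * r) + r := fun z => by ring
  have n1 : p - a * r ≠ r := by
    intro h
    have : p + r = 2 * (r + a' * r) := by rw [ha'] at h; linarith
    omega
  have n2 : p - a * r ≠ -r := by
    intro h
    have : p + r = 2 * (a' * r) := by rw [ha'] at h; linarith
    omega
  rw [abs_lt]
  constructor
  · by_contra h
    refine key (a - 1) ?_ ?_
    · have : p - (a - 1) * r = (p - a * r) + r := by ring
      omega
    · push_cast; linarith [hb.1]
  · by_contra h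
    refine key2 (a + 1) ?_ ?_
    · have : p - (a + 1) * r = (p - a * r) - r := by ring
      omega
    · push_cast; linarith [hb.2]

lemma peel_par (p q r s a e : ℤ) (ha : Even a) (he : ¬ Even e)
    (h : Odd (p + r) ∧ Even (p + s) ∧ Even (q + r)) : Par !![r, s; e * (p - a * r), e * (q - a * s)] := by
  unfold Par
  simp only [Matrix.of_apply, Matrix.cons_val', Matrix.cons_val_zero, Matrix.cons_val_one, Matrix.cons_val_fin_one]
  obtain ⟨a1, a2, a3⟩ := h
  simp only [← Int.not_even_iff_odd, Int.even_add, Int.even_mul, Int.even_sub] at *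
  tauto

set_option maxHeartbeats 1000000 in
lemma peel (N : ℕ) : ∀ (A : Matrix (Fin 2) (Fin 2) ℤ) (u v l : ℝ), Irrational u → 1 < u → 1 < v →
    (A.det = 1 ∨ A.det = -1) → Par A → 0 < A 1 0 → |A 1 1| < A 1 0 → A 1 0 ≤ N → Act A v l u →
    ∃ n, 0 < n ∧ TE^[n] u = v ∧ A = Pm u n := by
  induction N with
  | zero => intro A u v l _ _ _ _ _ h1 _ h2; simp at h2; omega
  | succ N ih =>
    intro A u v l hu hu1 hv1 hdet hpar hr hs hN hact
    obtain ⟨h1, h2⟩ := hact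
    have hr1 : (1:ℝ) ≤ A 1 0 := by exact_mod_cast hr
    have hs' : |(A 1 1 : ℝ)| < A 1 0 := by exact_mod_cast hs
    have hl : 0 < l := by
      rw [← h2]; rw [abs_lt] at hs'; nlinarith [hs'.1]
    set p := A 0 0 with hp
    set q := A 0 1 with hq
    set r := A 1 0 with hrd
    set s := A 1 1 with hsd
    have hdet' : p * s - q * r = 1 ∨ p * s - q * r = -1 := by rwa [Matrix.det_fin_two] at hdet
    set a := aE u with ha
    set e := eE u with he
    have hT := TE_gt u hu
    have hrel := TE_rel u hu
    have hee := eE_sq u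
    rw [← ha, ← he] at hrel
    rw [← he] at hee
    have hbd := peel_bound p q r s a u v l hv1 hdet' hpar.1 hr hs hl h1 h2 (aE_even u) (aE_bounds u hu)
    set B : Matrix (Fin 2) (Fin 2) ℤ := !![r, s; e * (p - a * r), e * (q - a * s)] with hB
    have hAB : A = Mmat a e * B := by
      ext i j
      fin_cases i <;> fin_cases j <;> simp [Mmat, hB, Matrix.mul_apply, Fin.sum_univ_two]
      · linear_combination (-(p - a * r)) * hee
      · linear_combination (-(q - a * s)) * hee
      · rfl
      · rfl
    have hactB : Act B v (l / TE u) (TE u) := by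
      unfold Act
      simp only [hB, Matrix.of_apply, Matrix.cons_val', Matrix.cons_val_zero, Matrix.cons_val_one, Matrix.cons_val_fin_one]
      have heer : (e:ℝ) * e = 1 := by exact_mod_cast hee
      constructor
      · rw [h2]; field_simp
      · push_cast
        rw [eq_div_iff (by linarith)]
        linear_combination (e:ℝ) * (TE u) * h1 - (e:ℝ) * a * TE u * h2 - l * e * hrel + l * heer
    have hdetB : B.det = 1 ∨ B.det = -1 := by
      rw [hB, Matrix.det_fin_two_of]
      have : r * (e * (q - a * s)) - s * (e * (p - a * r)) = - e * (p * s - q * r) := by ring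
      rw [this]
      rcases hdet' with h | h <;> rcases eE_cases u with h' | h' <;> rw [h, he, h'] <;> simp
    have hparB : Par B := by
      have h3 := aE_even u
      have h4 : ¬ Even e := by rcases eE_cases u with h' | h' <;> rw [he, h'] <;> decide
      exact peel_par p q r s a e h3 h4 hpar
    by_cases hr0 : p - a * r = 0
    · -- terminal
      have hr1' : r = 1 := by
        have : p * s - q * r = r * (a * s - q) := by linear_combination s * hr0
        rw [this] at hdet'
        have : r ∣ 1 := by
          rcases hdet' with h | h
          · exact ⟨_, h.symm⟩
          · exact ⟨-(a * s - q), by linarith⟩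
        exact Int.eq_one_of_dvd_one hr.le this
      have hs0 : s = 0 := by rw [hr1'] at hs; exact Int.abs_lt_one_iff.mp hs
      obtain ⟨g1, g2⟩ := hactB
      simp only [hB, Matrix.of_apply, Matrix.cons_val', Matrix.cons_val_zero, Matrix.cons_val_one, Matrix.cons_val_fin_one] at g1 g2
      rw [hr0, hs0] at g2
      rw [hs0, hr1'] at g1
      push_cast at g1 g2
      have hlT : 0 < l / TE u := by positivity
      have hq1 : e * q = 1 := by
        have h5 : e * q = 1 ∨ e * q = -1 := by
          rcases hdet' with h | h <;> rcases eE_cases u with h' | h' <;> rw [hs0, hr1'] at h <;> rw [he, h'] <;> omega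
        rcases h5 with h5 | h5
        · exact h5
        · have h6 : (e:ℝ) * q = -1 := by exact_mod_cast h5
          have : l / TE u = -1 := by rw [← g2]; linear_combination h6
          linarith
      have h6 : (e:ℝ) * q = 1 := by exact_mod_cast hq1
      have h7 : l / TE u = 1 := by rw [← g2]; linear_combination h6
      rw [h7] at g1
      refine ⟨1, by norm_num, ?_, ?_⟩
      · simp; linarith
      · rw [Pm_succ, Pm_zero, hAB]
        have : B = 1 := by
          rw [hB, hr0, hs0, hr1']
          ext i j
          fin_cases i <;> fin_cases j <;> simp [hq1]
        rw [this]
    · -- recursive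
      have hr'1 : 1 ≤ |e * (p - a * r)| := by
        apply Int.one_le_abs
        apply mul_ne_zero _ hr0
        rintro h; rw [h] at hee; simp at hee
      have habs : |e * (p - a * r)| = |p - a * r| := by
        rw [abs_mul]
        rcases eE_cases u with h' | h' <;> rw [he, h'] <;> simp
      set r' := e * (p - a * r) with hr'
      set s' := e * (q - a * s) with hs'd
      have hs1 : |s'| < |r'| := by
        by_contra hcon
        have hne : |s'| ≠ |r'| := by
          intro h
          have h3 := hparB
          unfold Par at h3
          simp only [hB, Matrix.of_apply, Matrix.cons_val', Matrix.cons_val_zero, Matrix.cons_val_one, Matrix.cons_val_fin_one] at h3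
          have h4 : Even s' ↔ Even r' := by rw [← even_abs (a := s'), ← even_abs (a := r'), h]
          obtain ⟨a1, a2, a3⟩ := h3
          simp only [← Int.not_even_iff_odd, Int.even_add] at a1 a2 a3
          tauto
        have h3 : |r'| + 1 ≤ |s'| := by omega
        have h4 : r * s' - s * r' = 1 ∨ r * s' - s * r' = -1 := by
          rwa [hB, Matrix.det_fin_two_of] at hdetB
        have h5 : |r * s' - s * r'| = 1 := by rcases h4 with h | h <;> rw [h] <;> simp
        have h6 : |r * s'| - |s * r'| ≤ |r * s' - s * r'| := abs_sub_abs_le_abs_sub _ _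
        have h6a : |r * s'| = r * |s'| := by rw [abs_mul r s', abs_of_pos hr]
        have h6b : |s * r'| = |s| * |r'| := abs_mul s r'
        rw [h6a, h6b, h5] at h6
        have h7 := mul_le_mul_of_nonneg_left h3 hr.le
        have h8 : (|s| + 1) * |r'| ≤ r * |r'| := mul_le_mul_of_nonneg_right hs (abs_nonneg r')
        linarith
      have hpos : 0 < r' := by
        obtain ⟨g1, g2⟩ := hactB
        simp only [hB, Matrix.of_apply, Matrix.cons_val', Matrix.cons_val_zero, Matrix.cons_val_one, Matrix.cons_val_fin_one] at g2
        have hlT : 0 < l / TE u := by positivity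
        by_contra hcon
        rw [abs_of_nonpos (by omega : r' ≤ 0)] at hs1 hr'1
        rw [abs_lt] at hs1
        have h3 : (s':ℝ) < -r' := by exact_mod_cast hs1.2
        have h4 : (1:ℝ) ≤ -r' := by exact_mod_cast hr'1
        nlinarith
      have eB0 : B 1 0 = r' := by simp [hB]
      have eB1 : B 1 1 = s' := by simp [hB]
      rw [abs_of_pos hpos] at hs1 habs
      obtain ⟨n, hn, hn1, hn2⟩ := ih B (TE u) v (l / TE u) (TE_irr u hu) hT hv1 hdetB hparB (by rw [eB0]; exact hpos)
        (by rw [eB0, eB1]; exact hs1) (by rw [eB0]; push_cast at hN; omega) hactB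
      refine ⟨n+1, by omega, ?_, ?_⟩
      · rw [Function.iterate_succ_apply]; exact hn1
      · rw [Pm_succ, ← hn2]; exact hAB

end

section
open Finset

lemma conj_root (ω ω' : ℝ) (A B C x y z : ℤ) (hA : A ≠ 0) (hi : Irrational ω)
    (h1 : (A : ℝ) * ω ^ 2 + B * ω + C = 0) (h2 : (A : ℝ) * ω' ^ 2 + B * ω' + C = 0)
    (h3 : (x : ℝ) * ω ^ 2 + y * ω + z = 0) : (x : ℝ) * ω' ^ 2 + y * ω' + z = 0 := by
  have h4 : ((A * y - x * B : ℤ):ℝ) * ω = ((x * C - A * z : ℤ) : ℝ) := by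
    push_cast; linear_combination (A:ℝ) * h3 - x * h1
  have h5 : A * y - x * B = 0 := by
    by_contra hne
    have h6 := hi.intCast_mul hne
    rw [h4] at h6
    exact Int.not_irrational _ h6
  have h6 : ((x * C - A * z : ℤ) : ℝ) = 0 := by rw [← h4, h5]; simp
  have h7 : x * C - A * z = 0 := by exact_mod_cast h6
  have h8 : (A:ℝ) * y - x * B = 0 := by exact_mod_cast h5
  have h9 : (x:ℝ) * C - A * z = 0 := by exact_mod_cast h7
  have hA' : (A:ℝ) ≠ 0 := by exact_mod_cast hA
  have : (A:ℝ) * ((x : ℝ) * ω' ^ 2 + y * ω' + z) = 0 := by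
    linear_combination x * h2 + ω' * h8 - h9
  exact (mul_eq_zero.mp this).resolve_left hA'

lemma key_peel (ω ω' l l' : ℝ) (γ : Matrix (Fin 2) (Fin 2) ℤ) (hi : Irrational ω) (h1 : 1 < ω) (h2 : -1 < ω') (h3 : ω' < 1)
    (hdet : γ.det = 1) (hpar : Par γ) (hr : 0 < γ 1 0) (ha : Act γ ω l ω) (hb : Act γ ω' l' ω') (hl : 0 < l') (hl1 : l' < 1) :
    ∃ n, 0 < n ∧ TE^[n] ω = ω ∧ γ = Pm ω n := by
  have hs : |γ 1 1| < γ 1 0 := by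
    have e := hb.2
    have hr1 : (0:ℝ) < γ 1 0 := by exact_mod_cast hr
    have s1 : (γ 1 1 : ℝ) < γ 1 0 + 1 := by nlinarith
    have s2 : -(γ 1 0 : ℝ) < γ 1 1 := by nlinarith
    have s1' : γ 1 1 < γ 1 0 + 1 := by exact_mod_cast s1
    have s2' : -(γ 1 0) < γ 1 1 := by exact_mod_cast s2
    rw [abs_lt]
    refine ⟨s2', lt_of_le_of_ne (by omega) ?_⟩
    intro h
    obtain ⟨⟨a1, a1'⟩, ⟨a2, a2'⟩, _⟩ := hpar
    omega
  exact peel (γ 1 0).toNat γ ω ω l hi h1 h1 (Or.inl hdet) hpar hr hs (by omega) ha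

lemma periodic (ω ω' : ℝ) (hc : IsConjPair ω ω') (h1 : 1 < ω) (h2 : -1 < ω') (h3 : ω' < 1) :
    ∃ n, 0 < n ∧ TE^[n] ω = ω := by
  obtain ⟨hi, A, B, C, hA, _, e1, e2, _⟩ := hc
  have hA' : (0:ℝ) < A := by exact_mod_cast hA
  set ρ := 2 * (A:ℝ) * ω + B with hρ
  have hρi : Irrational ρ := by
    have : Irrational (((2 * A : ℤ):ℝ) * ω + B) := (hi.intCast_mul (by omega)).add_intCast B
    push_cast at this
    exact this
  have hρ2 : ρ^2 = ((B^2 - 4 * A * C : ℤ) : ℝ) := by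
    push_cast; rw [hρ]; linear_combination 4 * (A:ℝ) * e1
  have hρ2' : (2 * (A:ℝ) * ω' + B)^2 = ((B^2 - 4 * A * C : ℤ) : ℝ) := by
    push_cast; linear_combination 4 * (A:ℝ) * e2
  have hneg : 2 * (A:ℝ) * ω' + B = -ρ := by
    have : (2 * (A:ℝ) * ω' + B)^2 = ρ^2 := by rw [hρ2, hρ2']
    rcases sq_eq_sq_iff_eq_or_eq_neg.mp this with h | h
    · exfalso
      have : (A:ℝ) * (ω - ω') = 0 := by rw [hρ] at h; linarith
      nlinarith
    · exact h
  have hρ0 : 0 < ρ := by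
    have : (A:ℝ) * (ω - ω') = ρ := by linarith
    rw [← this]; apply mul_pos hA'; linarith
  have hD0 : 0 < B^2 - 4 * A * C := by
    have : (0:ℝ) < ((B^2 - 4 * A * C : ℤ) : ℝ) := by rw [← hρ2]; positivity
    exact_mod_cast this
  have hns : ¬ IsSquare (B^2 - 4 * A * C) := by
    rintro ⟨z, hz⟩
    rw [hz] at hρ2
    push_cast at hρ2
    have : ρ^2 = (z:ℝ)^2 := by rw [hρ2]; ring
    rcases sq_eq_sq_iff_eq_or_eq_neg.mp this with h | h
    · exact hρi.ne_int z h
    · exact hρi.ne_int (-z) (by push_cast; exact h)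
  obtain ⟨x, y, hxy, hy⟩ := Pell.exists_of_not_isSquare hD0 hns
  have hx0 : x ≠ 0 := by
    rintro rfl
    nlinarith [mul_nonneg hD0.le (sq_nonneg y)]
  obtain ⟨x, y, hxy, hx, hy⟩ : ∃ x y : ℤ, x^2 - (B^2 - 4*A*C) * y^2 = 1 ∧ 0 < x ∧ 0 < y :=
    ⟨|x|, |y|, by rw [sq_abs, sq_abs]; exact hxy, abs_pos.mpr hx0, abs_pos.mpr hy⟩
  have hx' : (1:ℝ) ≤ x := by exact_mod_cast hx
  have hy' : (0:ℝ) < y := by exact_mod_cast hy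
  have hll : ((x:ℝ) + y * ρ) * (x - y * ρ) = 1 := by
    have : ((x:ℝ)^2 - ((B^2 - 4*A*C : ℤ):ℝ) * y^2) = 1 := by exact_mod_cast hxy
    rw [← hρ2] at this
    linear_combination this
  have hl1 : 1 < (x:ℝ) + y * ρ := by have := mul_pos hy' hρ0; linarith
  have hl'0 : 0 < (x:ℝ) - y * ρ := by
    by_contra h
    push Not at h
    nlinarith
  have hl'1 : (x:ℝ) - y * ρ < 1 := by nlinarith
  have hxo : Odd (x + B * y) := by
    have : (x - B * y) * (x + B * y) = 2 * (-2 * A * C * y^2) + 1 := by linear_combination hxy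
    have h5 : Odd ((x - B * y) * (x + B * y)) := ⟨_, this⟩
    exact (Int.odd_mul.mp h5).2
  obtain ⟨n, hn, hn2, _⟩ := key_peel ω ω' (x + y * ρ) (x - y * ρ) !![x - B * y, -2 * C * y; 2 * A * y, x + B * y] hi h1 h2 h3
    (by rw [Matrix.det_fin_two_of]; linear_combination hxy)
    (by
      unfold Par
      simp only [Matrix.of_apply, Matrix.cons_val', Matrix.cons_val_zero, Matrix.cons_val_one, Matrix.cons_val_fin_one]
      obtain ⟨w, hw⟩ := hxo
      refine ⟨⟨w - B * y + A * y, by linarith⟩, ⟨x, by ring⟩, ⟨A * y - C * y, by ring⟩⟩)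
    (by simp; positivity)
    (by
      unfold Act
      simp only [Matrix.of_apply, Matrix.cons_val', Matrix.cons_val_zero, Matrix.cons_val_one, Matrix.cons_val_fin_one]
      push_cast
      rw [hρ]
      constructor
      · linear_combination (-2 * (y:ℝ)) * e1
      · ring)
    (by
      unfold Act
      simp only [Matrix.of_apply, Matrix.cons_val', Matrix.cons_val_zero, Matrix.cons_val_one, Matrix.cons_val_fin_one]
      push_cast
      constructor
      · linear_combination (-2 * (y:ℝ)) * e2 + (y:ℝ) * ω' * hneg
      · linear_combination (y:ℝ) * hneg) hl'0 hl'1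
  exact ⟨n, hn, hn2⟩

lemma perE_spec (ω : ℝ) (h : ∃ n, 0 < n ∧ TE^[n] ω = ω) : 0 < perE ω ∧ TE^[perE ω] ω = ω := by
  have : perE ω ∈ {n : ℕ | 0 < n ∧ TE^[n] ω = ω} := Nat.sInf_mem h
  exact this

lemma perE_dvd (ω : ℝ) (n : ℕ) (hn : 0 < n) (h : TE^[n] ω = ω) : perE ω ∣ n := by
  have hp := perE_spec ω ⟨n, hn, h⟩
  have hm := (Pm_mul ω (perE ω) hp.2 (n / perE ω)).2
  have h2 : TE^[n % perE ω] ω = ω := by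
    have e : n = n % perE ω + perE ω * (n / perE ω) := (Nat.mod_add_div n (perE ω)).symm
    rw [e, Function.iterate_add_apply, hm] at h
    exact h
  by_contra hnd
  have hpos : 0 < n % perE ω := Nat.pos_of_ne_zero (fun h0 => hnd (Nat.dvd_of_mod_eq_zero h0))
  have : perE ω ≤ n % perE ω := Nat.sInf_le (show n % perE ω ∈ {n : ℕ | 0 < n ∧ TE^[n] ω = ω} from ⟨hpos, h2⟩)
  exact absurd (Nat.mod_lt n hp.1) (by omega)

lemma OmegaE_eq (ω : ℝ) : OmegaE ω = Pm ω (perE ω) := rfl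

lemma tilde_props (ω : ℝ) (hi : Irrational ω) (h : ∃ n, 0 < n ∧ TE^[n] ω = ω) :
    (OmegaTildeE ω).det = 1 ∧ Par (OmegaTildeE ω) ∧ ∃ Λ, 1 < Λ ∧ Act (OmegaTildeE ω) ω Λ ω := by
  have hp := perE_spec ω h
  obtain ⟨l, _, hl, hact⟩ := Act_Pm ω hi (perE ω)
  rw [hp.2, ← OmegaE_eq] at hact
  have hl1 := hl hp.1
  have hpar : Par (OmegaE ω) := by rw [OmegaE_eq]; exact Par_Pm _ _
  have hdet : (OmegaE ω).det = 1 ∨ (OmegaE ω).det = -1 := by rw [OmegaE_eq]; exact det_Pm _ _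
  unfold OmegaTildeE
  split_ifs with hd
  · exact ⟨hd, hpar, l, hl1, hact⟩
  · refine ⟨?_, ?_, l^2, by nlinarith, Act_pow _ _ _ hact 2⟩
    · rw [Matrix.det_pow]
      rcases hdet with h | h <;> rw [h] <;> norm_num
    · rw [sq]; exact Par_mul _ _ hpar hpar

lemma pow_tilde (ω : ℝ) (n : ℕ) (hn : 0 < n) (h : TE^[n] ω = ω) (hd : (Pm ω n).det = 1) :
    ∃ k, 0 < k ∧ Pm ω n = OmegaTildeE ω ^ k := by
  have hp := perE_spec ω ⟨n, hn, h⟩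
  obtain ⟨k, hk⟩ := perE_dvd ω n hn h
  have hk0 : 0 < k := by
    rcases Nat.eq_zero_or_pos k with h0 | h0
    · subst h0; omega
    · exact h0
  have e := (Pm_mul ω (perE ω) hp.2 k).1
  rw [← hk, ← OmegaE_eq] at e
  unfold OmegaTildeE
  split_ifs with hd1
  · exact ⟨k, hk0, e⟩
  · have hd2 : (OmegaE ω).det = -1 := (det_Pm ω (perE ω)).resolve_left hd1
    rw [e, Matrix.det_pow, hd2] at hd
    have hev : Even k := by
      by_contra ho
      rw [Nat.not_even_iff_odd] at ho
      rw [ho.neg_one_pow] at hd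
      norm_num at hd
    obtain ⟨j, hj⟩ := hev
    refine ⟨j, by omega, ?_⟩
    rw [e, hj, ← pow_mul]
    congr 1
    ring

lemma mat_props (ω ω' Λ : ℝ) (hc : IsConjPair ω ω') (h1 : 1 < ω) (h3 : ω' < 1) (σ : Matrix (Fin 2) (Fin 2) ℤ)
    (hdet : σ.det = 1) (hΛ : 1 < Λ) (ha : Act σ ω Λ ω) :
    0 < σ 1 0 ∧ Act σ ω' (1/Λ) ω' ∧ ((σ 0 0 : ℝ) + σ 1 1 = Λ + 1/Λ) ∧ specRad σ = Λ := by
  obtain ⟨hi, A, B, C, hA, _, e1, e2, _⟩ := hc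
  obtain ⟨a1, a2⟩ := ha
  rw [Matrix.det_fin_two] at hdet
  have hdet' : (σ 0 0 : ℝ) * σ 1 1 - σ 0 1 * σ 1 0 = 1 := by exact_mod_cast hdet
  have hΛ0 : 0 < Λ := by linarith
  have hquad : (σ 1 0 : ℝ) * ω^2 + ((σ 1 1 - σ 0 0 : ℤ):ℝ) * ω + ((-σ 0 1 : ℤ):ℝ) = 0 := by
    push_cast; linear_combination ω * a2 - a1
  have hquad' := conj_root ω ω' A B C _ _ _ hA.ne' hi e1 e2 hquad
  push_cast at hquad hquad'
  have hne : ω - ω' ≠ 0 := by intro h; linarith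
  have hsum : (σ 1 0 : ℝ) * (ω + ω') + (σ 1 1 - σ 0 0) = 0 := by
    have : (ω - ω') * ((σ 1 0 : ℝ) * (ω + ω') + (σ 1 1 - σ 0 0)) = 0 := by linear_combination hquad - hquad'
    exact (mul_eq_zero.mp this).resolve_left hne
  have hμ : (σ 1 0 : ℝ) * ω' + σ 1 1 = 1/Λ := by
    rw [eq_div_iff hΛ0.ne', ← a2]
    linear_combination hdet' + ((σ 1 1 : ℝ) + (σ 1 0) * ω') * 0 + (σ 1 1 : ℝ) * hsum + σ 1 0 * (ω * hsum - hquad)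
  have hμ1 : 1/Λ < 1 := by rw [div_lt_one hΛ0]; exact hΛ
  have htr : (σ 0 0 : ℝ) + σ 1 1 = Λ + 1/Λ := by rw [← hμ, ← a2]; linear_combination -hsum
  refine ⟨?_, ⟨?_, hμ⟩, htr, ?_⟩
  · have : 0 < (σ 1 0 : ℝ) * (ω - ω') := by
      have : (σ 1 0 : ℝ) * (ω - ω') = Λ - 1/Λ := by rw [← hμ, ← a2]; ring
      rw [this]; linarith
    have h5 : (0:ℝ) < σ 1 0 := pos_of_mul_pos_left this (by linarith)
    exact_mod_cast h5
  · rw [← hμ]; linear_combination -hquad'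
  · unfold specRad
    rw [Matrix.trace_fin_two]
    push_cast
    rw [htr]
    have : (Λ + 1/Λ)^2 - 4 = (Λ - 1/Λ)^2 := by field_simp; ring
    rw [this, Real.sqrt_sq (by linarith)]
    ring

end

section
open Finset

lemma prim_form (x y z : ℤ) (hx : 0 < x) : ∃ g A B C : ℤ, 0 < g ∧ 0 < A ∧ x = g * A ∧ y = g * B ∧ z = g * C ∧
    Int.gcd (Int.gcd A B : ℤ) C = 1 := by
  set g : ℕ := Int.gcd (Int.gcd x y : ℤ) z with hg
  have hgx : (g:ℤ) ∣ x := (Int.gcd_dvd_left _ _).trans (Int.gcd_dvd_left _ _)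
  have hgy : (g:ℤ) ∣ y := (Int.gcd_dvd_left _ _).trans (Int.gcd_dvd_right _ _)
  have hgz : (g:ℤ) ∣ z := Int.gcd_dvd_right _ _
  have hg0 : 0 < g := by
    rcases Nat.eq_zero_or_pos g with h | h
    · rw [h] at hgx; simp at hgx; omega
    · exact h
  obtain ⟨A, hA⟩ := hgx
  obtain ⟨B, hB⟩ := hgy
  obtain ⟨C, hC⟩ := hgz
  refine ⟨g, A, B, C, by exact_mod_cast hg0, ?_, hA, hB, hC, ?_⟩
  · rw [hA] at hx
    exact pos_of_mul_pos_right hx (by positivity)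
  · have e : g = g * Int.gcd (Int.gcd A B : ℤ) C := by
      conv_lhs => rw [hg, hA, hB, hC]
      rw [Int.gcd_mul_left, Int.natAbs_natCast]
      push_cast
      rw [Int.gcd_mul_left, Int.natAbs_natCast]
    exact (Nat.eq_of_mul_eq_mul_left hg0 (by rw [mul_one]; exact e)).symm

/-- eigenvalue attached to a trace -/
def lamT (t : ℤ) : ℝ := ((t:ℝ) + Real.sqrt ((t:ℝ)^2 - 4)) / 2

lemma lamT_props (t : ℤ) (ht : 3 ≤ t) : 1 < lamT t ∧ (t:ℝ) = lamT t + 1 / lamT t ∧ Irrational (1 / lamT t) ∧ 2 ≤ lamT t := by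
  have ht' : (3:ℝ) ≤ t := by exact_mod_cast ht
  have h0 : (0:ℝ) ≤ (t:ℝ)^2 - 4 := by nlinarith
  have hs := Real.sq_sqrt h0
  have hs1 : 1 ≤ Real.sqrt ((t:ℝ)^2 - 4) := by
    apply Real.le_sqrt_of_sq_le; nlinarith
  have h1 : 2 ≤ lamT t := by unfold lamT; linarith
  have hinv : 1 / lamT t = ((t:ℝ) - Real.sqrt ((t:ℝ)^2 - 4)) / 2 := by
    rw [div_eq_iff (by linarith)]
    unfold lamT
    nlinarith
  refine ⟨by linarith, ?_, ?_, h1⟩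
  · rw [hinv]; unfold lamT; ring
  · have hirr : Irrational (Real.sqrt ((t^2 - 4 : ℤ) : ℝ)) := by
      rw [irrational_sqrt_intCast_iff]
      refine ⟨?_, by nlinarith⟩
      rintro ⟨z, hz⟩
      have h3 : |z| * |z| = t^2 - 4 := by rw [abs_mul_abs_self]; exact hz.symm
      have h4 : |z| < t := by
        by_contra h
        push Not at h
        nlinarith
      have h5 : t - 1 < |z| := by
        by_contra h
        push Not at h
        nlinarith [abs_nonneg z]
      omega
    have e : ((t^2 - 4 : ℤ) : ℝ) = (t:ℝ)^2 - 4 := by push_cast; ring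
    rw [e] at hirr
    rw [hinv]
    have := (hirr.intCast_sub t).div_natCast (m := 2) (by norm_num)
    push_cast at this
    exact this

/-- fixed point attached to a triple -/
def omT (p r s : ℤ) : ℝ := ((p:ℝ) - 1 / lamT (p + s)) / r
/-- its conjugate -/
def omT' (p r s : ℤ) : ℝ := (1 / lamT (p + s) - s) / r

lemma P3_par (p q r s : ℤ) (hr : 0 < r) (hdet : p * s - q * r = 1) (h : P3 p r s) : Par !![p, q; r, s] := by
  unfold Par
  simp only [Matrix.of_apply, Matrix.cons_val', Matrix.cons_val_zero, Matrix.cons_val_one, Matrix.cons_val_fin_one]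
  rcases h with ⟨h1, ⟨c, hc⟩⟩ | ⟨h1, h2, h3, _⟩
  · have hq : q = 2 * c := by
      have : q * r = (2 * c) * r := by linarith
      exact mul_right_cancel₀ hr.ne' this
    have hqe : Even q := ⟨c, by omega⟩
    have hps : Odd (p * s) := by
      have := h1.mul_left q
      have e : p * s = q * r + 1 := by linarith
      rw [e]; exact this.add_one
    have := Int.odd_mul.mp hps
    exact ⟨this.1.add_even h1, this.1.add_odd this.2, hqe.add h1⟩
  · have hqr : Odd (q * r) := by
      have e : q * r = p * s - 1 := by linarith
      rw [e]; exact (h2.mul_right s).sub_odd odd_one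
    have := Int.odd_mul.mp hqr
    exact ⟨h2.add_odd h1, h2.add h3, this.1.add_odd h1⟩

lemma par_P3 (A : Matrix (Fin 2) (Fin 2) ℤ) (hdet : A.det = 1) (h : Par A) : P3 (A 0 0) (A 1 0) (A 1 1) := by
  rw [Matrix.det_fin_two] at hdet
  obtain ⟨h1, h2, h3⟩ := h
  unfold P3
  rcases Int.even_or_odd (A 1 0) with hr | hr
  · left
    refine ⟨hr, ?_⟩
    have hq : Even (A 0 1) := by
      rw [Int.even_add] at h3; tauto
    obtain ⟨c, hc⟩ := hq
    exact ⟨c, by rw [hc] at hdet; linarith⟩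
  · right
    have hp : Even (A 0 0) := by
      by_contra hp
      rw [Int.not_even_iff_odd] at hp
      have := hp.add_odd hr
      rw [← Int.not_odd_iff_even] at this
      exact this h1
    refine ⟨hr, hp, ?_, ⟨A 0 1, by linarith⟩⟩
    rw [Int.even_add] at h2; tauto

lemma P3_dvd (p r s : ℤ) (h : P3 p r s) : r ∣ p * s - 1 := by
  rcases h with ⟨_, h⟩ | ⟨_, _, _, h⟩
  · exact (Dvd.intro_left 2 rfl).trans h
  · exact h

lemma P3_even (p r s : ℤ) (h : P3 p r s) : Even (p + s) := by
  rcases h with ⟨_, ⟨c, hc⟩⟩ | ⟨_, h2, h3, h⟩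
  · have hps : Odd (p * s) := ⟨r * c, by linarith⟩
    have := Int.odd_mul.mp hps
    exact this.1.add_odd this.2
  · exact h2.add h3

lemma from_triple (p r s : ℤ) (hr : 0 < r) (h3 : P3 p r s) (ht : 3 ≤ p + s) :
    ∃ q : ℤ, p * s - q * r = 1 ∧ Act !![p, q; r, s] (omT p r s) (lamT (p+s)) (omT p r s) ∧
      Act !![p, q; r, s] (omT' p r s) (1 / lamT (p+s)) (omT' p r s) ∧ IsConjPair (omT p r s) (omT' p r s) ∧
      Irrational (omT' p r s) := by
  obtain ⟨hl1, hl2, hl3, _⟩ := lamT_props (p+s) ht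
  set l := lamT (p+s) with hl
  obtain ⟨q, hq⟩ := P3_dvd p r s h3
  have hr' : (0:ℝ) < r := by exact_mod_cast hr
  push_cast at hl2
  have hqr : (q:ℝ) * r = p * s - 1 := by
    have : q * r = p * s - 1 := by linarith
    exact_mod_cast this
  have hω : (r:ℝ) * omT p r s = p - 1/l := by unfold omT; rw [← hl]; field_simp
  have hω' : (r:ℝ) * omT' p r s = 1/l - s := by unfold omT'; rw [← hl]; field_simp
  set ω := omT p r s with hωd
  set ω' := omT' p r s with hωd'
  set μ := 1/l with hμ
  have hlμ : l * μ = 1 := by rw [hμ]; field_simp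
  have quad : (r:ℝ) * ω^2 + (s - p) * ω - q = 0 := by
    have : (r:ℝ) * ((r:ℝ) * ω^2 + (s - p) * ω - q) = 0 := by
      linear_combination ((r:ℝ) * ω + p - μ + s - p) * hω - hqr - μ * hl2 - hlμ
    exact (mul_eq_zero.mp this).resolve_left hr'.ne'
  have quad' : (r:ℝ) * ω'^2 + (s - p) * ω' - q = 0 := by
    have : (r:ℝ) * ((r:ℝ) * ω'^2 + (s - p) * ω' - q) = 0 := by
      linear_combination ((r:ℝ) * ω' + μ - p) * hω' - hqr - μ * hl2 - hlμ
    exact (mul_eq_zero.mp this).resolve_left hr'.ne'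
  have hirr : Irrational ω := by
    have := (hl3.intCast_sub p).div_intCast hr.ne'
    exact this
  refine ⟨q, by linarith, ⟨?_, ?_⟩, ⟨?_, ?_⟩, ?_, ?_⟩
  · simp only [Matrix.of_apply, Matrix.cons_val', Matrix.cons_val_zero, Matrix.cons_val_one, Matrix.cons_val_fin_one]
    linear_combination -quad + ω * hω + ω * hl2
  · simp only [Matrix.of_apply, Matrix.cons_val', Matrix.cons_val_zero, Matrix.cons_val_one, Matrix.cons_val_fin_one]
    linear_combination hω + hl2
  · simp only [Matrix.of_apply, Matrix.cons_val', Matrix.cons_val_zero, Matrix.cons_val_one, Matrix.cons_val_fin_one]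
    linear_combination -quad' + ω' * hω'
  · simp only [Matrix.of_apply, Matrix.cons_val', Matrix.cons_val_zero, Matrix.cons_val_one, Matrix.cons_val_fin_one]
    linear_combination hω'
  · obtain ⟨g, A, B, C, hg, hA, e1, e2, e3, hgcd⟩ := prim_form r (s - p) (-q) hr
    have hg' : (g:ℝ) ≠ 0 := by exact_mod_cast hg.ne'
    have e1' : (r:ℝ) = g * A := by exact_mod_cast e1
    have e2' : (s:ℝ) - p = g * B := by exact_mod_cast e2
    have e3' : -(q:ℝ) = g * C := by exact_mod_cast e3
    refine ⟨hirr, A, B, C, hA, hgcd, ?_, ?_, ?_⟩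
    · apply (mul_eq_zero.mp _).resolve_left hg'
      linear_combination quad - ω^2 * e1' - ω * e2' - e3'
    · apply (mul_eq_zero.mp _).resolve_left hg'
      linear_combination quad' - ω'^2 * e1' - ω' * e2' - e3'
    · intro h
      have hμ1 : μ < 1 := by rw [hμ, div_lt_one (by linarith)]; exact hl1
      rw [h, hω] at hω'
      linarith
  · have := (hl3.sub_intCast s).div_intCast hr.ne'
    exact this

end

section
open Finset

lemma cong_count (r y : ℤ) (hr : 0 < r) (L : ℕ) :
    (((Icc (-(L:ℤ)) L).filter (fun x => r ∣ x * y - 1)).card : ℝ) ≤ 2 * L * (r:ℝ)⁻¹ + 2 := by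
  have h1 : ((Icc (-(L:ℤ)) L).filter (fun x => r ∣ x * y - 1)).card ≤ (Icc ((-(L:ℤ)) / r) ((L:ℤ) / r)).card := by
    apply Finset.card_le_card_of_injOn (fun x => x / r)
    · intro x hx
      simp only [coe_filter, mem_Icc, Set.mem_setOf_eq] at hx
      simp only [coe_Icc, Set.mem_Icc]
      exact ⟨Int.ediv_le_ediv hr hx.1.1, Int.ediv_le_ediv hr hx.1.2⟩
    · intro x hx x' hx' he
      simp only [coe_filter, mem_Icc, Set.mem_setOf_eq] at hx hx'
      have hd : r ∣ (x - x') * y := by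
        have := dvd_sub hx.2 hx'.2
        have e : x * y - 1 - (x' * y - 1) = (x - x') * y := by ring
        rwa [e] at this
      have hc : IsCoprime r y := by
        obtain ⟨c, hc⟩ := hx.2
        exact ⟨-c, x, by linarith⟩
      have hd2 := hc.dvd_of_dvd_mul_right hd
      have hm : x % r = x' % r := Int.ModEq.symm ((Int.modEq_iff_dvd).mpr hd2)
      simp only at he
      rw [← Int.mul_ediv_add_emod x r, ← Int.mul_ediv_add_emod x' r, he, hm]
  have h2 : ((Icc ((-(L:ℤ)) / r) ((L:ℤ) / r)).card : ℝ) ≤ 2 * L * (r:ℝ)⁻¹ + 2 := by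
    rw [Int.card_Icc]
    have hr' : (0:ℝ) < r := by exact_mod_cast hr
    have a1 : (((L:ℤ) / r : ℤ) : ℝ) ≤ L * (r:ℝ)⁻¹ := by
      rw [← div_eq_mul_inv, le_div_iff₀ hr']
      exact_mod_cast Int.ediv_mul_le (L:ℤ) hr.ne'
    have a2 : -(L * (r:ℝ)⁻¹) - 1 ≤ (((-(L:ℤ)) / r : ℤ) : ℝ) := by
      have h := Int.lt_ediv_add_one_mul_self (-(L:ℤ)) hr
      have h' : -(L:ℝ) < ((((-(L:ℤ)) / r : ℤ) : ℝ) + 1) * r := by exact_mod_cast h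
      have e : -(L:ℝ) = -(L * (r:ℝ)⁻¹) * r := by field_simp
      rw [e] at h'
      have := lt_of_mul_lt_mul_right h' hr'.le
      linarith
    have hle : (-(L:ℤ)) / r ≤ (L:ℤ) / r := Int.ediv_le_ediv hr (by omega)
    have e : ((((L:ℤ) / r + 1 - (-(L:ℤ)) / r).toNat : ℕ) : ℝ) = (((L:ℤ) / r + 1 - (-(L:ℤ)) / r : ℤ) : ℝ) := by
      exact_mod_cast Int.toNat_of_nonneg (by linarith)
    rw [e]; push_cast
    linarith
  exact le_trans (by exact_mod_cast h1) h2

/-- pairs on a line -/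
def Bd (f : ℤ → ℤ) (L : ℕ) : Finset (ℤ × ℤ) :=
  (Icc 1 L).biUnion (fun r : ℕ => ((Icc (-(L:ℤ)) L).filter (fun x => (r:ℤ) ∣ x * f r - 1)).image (fun x => (x, (r:ℤ))))

lemma mem_Bd (f : ℤ → ℤ) (L : ℕ) (x r : ℤ) (hr : 0 < r) (hrL : r ≤ L) (hx : -(L:ℤ) ≤ x) (hx' : x ≤ L)
    (hd : r ∣ x * f r - 1) : (x, r) ∈ Bd f L := by
  lift r to ℕ using hr.le
  simp only [Bd, mem_biUnion, mem_image, mem_filter, mem_Icc]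
  exact ⟨r, ⟨by omega, by omega⟩, x, ⟨⟨hx, hx'⟩, hd⟩, rfl⟩

lemma card_Bd (f : ℤ → ℤ) (L : ℕ) (hL : 1 ≤ L) : ((Bd f L).card : ℝ) ≤ 10 * (L:ℝ) ^ (3/2 : ℝ) := by
  have h1 : (Bd f L).card ≤ ∑ r ∈ Icc 1 L, ((Icc (-(L:ℤ)) L).filter (fun x => (r:ℤ) ∣ x * f r - 1)).card := by
    unfold Bd
    refine card_biUnion_le.trans ?_
    exact Finset.sum_le_sum (fun r _ => card_image_le)
  have h2 : ((Bd f L).card : ℝ) ≤ ∑ r ∈ Icc 1 L, (2 * (L:ℝ) * (r:ℝ)⁻¹ + 2) := by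
    have h1' := (Nat.cast_le (α := ℝ)).mpr h1
    refine h1'.trans ?_
    push_cast
    apply Finset.sum_le_sum
    intro r hr
    have := cong_count r (f r) (by simp at hr; omega) L
    exact_mod_cast this
  have h3 := harmonic_le_one_add_log L
  rw [harmonic_eq_sum_Icc] at h3
  push_cast at h3
  rw [Finset.sum_add_distrib, ← Finset.mul_sum] at h2
  simp only [sum_const, Nat.card_Icc, add_tsub_cancel_right, nsmul_eq_mul] at h2
  have hL' : (1:ℝ) ≤ L := by exact_mod_cast hL
  have h4 := log_bound (1/2) (by norm_num) L hL'
  have h5 : (L:ℝ) ^ (3/2:ℝ) = L * (L:ℝ) ^ (1/2:ℝ) := by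
    rw [show (3/2:ℝ) = 1 + 1/2 by norm_num, Real.rpow_add (by linarith), Real.rpow_one]
  have h6 : 1 ≤ (L:ℝ) ^ (1/2:ℝ) := Real.one_le_rpow hL' (by norm_num)
  rw [h5]
  have h7 : 2 * (L:ℝ) * ∑ i ∈ Icc 1 L, (i:ℝ)⁻¹ ≤ 2 * (L:ℝ) * (3 * (L:ℝ) ^ (1/2:ℝ)) := by
    apply mul_le_mul_of_nonneg_left _ (by linarith)
    norm_num at h4 ⊢
    linarith
  have h8 : (L:ℝ) * 1 ≤ L * (L:ℝ) ^ (1/2:ℝ) := mul_le_mul_of_nonneg_left h6 (by linarith)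
  linarith

end

section
open Finset

/-- the counted set -/
def SS (α β₁ β₂ R : ℝ) : Set ℝ := {ω : ℝ | 1 < ω ∧ α ≤ ω ∧ rhoE ω ≤ R ∧
          ∃ ω' : ℝ, IsConjPair ω ω' ∧ -1 < ω' ∧ ω' < 1 ∧
            -(1 / β₂) ≤ ω' ∧ ω' ≤ 1 / β₁}

/-- entries of the fundamental matrix -/
def gT (ω : ℝ) : ℤ × ℤ × ℤ := (OmegaTildeE ω 0 0, OmegaTildeE ω 1 0, OmegaTildeE ω 1 1)

/-- triples with prescribed `s` -/
def lineS (f : ℤ → ℤ) (L : ℕ) : Finset (ℤ × ℤ × ℤ) := (Bd f L).image (fun x => (x.1, x.2, f x.2))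
/-- triples with prescribed `p` -/
def lineP (f : ℤ → ℤ) (L : ℕ) : Finset (ℤ × ℤ × ℤ) := (Bd f L).image (fun x => (f x.2, x.2, x.1))

lemma mem_lineS (f : ℤ → ℤ) (L : ℕ) (p r s : ℤ) (hr : 0 < r) (hrL : r ≤ L) (hx : -(L:ℤ) ≤ p) (hx' : p ≤ L)
    (hd : r ∣ p * s - 1) (h : s = f r) : (p, r, s) ∈ lineS f L := by
  subst h
  exact mem_image.mpr ⟨(p, r), mem_Bd f L p r hr hrL hx hx' hd, rfl⟩

lemma mem_lineP (f : ℤ → ℤ) (L : ℕ) (p r s : ℤ) (hr : 0 < r) (hrL : r ≤ L) (hx : -(L:ℤ) ≤ s) (hx' : s ≤ L)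
    (hd : r ∣ p * s - 1) (h : p = f r) : (p, r, s) ∈ lineP f L := by
  subst h
  exact mem_image.mpr ⟨(s, r), mem_Bd f L s r hr hrL hx hx' (by rwa [mul_comm]), rfl⟩

/-- all boundary triples -/
def BadF (α β₁ β₂ : ℝ) (L : ℕ) : Finset (ℤ × ℤ × ℤ) :=
  lineS (fun r => ⌊(r:ℝ) / β₂⌋ + 1) L ∪ lineS (fun r => ⌈-((r:ℝ) / β₁)⌉) L ∪
  lineP (fun r => ⌈α * (r:ℝ)⌉) L ∪ lineP (fun r => r) L ∪ lineP (fun r => r + 1) L ∪ lineP (fun r => r + 2) L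

lemma card_lineS (f : ℤ → ℤ) (L : ℕ) (hL : 1 ≤ L) : ((lineS f L).card : ℝ) ≤ 10 * (L:ℝ) ^ (3/2 : ℝ) :=
  le_trans (by exact_mod_cast card_image_le) (card_Bd f L hL)
lemma card_lineP (f : ℤ → ℤ) (L : ℕ) (hL : 1 ≤ L) : ((lineP f L).card : ℝ) ≤ 10 * (L:ℝ) ^ (3/2 : ℝ) :=
  le_trans (by exact_mod_cast card_image_le) (card_Bd f L hL)

lemma card_BadF (α β₁ β₂ : ℝ) (L : ℕ) (hL : 1 ≤ L) : ((BadF α β₁ β₂ L).card : ℝ) ≤ 60 * (L:ℝ) ^ (3/2 : ℝ) := by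
  have h1 := card_lineS (fun r => ⌊(r:ℝ) / β₂⌋ + 1) L hL
  have h2 := card_lineS (fun r => ⌈-((r:ℝ) / β₁)⌉) L hL
  have h3 := card_lineP (fun r => ⌈α * (r:ℝ)⌉) L hL
  have h4 := card_lineP (fun r => r) L hL
  have h5 := card_lineP (fun r => r + 1) L hL
  have h6 := card_lineP (fun r => r + 2) L hL
  have h : (BadF α β₁ β₂ L).card ≤ (lineS (fun r => ⌊(r:ℝ) / β₂⌋ + 1) L).card +
      (lineS (fun r => ⌈-((r:ℝ) / β₁)⌉) L).card + (lineP (fun r => ⌈α * (r:ℝ)⌉) L).card +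
      (lineP (fun r => r) L).card + (lineP (fun r => r + 1) L).card + (lineP (fun r => r + 2) L).card := by
    unfold BadF
    refine (card_union_le _ _).trans (Nat.add_le_add_right ?_ _)
    refine (card_union_le _ _).trans (Nat.add_le_add_right ?_ _)
    refine (card_union_le _ _).trans (Nat.add_le_add_right ?_ _)
    refine (card_union_le _ _).trans (Nat.add_le_add_right ?_ _)
    exact card_union_le _ _
  have h' := (Nat.cast_le (α := ℝ)).mpr h
  push_cast at h'
  linarith

/-- entries of a power of the matrix attached to a triple -/
def powT (x : (ℤ × ℤ × ℤ) × ℕ) : ℤ × ℤ × ℤ :=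
  ((!![x.1.1, (x.1.1 * x.1.2.2 - 1) / x.1.2.1; x.1.2.1, x.1.2.2] ^ x.2 : Matrix (Fin 2) (Fin 2) ℤ) 0 0,
   (!![x.1.1, (x.1.1 * x.1.2.2 - 1) / x.1.2.1; x.1.2.1, x.1.2.2] ^ x.2 : Matrix (Fin 2) (Fin 2) ℤ) 1 0,
   (!![x.1.1, (x.1.1 * x.1.2.2 - 1) / x.1.2.1; x.1.2.1, x.1.2.2] ^ x.2 : Matrix (Fin 2) (Fin 2) ℤ) 1 1)

/-- triples which are proper powers -/
def NG (T k : ℕ) : Finset (ℤ × ℤ × ℤ) :=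
  ((Icc (-(T:ℤ)) T ×ˢ Icc (-(T:ℤ)) T ×ˢ Icc (-(T:ℤ)) T) ×ˢ Icc 1 k).image powT

lemma card_NG (T k : ℕ) : (NG T k).card ≤ (2 * T + 1)^3 * k := by
  refine card_image_le.trans ?_
  simp only [card_product, Int.card_Icc, Nat.card_Icc]
  have : ((T:ℤ) + 1 - -(T:ℤ)).toNat = 2 * T + 1 := by omega
  rw [this]
  apply le_of_eq
  rw [Nat.add_sub_cancel]; ring

lemma add_inv_mono (a b : ℝ) (ha : 1 ≤ a) (hab : a ≤ b) : a + 1/a ≤ b + 1/b := by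
  have hb : 1 ≤ b := ha.trans hab
  have e : b + 1/b - (a + 1/a) = (b - a) * (a * b - 1) / (a * b) := by
    field_simp; ring
  have : 0 ≤ (b - a) * (a * b - 1) / (a * b) := by
    apply div_nonneg _ (by positivity)
    apply mul_nonneg (by linarith)
    nlinarith
  linarith

lemma add_inv_anti (a b : ℝ) (ha : 1 < a) (hb : 1 ≤ b) (h : a + 1/a ≤ b + 1/b) : a ≤ b := by
  by_contra hab
  push Not at hab
  have e : a + 1/a - (b + 1/b) = (a - b) * (a * b - 1) / (a * b) := by
    field_simp; ring
  have : 0 < (a - b) * (a * b - 1) / (a * b) := by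
    apply div_pos _ (by positivity)
    apply mul_pos (by linarith)
    nlinarith
  linarith

lemma specRad_lamT (σ : Matrix (Fin 2) (Fin 2) ℤ) : specRad σ = lamT (σ 0 0 + σ 1 1) := by
  unfold specRad lamT
  rw [Matrix.trace_fin_two]

lemma SS_data (α β₁ β₂ R ω : ℝ) (hβ₁ : 1 ≤ β₁) (hβ₂ : 1 ≤ β₂) (h : ω ∈ SS α β₁ β₂ R) :
    ∃ Λ : ℝ, 1 < Λ ∧ Λ ≤ Real.exp (R/2) ∧ 0 < OmegaTildeE ω 1 0 ∧
      P3 (OmegaTildeE ω 0 0) (OmegaTildeE ω 1 0) (OmegaTildeE ω 1 1) ∧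
      (OmegaTildeE ω 0 0 : ℝ) + OmegaTildeE ω 1 1 = Λ + 1/Λ ∧
      α * OmegaTildeE ω 1 0 ≤ OmegaTildeE ω 0 0 ∧
      -(OmegaTildeE ω 1 0 : ℝ) ≤ β₁ * OmegaTildeE ω 1 1 ∧
      (OmegaTildeE ω 1 1 : ℝ) < OmegaTildeE ω 1 0 / β₂ + 1 ∧
      ω = omT (OmegaTildeE ω 0 0) (OmegaTildeE ω 1 0) (OmegaTildeE ω 1 1) := by
  obtain ⟨h1, h2, h3, ω', hc, h4, h5, h6, h7⟩ := h
  obtain ⟨hdet, hpar, Λ, hΛ, hact⟩ := tilde_props ω hc.1 (periodic ω ω' hc h1 h4 h5)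
  obtain ⟨m1, m2, m3, m4⟩ := mat_props ω ω' Λ hc h1 h5 _ hdet hΛ hact
  have hP := par_P3 _ hdet hpar
  unfold rhoE at h3
  have hlam := specRad_lamT (OmegaTildeE ω)
  rw [m4] at h3 hlam
  obtain ⟨_, m2⟩ := m2
  obtain ⟨_, hact⟩ := hact
  generalize OmegaTildeE ω 0 0 = p at *
  generalize OmegaTildeE ω 1 0 = r at *
  generalize OmegaTildeE ω 1 1 = s at *
  have hr : (0:ℝ) < r := by exact_mod_cast m1
  have hμ : 0 < 1/Λ := by positivity
  have hμ1 : 1/Λ < 1 := by rw [div_lt_one (by linarith)]; exact hΛ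
  refine ⟨Λ, hΛ, ?_, m1, hP, m3, ?_, ?_, ?_, ?_⟩
  · rw [← Real.log_le_iff_le_exp (by linarith)]; linarith
  · have := mul_le_mul_of_nonneg_right h2 hr.le
    linarith
  · have := mul_le_mul_of_nonneg_left h7 hr.le
    have h8 : -((r:ℝ) * (1/β₁)) ≤ s := by linarith
    have h9 := mul_le_mul_of_nonneg_left h8 (by linarith : 0 ≤ β₁)
    have e : β₁ * -((r:ℝ) * (1/β₁)) = -r := by field_simp
    linarith
  · have := mul_le_mul_of_nonneg_left h6 hr.le
    have e : (r:ℝ) * -(1/β₂) = -(r/β₂) := by ring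
    linarith
  · unfold omT
    rw [← hlam, eq_div_iff hr.ne']
    linarith

lemma gT_inj (α β₁ β₂ R : ℝ) (hβ₁ : 1 ≤ β₁) (hβ₂ : 1 ≤ β₂) : Set.InjOn gT (SS α β₁ β₂ R) := by
  intro x hx y hy h
  obtain ⟨_, _, _, _, _, _, _, _, _, ex⟩ := SS_data α β₁ β₂ R x hβ₁ hβ₂ hx
  obtain ⟨_, _, _, _, _, _, _, _, _, ey⟩ := SS_data α β₁ β₂ R y hβ₁ hβ₂ hy
  simp only [gT, Prod.mk.injEq] at h
  rw [ex, ey, h.1, h.2.1, h.2.2]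

lemma size_bd (α β₁ X : ℝ) (p r s : ℤ) (hα : 1 ≤ α) (hβ₁ : 1 ≤ β₁) (hδ : 0 < α - 1/β₁) (hX : 0 ≤ X) (hr : 0 < r)
    (h1 : α * r ≤ p) (h2 : -(r:ℝ) ≤ β₁ * s) (h3 : (p:ℝ) + s ≤ X) :
    (α - 1/β₁) * r ≤ (p:ℝ) + s ∧ r ≤ (⌊(1 + 2/(α - 1/β₁)) * X⌋₊ : ℤ) ∧ 2 * r ≤ (⌊(1 + 2/(α - 1/β₁)) * X⌋₊ : ℤ) ∧
      r ≤ p ∧ p ≤ (⌊(1 + 2/(α - 1/β₁)) * X⌋₊ : ℤ) ∧ -r ≤ s ∧ -((r:ℝ)/β₁) ≤ s := by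
  set δ := α - 1/β₁ with hd
  have hr' : (0:ℝ) < r := by exact_mod_cast hr
  have a1 : -((r:ℝ)/β₁) ≤ s := by
    rw [neg_le, ← neg_le_neg_iff, neg_neg, div_eq_mul_inv, neg_le]
    rw [← div_eq_mul_inv, le_div_iff₀ (by linarith)] 
    linarith
  have a2 : δ * r ≤ (p:ℝ) + s := by
    have e : δ * r = α * r - r/β₁ := by rw [hd]; ring
    linarith
  have a3 : (r:ℝ) ≤ X / δ := by rw [le_div_iff₀ hδ]; linarith
  have a4 : (r:ℝ)/β₁ ≤ r := div_le_self hr'.le hβ₁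
  have a5 : (-r:ℝ) ≤ s := by linarith
  have a6 : (r:ℝ) ≤ p := by nlinarith
  have e : (1 + 2/δ) * X = X + 2 * (X/δ) := by ring
  have fl : ∀ z : ℤ, 0 ≤ z → (z:ℝ) ≤ (1 + 2/δ) * X → z ≤ (⌊(1 + 2/δ) * X⌋₊ : ℤ) := by
    intro z hz hzx
    lift z to ℕ using hz
    exact_mod_cast Nat.le_floor (by exact_mod_cast hzx)
  have a8 : (0:ℤ) ≤ p := by exact_mod_cast hr'.le.trans a6
  refine ⟨a2, fl _ hr.le (by rw [e]; linarith), fl _ (by omega) (by push_cast; rw [e]; linarith), by exact_mod_cast a6, 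
    fl _ a8 (by rw [e]; linarith), by exact_mod_cast a5, a1⟩

lemma incl1 (α β₁ β₂ R : ℝ) (hα : 1 ≤ α) (hβ₁ : 1 ≤ β₁) (hβ₂ : 1 ≤ β₂) (hδ : 0 < α - 1/β₁) :
    gT '' SS α β₁ β₂ R ⊆ Bset α β₁ β₂ (Real.exp (R/2) + 1/Real.exp (R/2)) ∪
      (BadF α β₁ β₂ ⌊(1 + 2/(α - 1/β₁)) * (Real.exp (R/2) + 1/Real.exp (R/2))⌋₊ : Set (ℤ × ℤ × ℤ)) := by
  rintro _ ⟨ω, hω, rfl⟩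
  obtain ⟨Λ, h1, h2, h3, h4, h5, h6, h7, h8, -⟩ := SS_data α β₁ β₂ R ω hβ₁ hβ₂ hω
  unfold gT
  generalize OmegaTildeE ω 0 0 = p at *
  generalize OmegaTildeE ω 1 0 = r at *
  generalize OmegaTildeE ω 1 1 = s at *
  have hX := add_inv_mono Λ _ h1.le h2
  rw [← h5] at hX
  set X := Real.exp (R/2) + 1/Real.exp (R/2) with hXd
  have hX0 : 0 ≤ X := by positivity
  by_cases hb : β₂ * s ≤ r
  · left
    exact ⟨h3, h6, h7, hb, hX, h4⟩
  · right
    push Not at hb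
    obtain ⟨b1, b2, b3, b4, b5, b6, b7⟩ := size_bd α β₁ X p r s hα hβ₁ hδ hX0 h3 h6 h7 hX
    have hs : s = ⌊(r:ℝ)/β₂⌋ + 1 := by
      have : ⌊(r:ℝ)/β₂⌋ = s - 1 := by
        rw [Int.floor_eq_iff]
        push_cast
        constructor
        · linarith
        · rw [div_lt_iff₀ (by linarith)]; linarith
      omega
    have := mem_lineS (fun r => ⌊(r:ℝ) / β₂⌋ + 1) _ p r s h3 b2 (by omega) b5 (P3_dvd _ _ _ h4) hs
    simp only [BadF, coe_union]
    exact Or.inl (Or.inl (Or.inl (Or.inl (Or.inl this))))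

end

section
open Finset

lemma ng_mem (δ X ω ω' l : ℝ) (γ : Matrix (Fin 2) (Fin 2) ℤ) (k : ℕ) (hδ : 0 < δ) (hX : 1 ≤ X)
    (hc : IsConjPair ω ω') (h1 : 1 < ω) (h2 : -1 < ω') (h3 : ω' < 1) (hd : δ ≤ ω - ω')
    (hk : 2 ≤ k) (hγ : γ = OmegaTildeE ω ^ k) (ha : Act γ ω l ω) (hl : l ≤ X) :
    (γ 0 0, γ 1 0, γ 1 1) ∈ NG ⌊(3 + 1/δ) * Real.sqrt X⌋₊ ⌊2 * Real.log X⌋₊ := by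
  obtain ⟨hdet, hpar, Λ, hΛ, hact⟩ := tilde_props ω hc.1 (periodic ω ω' hc h1 h2 h3)
  obtain ⟨m1, m2, m3, m4⟩ := mat_props ω ω' Λ hc h1 h3 _ hdet hΛ hact
  have hpow := Act_pow _ _ _ hact k
  rw [← hγ] at hpow
  have hlk : l = Λ ^ k := by rw [← ha.2, ← hpow.2]
  have hlam := specRad_lamT (OmegaTildeE ω)
  rw [m4] at hlam
  obtain ⟨_, m2⟩ := m2
  obtain ⟨_, hact⟩ := hact
  have hmat : OmegaTildeE ω = !![OmegaTildeE ω 0 0, (OmegaTildeE ω 0 0 * OmegaTildeE ω 1 1 - 1) / OmegaTildeE ω 1 0;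
      OmegaTildeE ω 1 0, OmegaTildeE ω 1 1] := by
    rw [Matrix.det_fin_two] at hdet
    have : (OmegaTildeE ω 0 0 * OmegaTildeE ω 1 1 - 1) / OmegaTildeE ω 1 0 = OmegaTildeE ω 0 1 := by
      apply Int.ediv_eq_of_eq_mul_left m1.ne'
      linarith
    rw [this]
    exact Matrix.eta_fin_two _
  unfold NG
  rw [mem_image]
  refine ⟨((OmegaTildeE ω 0 0, OmegaTildeE ω 1 0, OmegaTildeE ω 1 1), k), ?_, ?_⟩
  swap
  · unfold powT
    simp only
    rw [← hmat, ← hγ]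
  generalize OmegaTildeE ω 0 0 = p at *
  generalize OmegaTildeE ω 1 0 = r at *
  generalize OmegaTildeE ω 1 1 = s at *
  have hr : (0:ℝ) < r := by exact_mod_cast m1
  have hμ : 0 < 1/Λ := by positivity
  have hμ1 : 1/Λ < 1 := by rw [div_lt_one (by linarith)]; exact hΛ
  have hΛ2 : 2 ≤ Λ := by
    have ht : 3 ≤ p + s := by
      have h4 : (2:ℝ) < p + s := by
        rw [m3]
        have e : Λ + 1/Λ - 2 = (Λ - 1)^2/Λ := by field_simp; ring
        have : 0 < (Λ - 1)^2/Λ := by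
          apply div_pos _ (by linarith)
          exact pow_pos (by linarith) 2
        linarith
      have : (2:ℤ) < p + s := by exact_mod_cast h4
      omega
    rw [hlam]; exact (lamT_props _ ht).2.2.2
  have hsq : Λ ≤ Real.sqrt X := by
    apply Real.le_sqrt_of_sq_le
    exact (pow_le_pow_right₀ hΛ.le hk).trans (by rw [← hlk]; exact hl)
  have hs1 : 1 ≤ Real.sqrt X := by linarith
  have hrb : (r:ℝ) ≤ 1/δ * Real.sqrt X := by
    have a1 := mul_le_mul_of_nonneg_left hd hr.le
    have a2 : (r:ℝ) * δ ≤ Λ := by linarith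
    have : (r:ℝ) ≤ Λ/δ := by rw [le_div_iff₀ hδ]; exact a2
    have a3 : Λ/δ ≤ Real.sqrt X/δ := by gcongr
    have e : 1/δ * Real.sqrt X = Real.sqrt X/δ := by ring
    linarith
  have sb1 : -(r:ℝ) ≤ s := by
    have := mul_le_mul_of_nonneg_left h3.le hr.le
    linarith
  have sb2 : (s:ℝ) ≤ 1 + r := by
    have := mul_le_mul_of_nonneg_left h2.le hr.le
    linarith
  have e : (3 + 1/δ) * Real.sqrt X = 3 * Real.sqrt X + 1/δ * Real.sqrt X := by ring
  have fl : ∀ z : ℤ, |(z:ℝ)| ≤ (3 + 1/δ) * Real.sqrt X → z ∈ Icc (-(⌊(3 + 1/δ) * Real.sqrt X⌋₊:ℤ)) (⌊(3 + 1/δ) * Real.sqrt X⌋₊:ℤ) := by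
    intro z hz
    have h5 : z.natAbs ≤ ⌊(3 + 1/δ) * Real.sqrt X⌋₊ := by
      apply Nat.le_floor
      rw [Nat.cast_natAbs]; push_cast; exact hz
    rw [mem_Icc]; omega
  simp only [mem_product]
  refine ⟨⟨fl _ ?_, fl _ ?_, fl _ ?_⟩, ?_⟩
  · rw [abs_le, e]; constructor <;> linarith
  · rw [abs_le, e]; constructor <;> linarith
  · rw [abs_le, e]; constructor <;> linarith
  · rw [mem_Icc]
    refine ⟨by omega, Nat.le_floor ?_⟩
    have a1 : (2:ℝ)^k ≤ X := (pow_le_pow_left₀ (by norm_num) hΛ2 k).trans (by rw [← hlk]; exact hl)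
    have a2 := Real.log_le_log (by positivity) a1
    rw [Real.log_pow] at a2
    have a3 := Real.log_two_gt_d9
    have a4 : (k:ℝ) * (1/2) ≤ k * Real.log 2 := by
      apply mul_le_mul_of_nonneg_left (by linarith) (by positivity)
    linarith

lemma incl2 (α β₁ β₂ R : ℝ) (hα : 1 ≤ α) (hβ₁ : 1 ≤ β₁) (hβ₂ : 1 ≤ β₂) (hδ : 0 < α - 1/β₁) (hR : 0 < R) :
    Bset α β₁ β₂ (Real.exp (R/2) + 1/Real.exp (R/2)) ⊆ gT '' SS α β₁ β₂ R ∪ 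
      ((BadF α β₁ β₂ ⌊(1 + 2/(α - 1/β₁)) * (Real.exp (R/2) + 1/Real.exp (R/2))⌋₊ : Set (ℤ × ℤ × ℤ)) ∪
      (NG ⌊(3 + 1/(α - 1/β₁)) * Real.sqrt (Real.exp (R/2) + 1/Real.exp (R/2))⌋₊ 
        ⌊2 * Real.log (Real.exp (R/2) + 1/Real.exp (R/2))⌋₊ : Set (ℤ × ℤ × ℤ))) := by
  rintro ⟨p, r, s⟩ ⟨h1, h2, h3, h4, h5, h6⟩
  simp only at h1 h2 h3 h4 h5 h6
  have hN : 1 ≤ Real.exp (R/2) := Real.one_le_exp (by linarith)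
  have hNl : Real.log (Real.exp (R/2)) = R/2 := Real.log_exp _
  set N := Real.exp (R/2) with hNd
  set X := N + 1/N with hXd
  have hNX : N ≤ X := by
    have : 0 < 1/N := by positivity
    linarith
  have hX0 : 0 ≤ X := by linarith
  obtain ⟨b1, b2, b3, b4, b5, b6, b7⟩ := size_bd α β₁ X p r s hα hβ₁ hδ hX0 h1 h2 h3 h5
  set L := ⌊(1 + 2/(α - 1/β₁)) * X⌋₊ with hL
  have hr : (0:ℝ) < r := by exact_mod_cast h1
  have hdv := P3_dvd p r s h6
  have hsr' : (s:ℝ) ≤ r / β₂ := by rw [le_div_iff₀ (by linarith)]; linarith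
  have hsr : s ≤ r := by
    have : (r:ℝ)/β₂ ≤ r := div_le_self hr.le hβ₂
    exact_mod_cast hsr'.trans this
  have hev := P3_even p r s h6
  have hpos : 0 < p + s := by
    have : (0:ℝ) < (p:ℝ) + s := lt_of_lt_of_le (by positivity) b1
    exact_mod_cast this
  have hs1 : -(L:ℤ) ≤ s := by omega
  have hs2 : s ≤ L := by omega
  by_cases ht : p + s = 2
  · right; left
    have : p = r ∨ p = r + 1 ∨ p = r + 2 := by omega
    simp only [BadF, coe_union]
    rcases this with h | h | h
    · exact Or.inl (Or.inl (Or.inr (mem_lineP (fun r => r) L p r s h1 b2 hs1 hs2 hdv h)))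
    · exact Or.inl (Or.inr (mem_lineP (fun r => r + 1) L p r s h1 b2 hs1 hs2 hdv h))
    · exact Or.inr (mem_lineP (fun r => r + 2) L p r s h1 b2 hs1 hs2 hdv h)
  have ht3 : 3 ≤ p + s := by
    obtain ⟨c, hc⟩ := hev
    omega
  obtain ⟨q, hq, ha, hb, hc, hirr⟩ := from_triple p r s h1 h6 ht3
  obtain ⟨l1, l2, l3, l4⟩ := lamT_props (p+s) ht3
  have hω : (r:ℝ) * omT p r s = p - 1/lamT (p+s) := by unfold omT; field_simp
  have hω' : (r:ℝ) * omT' p r s = 1/lamT (p+s) - s := by unfold omT'; field_simp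
  set l := lamT (p+s) with hl
  set ω := omT p r s with hωd
  set ω' := omT' p r s with hωd'
  have hμ : 0 < 1/l := by positivity
  have hμ1 : 1/l < 1 := by rw [div_lt_one (by linarith)]; exact l1
  push_cast at l2
  by_cases hbad1 : (p:ℝ) - 1/l < α * r
  · right; left
    simp only [BadF, coe_union]
    refine Or.inl (Or.inl (Or.inl (Or.inr (mem_lineP (fun r => ⌈α * (r:ℝ)⌉) L p r s h1 b2 hs1 hs2 hdv ?_))))
    symm
    rw [Int.ceil_eq_iff]
    exact ⟨by linarith, h2⟩
  by_cases hbad2 : (r:ℝ)/β₁ < 1/l - s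
  · right; left
    simp only [BadF, coe_union]
    refine Or.inl (Or.inl (Or.inl (Or.inl (Or.inr (mem_lineS (fun r => ⌈-((r:ℝ) / β₁)⌉) L p r s h1 b2 (by omega) b5 hdv ?_)))))
    symm
    rw [Int.ceil_eq_iff]
    exact ⟨by linarith, b7⟩
  push Not at hbad1 hbad2
  have c1 : α ≤ ω := by
    apply le_of_mul_le_mul_left _ hr
    linarith
  have c2 : ω' ≤ 1/β₁ := by
    apply le_of_mul_le_mul_left _ hr
    rw [mul_one_div]; linarith
  have c3 : -(1/β₂) ≤ ω' := by
    apply le_of_mul_le_mul_left _ hr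
    rw [mul_neg, mul_one_div]; linarith
  have c4 : 1/β₁ ≤ 1 := by rw [div_le_one (by linarith)]; exact hβ₁
  have c5 : 1/β₂ ≤ 1 := by rw [div_le_one (by linarith)]; exact hβ₂
  have d1 : 1 < ω := lt_of_le_of_ne (by linarith) (Ne.symm (by simpa using hc.1.ne_one))
  have d2 : ω' < 1 := lt_of_le_of_ne (by linarith) (by simpa using hirr.ne_one)
  have d3 : -1 < ω' := by
    refine lt_of_le_of_ne (by linarith) (Ne.symm ?_)
    have := hirr.ne_int (-1)
    push_cast at this
    exact this
  have hdet : (!![p, q; r, s] : Matrix (Fin 2) (Fin 2) ℤ).det = 1 := by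
    rw [Matrix.det_fin_two_of]; linarith
  obtain ⟨n, hn, hper, hγ⟩ := key_peel ω ω' l (1/l) !![p, q; r, s] hc.1 d1 d3 d2 hdet (P3_par p q r s h1 hq h6) 
    (by simpa using h1) ha hb hμ hμ1
  obtain ⟨k, hk, hpow⟩ := pow_tilde ω n hn hper (by rw [← hγ]; exact hdet)
  rw [← hγ] at hpow
  have hlN : l ≤ N := add_inv_anti l N l1 hN (by linarith)
  by_cases hk1 : k = 1
  · left
    rw [hk1, pow_one] at hpow
    refine ⟨ω, ⟨d1, c1, ?_, ω', hc, d3, d2, c3, c2⟩, ?_⟩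
    · unfold rhoE
      rw [← hpow, specRad_lamT]
      simp only [Matrix.of_apply, Matrix.cons_val', Matrix.cons_val_zero, Matrix.cons_val_one, Matrix.cons_val_fin_one]
      rw [← hl]
      have := Real.log_le_log (by linarith) hlN
      linarith
    · unfold gT
      rw [← hpow]
      simp
  · right; right
    have := ng_mem (α - 1/β₁) X ω ω' l _ k hδ (by linarith) hc d1 d3 d2 (by linarith) (by omega) hpow ha (by linarith)
    simpa using this

end

section
open Finset

lemma err_total (α β₁ β₂ ε : ℝ) (hδ : 0 < α - 1/β₁) (hε : 0 < ε) : ∃ K : ℝ, 0 ≤ K ∧ ∀ X : ℝ, 2 ≤ X →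
    ((BadF α β₁ β₂ ⌊(1 + 2/(α - 1/β₁)) * X⌋₊).card : ℝ) +
      ((NG ⌊(3 + 1/(α - 1/β₁)) * Real.sqrt X⌋₊ ⌊2 * Real.log X⌋₊).card : ℝ) ≤ K * X ^ (3/2 + ε) := by
  set δ := α - 1/β₁ with hd
  refine ⟨60 * (1 + 2/δ) ^ (3/2:ℝ) + (2 * (3 + 1/δ) + 1)^3 * (2 * (1 + 1/ε)), by positivity, ?_⟩
  intro X hX
  have hX1 : 1 ≤ X := by linarith
  have hXε : 1 ≤ X ^ ε := Real.one_le_rpow hX1 hε.le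
  have hadd : X ^ (3/2 + ε) = X ^ (3/2:ℝ) * X ^ ε := Real.rpow_add (by linarith) _ _
  have hX32 : X ^ (3/2:ℝ) = Real.sqrt X ^ 3 := by
    rw [Real.sqrt_eq_rpow, ← Real.rpow_natCast, ← Real.rpow_mul (by linarith)]
    norm_num
  have hXp : 0 < X ^ (3/2:ℝ) := by positivity
  have h2 : 0 < 2/δ := by positivity
  have h1 : 0 < 1/δ := by positivity
  have hB : ((BadF α β₁ β₂ ⌊(1 + 2/δ) * X⌋₊).card : ℝ) ≤ 60 * (1 + 2/δ) ^ (3/2:ℝ) * X ^ (3/2 + ε) := by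
    have hL : 1 ≤ ⌊(1 + 2/δ) * X⌋₊ := by
      apply Nat.le_floor
      push_cast
      nlinarith
    refine (card_BadF α β₁ β₂ _ hL).trans ?_
    have a1 : ((⌊(1 + 2/δ) * X⌋₊ : ℕ) : ℝ) ≤ (1 + 2/δ) * X := Nat.floor_le (by positivity)
    have a2 : ((⌊(1 + 2/δ) * X⌋₊ : ℕ) : ℝ) ^ (3/2:ℝ) ≤ ((1 + 2/δ) * X) ^ (3/2:ℝ) := by gcongr
    rw [Real.mul_rpow (by positivity) (by linarith)] at a2
    have a3 : X ^ (3/2:ℝ) ≤ X ^ (3/2 + ε) := Real.rpow_le_rpow_of_exponent_le hX1 (by linarith)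
    calc 60 * ((⌊(1 + 2/δ) * X⌋₊ : ℕ) : ℝ) ^ (3/2:ℝ) ≤ 60 * ((1 + 2/δ) ^ (3/2:ℝ) * X ^ (3/2:ℝ)) := by gcongr
      _ ≤ 60 * ((1 + 2/δ) ^ (3/2:ℝ) * X ^ (3/2 + ε)) := by gcongr
      _ = _ := by ring
  have hNG : ((NG ⌊(3 + 1/δ) * Real.sqrt X⌋₊ ⌊2 * Real.log X⌋₊).card : ℝ) ≤ 
      (2 * (3 + 1/δ) + 1)^3 * (2 * (1 + 1/ε)) * X ^ (3/2 + ε) := by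
    have b1 := (Nat.cast_le (α := ℝ)).mpr (card_NG ⌊(3 + 1/δ) * Real.sqrt X⌋₊ ⌊2 * Real.log X⌋₊)
    push_cast at b1
    refine b1.trans ?_
    have hs1 : 1 ≤ Real.sqrt X := Real.le_sqrt_of_sq_le (by linarith)
    have hlog : 0 ≤ Real.log X := Real.log_nonneg hX1
    have a1 : ((⌊(3 + 1/δ) * Real.sqrt X⌋₊ : ℕ) : ℝ) ≤ (3 + 1/δ) * Real.sqrt X := Nat.floor_le (by positivity)
    have a2 : ((⌊2 * Real.log X⌋₊ : ℕ) : ℝ) ≤ 2 * Real.log X := Nat.floor_le (by positivity)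
    have a3 := log_bound ε hε X hX1
    have a4 : 2 * ((⌊(3 + 1/δ) * Real.sqrt X⌋₊ : ℕ) : ℝ) + 1 ≤ (2 * (3 + 1/δ) + 1) * Real.sqrt X := by linarith
    have a5 : ((⌊2 * Real.log X⌋₊ : ℕ) : ℝ) ≤ 2 * ((1 + 1/ε) * X ^ ε) := by linarith
    calc _ ≤ ((2 * (3 + 1/δ) + 1) * Real.sqrt X)^3 * (2 * ((1 + 1/ε) * X ^ ε)) := by gcongr
      _ = _ := by rw [hadd, hX32]; ring
  linarith

lemma main_final (α β₁ β₂ : ℝ) (hα : 1 ≤ α) (hβ₁ : 1 ≤ β₁) (hβ₂ : 1 ≤ β₂)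
    (hne : (α, β₁) ≠ (1, 1)) (ε : ℝ) (hε : 0 < ε) : ∃ K > (0:ℝ), ∀ R > (0:ℝ),
      |((SS α β₁ β₂ R).ncard : ℝ) - (1 / Real.pi ^ 2) *
          Real.log ((α * β₂ + 1) / (α * β₂) * (α * β₁ / (α * β₁ - 1))) * Real.exp R|
      ≤ K * Real.exp ((3 / 4 + ε) * R) := by
  have hab : 1 < α * β₁ := by
    rcases hα.lt_or_eq with h | h
    · nlinarith
    · rcases hβ₁.lt_or_eq with h' | h'
      · nlinarith
      · exact absurd (by rw [← h, ← h']) hne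
  have hδ : 0 < α - 1/β₁ := by
    have e : α - 1/β₁ = (α * β₁ - 1)/β₁ := by field_simp
    rw [e]
    exact div_pos (by linarith) (by linarith)
  have hκ : 1/(2*β₁) < α/2 := by
    have e : 1/(2*β₁) = (1/β₁)/2 := by field_simp
    rw [e]; linarith
  have hlog : (α/2 + 1/(2*β₂))/(α/2 - 1/(2*β₁)) = (α * β₂ + 1) / (α * β₂) * (α * β₁ / (α * β₁ - 1)) := by
    have n1 : α * β₁ - 1 ≠ 0 := by linarith
    have n2 : α/2 - 1/(2*β₁) ≠ 0 := by linarith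
    have e1 : α/2 + 1/(2*β₂) = (α * β₂ + 1)/(2 * β₂) := by field_simp
    have e2 : α/2 - 1/(2*β₁) = (α * β₁ - 1)/(2 * β₁) := by field_simp
    rw [e1, e2]
    have n3 : β₁ ≠ 0 := by linarith
    have n4 : β₂ ≠ 0 := by linarith
    have n5 : α ≠ 0 := by linarith
    field_simp
  obtain ⟨K1, hK1, H1⟩ := B_asymp α β₁ β₂ hα hβ₁ hβ₂ hκ (2*ε) (by linarith)
  obtain ⟨K2, hK2, H2⟩ := err_total α β₁ β₂ (2*ε) hδ (by linarith)
  rw [hlog] at H1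
  generalize Real.log ((α * β₂ + 1) / (α * β₂) * (α * β₁ / (α * β₁ - 1))) = W at *
  refine ⟨(K1 + K2) * 2 ^ (3/2 + 2*ε) + 3 * |W| / Real.pi^2 + 1, by positivity, ?_⟩
  intro R hR
  have i1 := incl1 α β₁ β₂ R hα hβ₁ hβ₂ hδ
  have i2 := incl2 α β₁ β₂ R hα hβ₁ hβ₂ hδ hR
  have hN : 1 ≤ Real.exp (R/2) := Real.one_le_exp (by linarith)
  have hNsq : Real.exp (R/2)^2 = Real.exp R := by
    rw [← Real.exp_nat_mul]; congr 1; push_cast; ring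
  have hNpow : Real.exp (R/2) ^ (3/2 + 2*ε) = Real.exp ((3/4 + ε) * R) := by
    rw [← Real.exp_mul]; congr 1; ring
  have hE1 : 1 ≤ Real.exp ((3/4 + ε) * R) := Real.one_le_exp (by positivity)
  set N := Real.exp (R/2) with hNd
  set X := N + 1/N with hXd
  have hN1 : 1/N ≤ 1 := by rw [div_le_one (by linarith)]; exact hN
  have hN0 : 0 < 1/N := by positivity
  have hX2 : 2 ≤ X := by
    have := add_inv_mono 1 N le_rfl hN
    norm_num at this
    rw [hXd]; norm_num; linarith
  obtain ⟨f1, f2⟩ := H1 X hX2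
  have f3 := H2 X hX2
  set Bd1 := BadF α β₁ β₂ ⌊(1 + 2/(α - 1/β₁)) * X⌋₊ with hBd1
  set Ng1 := NG ⌊(3 + 1/(α - 1/β₁)) * Real.sqrt X⌋₊ ⌊2 * Real.log X⌋₊ with hNg1
  have hfinI : (gT '' SS α β₁ β₂ R).Finite := (f1.union Bd1.finite_toSet).subset i1
  have hcard : (gT '' SS α β₁ β₂ R).ncard = (SS α β₁ β₂ R).ncard :=
    Set.ncard_image_of_injOn (gT_inj α β₁ β₂ R hβ₁ hβ₂)
  have n1 : (SS α β₁ β₂ R).ncard ≤ (Bset α β₁ β₂ X).ncard + Bd1.card := by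
    rw [← hcard, ← Set.ncard_coe_finset]
    exact (Set.ncard_le_ncard i1 (f1.union Bd1.finite_toSet)).trans (Set.ncard_union_le _ _)
  have n2 : (Bset α β₁ β₂ X).ncard ≤ (SS α β₁ β₂ R).ncard + (Bd1.card + Ng1.card) := by
    rw [← hcard, ← Set.ncard_coe_finset, ← Set.ncard_coe_finset]
    refine (Set.ncard_le_ncard i2 (hfinI.union (Bd1.finite_toSet.union Ng1.finite_toSet))).trans ?_
    refine (Set.ncard_union_le _ _).trans (Nat.add_le_add_left (Set.ncard_union_le _ _) _)
  have n1' := (Nat.cast_le (α := ℝ)).mpr n1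
  have n2' := (Nat.cast_le (α := ℝ)).mpr n2
  push_cast at n1' n2'
  have hng : (0:ℝ) ≤ Ng1.card := by positivity
  have n3 : |((SS α β₁ β₂ R).ncard : ℝ) - (Bset α β₁ β₂ X).ncard| ≤ K2 * X ^ (3/2 + 2*ε) := by
    rw [abs_le]; constructor <;> linarith
  have hXN : X ≤ 2 * N := by linarith
  have hXp : X ^ (3/2 + 2*ε) ≤ 2 ^ (3/2 + 2*ε) * Real.exp ((3/4 + ε) * R) := by
    rw [← hNpow, ← Real.mul_rpow (by norm_num) (by linarith)]
    exact Real.rpow_le_rpow (by linarith) hXN (by linarith)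
  have hXsq : X^2 - Real.exp R = 2 + (1/N)^2 := by
    rw [← hNsq, hXd]; field_simp; ring
  have n4 : |X^2 / Real.pi^2 * W - (1 / Real.pi ^ 2) * W * Real.exp R| ≤ 3 * |W| / Real.pi^2 := by
    have e : X^2 / Real.pi^2 * W - (1 / Real.pi ^ 2) * W * Real.exp R = (2 + (1/N)^2) * (W / Real.pi^2) := by
      rw [← hXsq]; ring
    rw [e, abs_mul, abs_div, abs_of_nonneg (by positivity : 0 ≤ 2 + (1/N)^2), abs_of_nonneg (by positivity : 0 ≤ Real.pi^2)]
    have : (1/N)^2 ≤ 1 := pow_le_one₀ hN0.le hN1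
    calc (2 + (1/N)^2) * (|W| / Real.pi^2) ≤ 3 * (|W| / Real.pi^2) := by gcongr; linarith
      _ = _ := by ring
  have t1 := abs_sub_le ((SS α β₁ β₂ R).ncard : ℝ) ((Bset α β₁ β₂ X).ncard : ℝ) ((1 / Real.pi ^ 2) * W * Real.exp R)
  have t2 := abs_sub_le ((Bset α β₁ β₂ X).ncard : ℝ) (X^2 / Real.pi^2 * W) ((1 / Real.pi ^ 2) * W * Real.exp R)
  have u1 := mul_le_mul_of_nonneg_left hXp (by linarith : 0 ≤ K1 + K2)
  have u2 : 3 * |W| / Real.pi^2 * 1 ≤ 3 * |W| / Real.pi^2 * Real.exp ((3/4 + ε) * R) := 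
    mul_le_mul_of_nonneg_left hE1 (by positivity)
  have e : ((K1 + K2) * 2 ^ (3/2 + 2*ε) + 3 * |W| / Real.pi^2 + 1) * Real.exp ((3/4 + ε) * R) =
    (K1 + K2) * (2 ^ (3/2 + 2*ε) * Real.exp ((3/4 + ε) * R)) + 3 * |W| / Real.pi^2 * Real.exp ((3/4 + ε) * R) + Real.exp ((3/4 + ε) * R) := by ring
  rw [e]
  linarith

end

theorem stmt0 (α β₁ β₂ : ℝ) (hα : 1 ≤ α) (hβ₁ : 1 ≤ β₁) (hβ₂ : 1 ≤ β₂)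
    (hne : (α, β₁) ≠ (1, 1)) :
    ∀ ε > (0 : ℝ), ∃ K > (0 : ℝ), ∀ R > (0 : ℝ),
      |({ω : ℝ | 1 < ω ∧ α ≤ ω ∧ rhoE ω ≤ R ∧
          ∃ ω' : ℝ, IsConjPair ω ω' ∧ -1 < ω' ∧ ω' < 1 ∧
            -(1 / β₂) ≤ ω' ∧ ω' ≤ 1 / β₁}.ncard : ℝ) -
        (1 / Real.pi ^ 2) *
          Real.log ((α * β₂ + 1) / (α * β₂) * (α * β₁ / (α * β₁ - 1))) * Real.exp R|
      ≤ K * Real.exp ((3 / 4 + ε) * R) := by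
  intro ε hε
  exact main_final α β₁ β₂ hα hβ₁ hβ₂ hne ε hε
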